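/- Let n ≥ 2 and let U ⊆ ℝ^n be open and connected. Suppose g is a pseudo-Riemannian metric of class C^2 on U that is Einstein (i.e., Ric(g)_{ij} = c · g_{ij} on U for some constant c), ḡ is a pseudo-Riemannian metric of class C^1 on U, and g and ḡ are geodesically related via a continuous 1-form ψ that is not identically zero on U. Then ḡ is of class C^2 on U and ḡ is Einstein, i.e., there exists a constant c̄ such that Ric(ḡ)_{ij} = c̄ · ḡ_{ij} on U. -/

import Mathlib

noncomputable section
open scoped BigOperators

/-- Partial derivative `∂_i f` of `f : ℝⁿ → ℝ` in the `i`-th coordinate direction. -/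
def pd {n : ℕ} (i : Fin n) (f : (Fin n → ℝ) → ℝ) (x : Fin n → ℝ) : ℝ :=
  fderiv ℝ f x (Pi.single i 1)

/-- The matrix `(g_{ij}(x))` of a two-index family of functions at a point `x`. -/
def matAt {n : ℕ} (g : Fin n → Fin n → (Fin n → ℝ) → ℝ) (x : Fin n → ℝ) :
    Matrix (Fin n) (Fin n) ℝ := Matrix.of fun i j => g i j x

/-- The components `g^{ij}(x)` of the pointwise inverse matrix. -/
def ginv {n : ℕ} (g : Fin n → Fin n → (Fin n → ℝ) → ℝ) (i j : Fin n) (x : Fin n → ℝ) : ℝ :=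
  (matAt g x)⁻¹ i j

/-- `g` is a pseudo-Riemannian metric of class `C^r` on `U`: the components are
symmetric, of class `C^r`, and the matrix `(g_{ij}(x))` is invertible for every `x ∈ U`. -/
structure IsMetric {n : ℕ} (r : WithTop ℕ∞) (g : Fin n → Fin n → (Fin n → ℝ) → ℝ)
    (U : Set (Fin n → ℝ)) : Prop where
  symm : ∀ i j, ∀ x ∈ U, g i j x = g j i x
  contDiff : ∀ i j, ContDiffOn ℝ r (g i j) U
  inv : ∀ x ∈ U, IsUnit (matAt g x).det

/-- Christoffel symbols `Γ^h_{ij} = (1/2) g^{hk}(∂_i g_{jk} + ∂_j g_{ik} − ∂_k g_{ij})`. -/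
def Christoffel {n : ℕ} (g : Fin n → Fin n → (Fin n → ℝ) → ℝ) (h i j : Fin n)
    (x : Fin n → ℝ) : ℝ :=
  (1/2) * ∑ k, ginv g h k x * (pd i (g j k) x + pd j (g i k) x - pd k (g i j) x)

/-- `g` and `gbar` are geodesically related via the 1-form `ψ`:
`Γ̄^h_{ij} = Γ^h_{ij} + ψ_i δ^h_j + ψ_j δ^h_i` on `U`. -/
def GeodesicallyRelated {n : ℕ} (g gbar : Fin n → Fin n → (Fin n → ℝ) → ℝ)
    (ψ : Fin n → (Fin n → ℝ) → ℝ) (U : Set (Fin n → ℝ)) : Prop :=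
  ∀ h i j, ∀ x ∈ U, Christoffel gbar h i j x =
    Christoffel g h i j x + ψ i x * (if h = j then (1:ℝ) else 0)
      + ψ j x * (if h = i then (1:ℝ) else 0)

/-- Ricci tensor `Ric(g)_{ij} = ∂_α Γ^α_{ij} − ∂_j Γ^α_{iα} + Γ^α_{αβ} Γ^β_{ij} − Γ^α_{jβ} Γ^β_{iα}`. -/
def Ricci {n : ℕ} (g : Fin n → Fin n → (Fin n → ℝ) → ℝ) (i j : Fin n) (x : Fin n → ℝ) : ℝ :=
  (∑ a, pd a (Christoffel g a i j) x) - pd j (fun y => ∑ a, Christoffel g a i a y) x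
    + (∑ a, ∑ b, Christoffel g a a b x * Christoffel g b i j x)
    - (∑ a, ∑ b, Christoffel g a j b x * Christoffel g b i a x)

/-- A commutative algebra with commuting derivations `d i` and a symmetric nondegenerate
matrix `g` with inverse `G`: the algebraic data of a metric in coordinates. -/
structure MetricAlgebra (n : ℕ) (S : Type*) [CommRing S] [Algebra ℝ S] where
  d : Fin n → Derivation ℝ S S
  d_comm : ∀ i j u, d i (d j u) = d j (d i u)
  g : Fin n → Fin n → S
  G : Fin n → Fin n → S
  g_symm : ∀ i j, g i j = g j i
  G_symm : ∀ i j, G i j = G j i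
  G_mul_g : ∀ i j, ∑ k, G i k * g k j = if i = j then 1 else 0

theorem levi_civita_compat {n : ℕ} {S : Type*} [CommRing S] [Algebra ℝ S]
    {g G : Fin n → Fin n → S} {dg : Fin n → Fin n → Fin n → S}
    (hg : ∀ i j, g i j = g j i) (hgG : ∀ i j, ∑ k, g i k * G k j = if i = j then 1 else 0)
    (hdg : ∀ k i j, dg k i j = dg k j i) (Γ : Fin n → Fin n → Fin n → S)
    (hΓ : ∀ h i j, Γ h i j = (1 / 2 : ℝ) • ∑ k, G h k * (dg i j k + dg j i k - dg k i j))
    (k i j : Fin n) :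
    dg k i j = ∑ a, Γ a k i * g a j + ∑ a, Γ a k j * g i a := by
  have key : ∀ j k i, ∑ a, Γ a k i * g a j = (1 / 2 : ℝ) • (dg k i j + dg i k j - dg j k i) := by
    intro j k i
    have : ∀ a, Γ a k i * g a j =
        ∑ l, (1 / 2 : ℝ) • ((g j a * G a l) * (dg k i l + dg i k l - dg l k i)) := by
      intro a
      rw [hΓ, smul_mul_assoc, Finset.sum_mul, Finset.smul_sum, hg a j]
      refine Finset.sum_congr rfl fun l _ => ?_
      congr 1; ring
    simp_rw [this]
    rw [Finset.sum_comm]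
    simp_rw [← Finset.smul_sum, ← Finset.sum_mul, hgG]
    simp
  have e2 : ∑ a, Γ a k j * g i a = ∑ a, Γ a k j * g a i :=
    Finset.sum_congr rfl fun a _ => by rw [hg i a]
  rw [e2, key, key, ← smul_add, hdg i k j, hdg j k i]
  have : dg k i j + dg i j k - dg j i k + (dg k j i + dg j i k - dg i j k) = (2 : ℝ) • dg k i j := by
    rw [hdg k j i, two_smul]; abel
  rw [hdg k j i, hdg j i k, hdg i j k] at *
  rw [this, smul_smul]; norm_num

namespace MetricAlgebra

variable {n : ℕ} {S : Type*} [CommRing S] [Algebra ℝ S] (W : MetricAlgebra n S)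

/-- Christoffel symbols. -/
def chr (h i j : Fin n) : S :=
  (1 / 2 : ℝ) • ∑ k, W.G h k * (W.d i (W.g j k) + W.d j (W.g i k) - W.d k (W.g i j))

/-- The contraction `Γ^a_{mi} X_a`. -/
def corr (m : Fin n) (X : Fin n → S) (i : Fin n) : S := ∑ a, W.chr a m i * X a

/-- Covariant derivative of a covector. -/
def cov1 (X : Fin n → S) (m i : Fin n) : S := W.d m (X i) - W.corr m X i

/-- Covariant derivative of a 2-tensor. -/
def cov2 (X : Fin n → Fin n → S) (m i j : Fin n) : S :=
  W.d m (X i j) - W.corr m (fun a => X a j) i - W.corr m (fun a => X i a) j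

/-- Covariant derivative of a 3-tensor. -/
def cov3 (X : Fin n → Fin n → Fin n → S) (m i j k : Fin n) : S :=
  W.d m (X i j k) - W.corr m (fun a => X a j k) i - W.corr m (fun a => X i a k) j
    - W.corr m (fun a => X i j a) k

/-- Covariant derivative of a 4-tensor. -/
def cov4 (X : Fin n → Fin n → Fin n → Fin n → S) (m i j k l : Fin n) : S :=
  W.d m (X i j k l) - W.corr m (fun a => X a j k l) i - W.corr m (fun a => X i a k l) j
    - W.corr m (fun a => X i j a l) k - W.corr m (fun a => X i j k a) l

/-- Metric trace of a 2-tensor. -/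
def tr (X : Fin n → Fin n → S) : S := ∑ i, ∑ j, W.G i j * X i j

/-- Curvature tensor `R^h_{ikl}`. -/
def Rup (h i k l : Fin n) : S :=
  W.d k (W.chr h l i) - W.d l (W.chr h k i)
    + ((∑ a, W.chr h k a * W.chr a l i) - ∑ a, W.chr h l a * W.chr a k i)

/-- Curvature tensor `R_{hikl}`. -/
def Rlow (h i k l : Fin n) : S := ∑ a, W.g h a * W.Rup a i k l

/-- Ricci tensor. -/
def ric (i l : Fin n) : S := ∑ k, W.Rup k i k l

theorem g_mul_G (i j : Fin n) : ∑ k, W.g i k * W.G k j = if i = j then 1 else 0 := by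
  have h1 : (Matrix.of W.G) * (Matrix.of W.g) = 1 := by
    ext i j; simp [Matrix.mul_apply, W.G_mul_g, Matrix.one_apply]
  have h2 := mul_eq_one_comm.mp h1
  have := congrFun (congrFun h2 i) j
  simpa [Matrix.mul_apply, Matrix.one_apply] using this

theorem chr_symm (h i j : Fin n) : W.chr h i j = W.chr h j i := by
  unfold chr
  congr 1
  refine Finset.sum_congr rfl fun k _ => ?_
  rw [W.g_symm i j]; ring

theorem d_g (k i j : Fin n) :
    W.d k (W.g i j) = ∑ a, W.chr a k i * W.g a j + ∑ a, W.chr a k j * W.g i a :=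
  levi_civita_compat (dg := fun k i j => W.d k (W.g i j)) W.g_symm W.g_mul_G
    (fun k i j => by simp only [W.g_symm i j]) W.chr (fun _ _ _ => rfl) k i j

theorem cov2_g (k i j : Fin n) : W.cov2 W.g k i j = 0 := by
  simp only [cov2, corr, W.d_g]; ring

theorem sum_G_g (x : Fin n → S) (m : Fin n) :
    ∑ i, ∑ j, W.G i j * (x i * W.g j m) = x m := by
  simp_rw [mul_left_comm (W.G _ _), ← Finset.mul_sum, W.G_mul_g]
  simp

theorem tr_mul_g (x : Fin n → S) (m : Fin n) : W.tr (fun i j => x i * W.g j m) = x m :=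
  W.sum_G_g x m

theorem tr_swap (X : Fin n → Fin n → S) : W.tr (fun i j => X j i) = W.tr X := by
  unfold tr
  rw [Finset.sum_comm]
  refine Finset.sum_congr rfl fun j _ => Finset.sum_congr rfl fun i _ => ?_
  rw [W.G_symm i j]

theorem tr_add (X Y : Fin n → Fin n → S) :
    W.tr (fun i j => X i j + Y i j) = W.tr X + W.tr Y := by
  simp [tr, mul_add, Finset.sum_add_distrib]

theorem tr_sub (X Y : Fin n → Fin n → S) :
    W.tr (fun i j => X i j - Y i j) = W.tr X - W.tr Y := by
  simp [tr, mul_sub, Finset.sum_sub_distrib]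

theorem tr_neg (X : Fin n → Fin n → S) : W.tr (fun i j => - X i j) = - W.tr X := by
  simp [tr]

theorem tr_const_mul (u : S) (X : Fin n → Fin n → S) :
    W.tr (fun i j => u * X i j) = u * W.tr X := by
  simp only [tr, Finset.mul_sum]
  refine Finset.sum_congr rfl fun j _ => Finset.sum_congr rfl fun i _ => ?_
  ring

theorem tr_mul_const (u : S) (X : Fin n → Fin n → S) :
    W.tr (fun i j => X i j * u) = W.tr X * u := by
  rw [mul_comm, ← tr_const_mul]; simp_rw [mul_comm]

theorem tr_smul (u : ℝ) (X : Fin n → Fin n → S) :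
    W.tr (fun i j => u • X i j) = u • W.tr X := by
  simp [tr, Finset.smul_sum]

theorem tr_sum {ι : Type*} (s : Finset ι) (X : ι → Fin n → Fin n → S) :
    W.tr (fun i j => ∑ a ∈ s, X a i j) = ∑ a ∈ s, W.tr (X a) := by
  simp only [tr, Finset.mul_sum]
  rw [Finset.sum_comm]
  conv_lhs => enter [2, j]; rw [Finset.sum_comm]
  rw [Finset.sum_comm]
  conv_lhs => enter [2, j]; rw [Finset.sum_comm]

theorem tr_comm (X : Fin n → Fin n → Fin n → Fin n → S) :
    W.tr (fun i j => W.tr (fun k l => X i j k l)) =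
      W.tr (fun k l => W.tr (fun i j => X i j k l)) := by
  rw [tr]
  simp_rw [← tr_const_mul, ← tr_sum]
  rfl

theorem tr_g : W.tr W.g = (n : S) := by
  unfold tr
  have : ∀ i, ∑ j, W.G i j * W.g i j = 1 := fun i => by
    simp_rw [W.g_symm i]; simp [W.G_mul_g]
  simp [this]

/-- Entrywise derivative of a matrix. -/
def dM (m : Fin n) (X : Matrix (Fin n) (Fin n) S) : Matrix (Fin n) (Fin n) S := X.map (W.d m)

/-- The connection matrices `(Γ_m)^h_i = Γ^h_{mi}`. -/
def chrM (m : Fin n) : Matrix (Fin n) (Fin n) S := Matrix.of fun h i => W.chr h m i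

/-- The curvature matrices `(R_{kl})^h_i`. -/
def RM (k l : Fin n) : Matrix (Fin n) (Fin n) S := Matrix.of fun h i => W.Rup h i k l

theorem dM_mul (m : Fin n) (X Y : Matrix (Fin n) (Fin n) S) :
    W.dM m (X * Y) = W.dM m X * Y + X * W.dM m Y := by
  ext i j
  simp only [dM, Matrix.map_apply, Matrix.mul_apply, Matrix.add_apply, map_sum,
    Derivation.leibniz, smul_eq_mul, ← Finset.sum_add_distrib]
  refine Finset.sum_congr rfl fun k _ => ?_
  ring

theorem dM_add (m : Fin n) (X Y : Matrix (Fin n) (Fin n) S) :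
    W.dM m (X + Y) = W.dM m X + W.dM m Y := by
  ext i j; simp [dM]

theorem dM_sub (m : Fin n) (X Y : Matrix (Fin n) (Fin n) S) :
    W.dM m (X - Y) = W.dM m X - W.dM m Y := by
  ext i j; simp [dM]

theorem dM_transpose (m : Fin n) (X : Matrix (Fin n) (Fin n) S) :
    W.dM m X.transpose = (W.dM m X).transpose := rfl

theorem dM_comm (k l : Fin n) (X : Matrix (Fin n) (Fin n) S) :
    W.dM k (W.dM l X) = W.dM l (W.dM k X) := by
  ext i j; simp [dM, W.d_comm k l]

theorem RM_eq (k l : Fin n) : W.RM k l =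
    W.dM k (W.chrM l) - W.dM l (W.chrM k) + (W.chrM k * W.chrM l - W.chrM l * W.chrM k) := by
  ext h i
  simp [RM, Rup, dM, chrM, Matrix.mul_apply]

theorem d_G (m i j : Fin n) :
    W.d m (W.G i j) = - ∑ a, W.chr i m a * W.G a j - ∑ a, W.chr j m a * W.G i a := by
  have h1 : (Matrix.of W.G) * (Matrix.of W.g) = 1 := by
    ext i j; simp [Matrix.mul_apply, W.G_mul_g, Matrix.one_apply]
  have h2 := mul_eq_one_comm.mp h1
  have h3 : W.dM m (Matrix.of W.g) =
      (W.chrM m).transpose * Matrix.of W.g + Matrix.of W.g * W.chrM m := by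
    ext i j
    simp only [dM, chrM, Matrix.map_apply, Matrix.of_apply, W.d_g, Matrix.add_apply,
      Matrix.mul_apply, Matrix.transpose_apply]
    simp_rw [mul_comm]
  have h4 : W.dM m (1 : Matrix (Fin n) (Fin n) S) = 0 := by
    ext i j
    by_cases h : i = j <;> simp [dM, h]
  rw [← h1, dM_mul, h3] at h4
  have h5 : W.dM m (Matrix.of W.G) =
      - (Matrix.of W.G * (W.chrM m).transpose) - W.chrM m * Matrix.of W.G := by
    have := congrArg (· * Matrix.of W.G) h4
    simp only [add_mul, mul_add, zero_mul] at this
    rw [Matrix.mul_assoc, h2, mul_one, Matrix.mul_assoc, Matrix.mul_assoc, h2, mul_one,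
      ← Matrix.mul_assoc (Matrix.of W.G) (Matrix.of W.g), h1, one_mul] at this
    rw [eq_comm, ← sub_eq_zero, ← neg_eq_zero, ← this]
    abel
  have h6 := congrFun (congrFun h5 i) j
  simp only [dM, chrM, Matrix.map_apply, Matrix.of_apply, Matrix.sub_apply, Matrix.neg_apply,
      Matrix.mul_apply, Matrix.transpose_apply] at h6
  rw [h6]
  simp_rw [mul_comm (W.G i _)]
  ring

theorem d_tr (m : Fin n) (X : Fin n → Fin n → S) : W.d m (W.tr X) = W.tr (W.cov2 X m) := by
  have e1 : W.tr (fun i j => W.corr m (fun a => X a j) i) =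
      ∑ i, ∑ j, (∑ a, W.chr i m a * W.G a j) * X i j := by
    unfold tr corr
    simp_rw [Finset.mul_sum, Finset.sum_mul]
    rw [Finset.sum_comm]
    conv_rhs => rw [Finset.sum_comm]
    refine Finset.sum_congr rfl fun j _ => ?_
    rw [Finset.sum_comm]
    refine Finset.sum_congr rfl fun i _ => Finset.sum_congr rfl fun a _ => ?_
    ring
  have e2 : W.tr (fun i j => W.corr m (fun a => X i a) j) =
      ∑ i, ∑ j, (∑ a, W.chr j m a * W.G i a) * X i j := by
    unfold tr corr
    simp_rw [Finset.mul_sum, Finset.sum_mul]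
    refine Finset.sum_congr rfl fun j _ => ?_
    rw [Finset.sum_comm]
    refine Finset.sum_congr rfl fun i _ => Finset.sum_congr rfl fun a _ => ?_
    ring
  unfold cov2
  rw [tr_sub, tr_sub, e1, e2]
  simp only [tr, map_sum, Derivation.leibniz, smul_eq_mul, W.d_G, ← Finset.sum_sub_distrib]
  refine Finset.sum_congr rfl fun i _ => Finset.sum_congr rfl fun j _ => ?_
  ring

/-- Ricci identity for covectors. -/
theorem ricci_identity1 (v : Fin n → S) (k l i : Fin n) :
    W.cov2 (W.cov1 v) k l i - W.cov2 (W.cov1 v) l k i = - ∑ a, W.Rup a i k l * v a := by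
  let X : Matrix (Fin n) (Fin n) S := Matrix.of fun _ j => v j
  have h : (W.dM k (W.dM l X - X * W.chrM l) - (W.dM l X - X * W.chrM l) * W.chrM k)
      - (W.dM l (W.dM k X - X * W.chrM k) - (W.dM k X - X * W.chrM k) * W.chrM l)
      = - (X * W.RM k l) := by
    rw [RM_eq]
    simp only [dM_sub, dM_mul, W.dM_comm k l X]
    noncomm_ring
  have h' := congrFun (congrFun h i) i
  simp only [dM, chrM, RM, X, Matrix.map_apply, Matrix.of_apply, Matrix.sub_apply,
    Matrix.neg_apply, Matrix.mul_apply] at h'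
  simp_rw [mul_comm (W.Rup _ _ _ _)]
  rw [← h']
  simp only [cov2, cov1, corr, W.chr_symm _ l k]
  simp_rw [mul_comm (v _), mul_comm (_ - _) (W.chr _ _ _)]
  ring

/-- Ricci identity for 2-tensors. -/
theorem ricci_identity2 (Z : Fin n → Fin n → S) (k l i j : Fin n) :
    W.cov3 (W.cov2 Z) k l i j - W.cov3 (W.cov2 Z) l k i j =
      - ∑ a, W.Rup a i k l * Z a j - ∑ a, W.Rup a j k l * Z i a := by
  let X : Matrix (Fin n) (Fin n) S := Matrix.of Z
  let D : Fin n → Matrix (Fin n) (Fin n) S → Matrix (Fin n) (Fin n) S :=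
    fun m X => W.dM m X - (W.chrM m).transpose * X - X * W.chrM m
  have h : D k (D l X) - D l (D k X) = - ((W.RM k l).transpose * X) - X * W.RM k l := by
    simp only [D, RM_eq, dM_sub, dM_mul, W.dM_comm k l X, Matrix.transpose_sub,
      Matrix.transpose_add, Matrix.transpose_mul, dM_transpose]
    noncomm_ring
  have h' := congrFun (congrFun h i) j
  simp only [D, dM, chrM, RM, X, Matrix.map_apply, Matrix.of_apply, Matrix.sub_apply,
    Matrix.neg_apply, Matrix.mul_apply, Matrix.transpose_apply] at h'
  simp_rw [mul_comm (W.Rup _ j _ _)]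
  rw [← h']
  simp only [cov3, cov2, corr, W.chr_symm _ l k]
  simp_rw [mul_comm (Z _ _), mul_comm (_ - _) (W.chr _ _ _)]
  ring

theorem Rup_antisymm (h i k l : Fin n) : W.Rup h i l k = - W.Rup h i k l := by
  unfold Rup; ring

theorem Rlow_antisymm_right (h i k l : Fin n) : W.Rlow h i l k = - W.Rlow h i k l := by
  simp only [Rlow, W.Rup_antisymm _ _ k l, mul_neg, Finset.sum_neg_distrib]

theorem Rlow_antisymm_left (h i k l : Fin n) : W.Rlow i h k l = - W.Rlow h i k l := by
  have := W.ricci_identity2 W.g k l h i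
  have hz : W.cov2 W.g = fun _ _ _ => 0 := by
    funext k i j; exact W.cov2_g k i j
  simp only [hz, cov3, corr, map_zero, mul_zero, Finset.sum_const_zero, sub_zero] at this
  simp only [Rlow]
  simp_rw [mul_comm (W.Rup _ _ _ _), W.g_symm _ i] at this
  rw [eq_comm, sub_eq_zero] at this
  rw [← this, neg_neg]

theorem Rup_cyclic (h i k l : Fin n) : W.Rup h i k l + W.Rup h k l i + W.Rup h l i k = 0 := by
  simp only [Rup, W.chr_symm h l i, W.chr_symm h k i, W.chr_symm h l k,
    W.chr_symm _ l i, W.chr_symm _ k i, W.chr_symm _ l k]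
  ring

theorem Rlow_cyclic (h i k l : Fin n) : W.Rlow h i k l + W.Rlow h k l i + W.Rlow h l i k = 0 := by
  simp only [Rlow, ← Finset.sum_add_distrib, ← mul_add, W.Rup_cyclic, mul_zero,
    Finset.sum_const_zero]

theorem second_bianchi_RM (m k l : Fin n) :
    (W.dM m (W.RM k l) + W.chrM m * W.RM k l - W.RM k l * W.chrM m)
    + (W.dM k (W.RM l m) + W.chrM k * W.RM l m - W.RM l m * W.chrM k)
    + (W.dM l (W.RM m k) + W.chrM l * W.RM m k - W.RM m k * W.chrM l) = 0 := by
  simp only [RM_eq, dM_sub, dM_add, dM_mul, W.dM_comm k m, W.dM_comm l m, W.dM_comm l k]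
  noncomm_ring

theorem corr_congr_mul_right (m : Fin n) (X : Fin n → S) (y : S) (i : Fin n) :
    W.corr m (fun a => X a * y) i = W.corr m X i * y := by
  simp only [corr, Finset.sum_mul, mul_assoc]

theorem corr_congr_mul_left (m : Fin n) (X : Fin n → S) (y : S) (i : Fin n) :
    W.corr m (fun a => y * X a) i = y * W.corr m X i := by
  simp only [corr, Finset.mul_sum, mul_left_comm]

theorem corr_add (m : Fin n) (X Y : Fin n → S) (i : Fin n) :
    W.corr m (fun a => X a + Y a) i = W.corr m X i + W.corr m Y i := by
  simp [corr, mul_add, Finset.sum_add_distrib]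

theorem corr_sub (m : Fin n) (X Y : Fin n → S) (i : Fin n) :
    W.corr m (fun a => X a - Y a) i = W.corr m X i - W.corr m Y i := by
  simp [corr, mul_sub, Finset.sum_sub_distrib]

theorem corr_neg (m : Fin n) (X : Fin n → S) (i : Fin n) :
    W.corr m (fun a => - X a) i = - W.corr m X i := by
  simp [corr]

theorem corr_smul (m : Fin n) (c : ℝ) (X : Fin n → S) (i : Fin n) :
    W.corr m (fun a => c • X a) i = c • W.corr m X i := by
  simp [corr, Finset.smul_sum]

theorem corr_tr (m : Fin n) (X : Fin n → Fin n → Fin n → S) (i : Fin n) :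
    W.corr m (fun a => W.tr (X a)) i = W.tr (fun j l => W.corr m (fun a => X a j l) i) := by
  simp only [corr, tr_sum, tr_const_mul]

/-- Lowering an index commutes with covariant differentiation. -/
theorem cov1_lower (v : Fin n → S) (m h : Fin n) :
    W.cov1 (fun h => ∑ a, W.g h a * v a) m h =
      ∑ a, W.g h a * (W.d m (v a) + ∑ b, W.chr a m b * v b) := by
  have e1 : ∑ a, W.g h a * ∑ b, W.chr a m b * v b
      = ∑ a, (∑ b, W.chr b m a * W.g h b) * v a := by
    simp_rw [Finset.mul_sum, Finset.sum_mul]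
    rw [Finset.sum_comm]
    refine Finset.sum_congr rfl fun j _ => Finset.sum_congr rfl fun i _ => ?_
    ring
  have e2 : ∑ b, W.chr b m h * ∑ a, W.g b a * v a
      = ∑ a, (∑ b, W.chr b m h * W.g b a) * v a := by
    simp_rw [Finset.mul_sum, Finset.sum_mul]
    rw [Finset.sum_comm]
    refine Finset.sum_congr rfl fun j _ => Finset.sum_congr rfl fun i _ => ?_
    ring
  simp only [cov1, corr, mul_add, Finset.sum_add_distrib]
  rw [e1, e2]
  simp only [map_sum, Derivation.leibniz, smul_eq_mul, W.d_g, ← Finset.sum_add_distrib,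
    ← Finset.sum_sub_distrib]
  refine Finset.sum_congr rfl fun i _ => ?_
  simp only [mul_add, Finset.sum_add_distrib]
  ring

theorem cov2_tr (Q : Fin n → Fin n → Fin n → Fin n → S) (m i k : Fin n) :
    W.cov2 (fun i k => W.tr (fun j l => Q i k j l)) m i k =
      W.tr (fun j l => W.cov4 Q m i k j l) := by
  simp only [cov2, d_tr, corr_tr, ← tr_sub]
  congr 1; funext j l
  simp only [cov4]; ring

theorem cov4_mul (X Y : Fin n → Fin n → S) (m i j k l : Fin n) :
    W.cov4 (fun i j k l => X i j * Y k l) m i j k l =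
      W.cov2 X m i j * Y k l + X i j * W.cov2 Y m k l := by
  simp only [cov4, cov2, corr_congr_mul_right, corr_congr_mul_left, Derivation.leibniz,
    smul_eq_mul]
  ring

/-- Second Bianchi identity. -/
theorem second_bianchi (m h i k l : Fin n) :
    W.cov4 W.Rlow m h i k l + W.cov4 W.Rlow k h i l m + W.cov4 W.Rlow l h i m k = 0 := by
  have key : ∀ m k l, W.cov4 W.Rlow m h i k l = ∑ a, W.g h a *
      ((W.dM m (W.RM k l) + W.chrM m * W.RM k l - W.RM k l * W.chrM m) a i)
      - W.corr m (fun a => W.Rlow h i a l) k - W.corr m (fun a => W.Rlow h i k a) l := by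
    intro m k l
    have h1 := W.cov1_lower (fun a => W.Rup a i k l) m h
    have h2 : W.corr m (fun b => W.Rlow h b k l) i =
        ∑ a, W.g h a * ∑ b, W.Rup a b k l * W.chr b m i := by
      simp only [corr, Rlow, Finset.mul_sum]
      rw [Finset.sum_comm]
      refine Finset.sum_congr rfl fun j _ => Finset.sum_congr rfl fun i _ => ?_
      ring
    simp only [dM, chrM, RM, Matrix.map_apply, Matrix.of_apply, Matrix.sub_apply,
      Matrix.add_apply, Matrix.mul_apply]
    simp only [mul_sub, Finset.sum_sub_distrib]
    rw [← h1, ← h2]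
    simp only [cov1, cov4, Rlow]
  rw [key, key, key]
  have h0 : ∀ a, W.g h a * ((W.dM m (W.RM k l) + W.chrM m * W.RM k l - W.RM k l * W.chrM m) a i)
    + W.g h a * ((W.dM k (W.RM l m) + W.chrM k * W.RM l m - W.RM l m * W.chrM k) a i)
    + W.g h a * ((W.dM l (W.RM m k) + W.chrM l * W.RM m k - W.RM m k * W.chrM l) a i) = 0 := by
    intro a
    rw [← mul_add, ← mul_add, ← Matrix.add_apply, ← Matrix.add_apply, W.second_bianchi_RM]
    simp
  have h1 := Finset.sum_eq_zero (s := Finset.univ) fun a _ => h0 a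
  simp only [Finset.sum_add_distrib] at h1
  have e : ∀ m k l, W.corr m (fun a => W.Rlow h i a l) k
      = - W.corr k (fun a => W.Rlow h i l a) m := by
    intro m k l
    simp only [corr, W.chr_symm _ m k, ← Finset.sum_neg_distrib]
    refine Finset.sum_congr rfl fun a _ => ?_
    rw [W.Rlow_antisymm_right h i a l]; ring
  rw [e m k l, e k l m, e l m k]
  linear_combination h1

theorem tr_Rlow_mul (y : Fin n → S) (i k l : Fin n) :
    W.tr (fun a b => W.Rlow a i k l * y b) = ∑ a, W.Rup a i k l * y a := by
  have : ∀ a b, W.Rlow a i k l * y b = ∑ c, W.Rup c i k l * (y b * W.g a c) := by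
    intro a b
    simp only [Rlow, Finset.sum_mul]
    refine Finset.sum_congr rfl fun c _ => ?_
    ring
  simp_rw [this, tr_sum, tr_const_mul]
  refine Finset.sum_congr rfl fun c _ => ?_
  rw [W.tr_swap (fun b a => y b * W.g a c), tr_mul_g]

theorem tr_Rlow (i l : Fin n) : W.tr (fun h k => W.Rlow h i k l) = W.ric i l := by
  have : ∀ h k, W.Rlow h i k l = ∑ c, W.Rup c i k l * W.g h c := by
    intro h k
    simp only [Rlow]
    refine Finset.sum_congr rfl fun c _ => ?_
    ring
  simp_rw [this, tr_sum]
  unfold ric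
  refine Finset.sum_congr rfl fun c _ => ?_
  rw [W.tr_swap (fun k h => W.Rup c i k l * W.g h c), W.tr_mul_g]

theorem eq_zero_of_add_self {x : S} (h : x + x = 0) : x = 0 := by
  rw [← two_smul ℝ] at h
  exact (smul_eq_zero.mp h).resolve_left two_ne_zero

/-- Curvature minus its constant-curvature part. -/
def C (K : ℝ) (h i k l : Fin n) : S :=
  W.Rlow h i k l - K • (W.g h k * W.g i l - W.g h l * W.g i k)

variable (K : ℝ)

theorem C_antisymm_right (h i k l : Fin n) : W.C K h i l k = - W.C K h i k l := by
  simp only [C, W.Rlow_antisymm_right h i k l, Algebra.smul_def]; ring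

theorem C_antisymm_left (h i k l : Fin n) : W.C K i h k l = - W.C K h i k l := by
  simp only [C, W.Rlow_antisymm_left h i k l, Algebra.smul_def]; ring

theorem C_cyclic (h i k l : Fin n) : W.C K h i k l + W.C K h k l i + W.C K h l i k = 0 := by
  have := W.Rlow_cyclic h i k l
  simp only [C, Algebra.smul_def, W.g_symm l i, W.g_symm k i, W.g_symm l k]
  linear_combination this

theorem C_pair (h i k l : Fin n) : W.C K h i k l = W.C K k l h i := by
  rw [← sub_eq_zero]
  apply eq_zero_of_add_self
  have c1 := W.C_cyclic K h i k l
  have c2 := W.C_cyclic K i k l h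
  have c3 := W.C_cyclic K k l h i
  have c4 := W.C_cyclic K l h i k
  rw [W.C_antisymm_left K h i k l] at c2
  rw [W.C_antisymm_left K h k i l, W.C_antisymm_right K h k l i,
    W.C_antisymm_left K i k l h] at c3
  rw [W.C_antisymm_left K h l i k, W.C_antisymm_left K i l k h, W.C_antisymm_right K i l h k,
    W.C_antisymm_left K k l h i] at c4
  linear_combination c1 - c2 - c3 + c4

theorem C_rev (h i k l : Fin n) : W.C K h i k l = W.C K l k i h := by
  rw [W.C_pair, W.C_antisymm_left, W.C_antisymm_right]; ring

theorem cov4_C (m h i k l : Fin n) : W.cov4 (W.C K) m h i k l = W.cov4 W.Rlow m h i k l := by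
  have h1 := W.cov4_mul W.g W.g m h k i l
  have h2 := W.cov4_mul W.g W.g m h l i k
  simp only [cov2_g, zero_mul, mul_zero, add_zero] at h1 h2
  simp only [cov4] at h1 h2 ⊢
  simp only [C, corr_sub, corr_smul, map_sub, Derivation.map_smul]
  simp only [Algebra.smul_def]
  linear_combination (algebraMap ℝ S K) * (h2 - h1)

theorem C_second_bianchi (m h i k l : Fin n) :
    W.cov4 (W.C K) m h i k l + W.cov4 (W.C K) k h i l m + W.cov4 (W.C K) l h i m k = 0 := by
  simp only [cov4_C, second_bianchi]

theorem tr_C (i l : Fin n) :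
    W.tr (fun h k => W.C K h i k l) = W.ric i l - ((n - 1) * K : ℝ) • W.g i l := by
  have e1 : W.tr (fun h k => W.g h k * W.g i l) = n * W.g i l := by
    rw [tr_mul_const]; congr 1; exact W.tr_g
  have e2 : W.tr (fun h k => W.g h l * W.g i k) = W.g i l := by
    rw [← W.tr_mul_g (fun a => W.g i a) l, ← W.tr_swap]
    congr 1; funext a b; ring
  simp only [C, tr_sub, tr_smul, tr_Rlow, e1, e2]
  simp only [Algebra.smul_def, map_mul, map_sub, map_natCast, map_one]
  ring

end MetricAlgebra

namespace MetricAlgebra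

variable {n : ℕ} {S : Type*} [CommRing S] [Algebra ℝ S] (W : MetricAlgebra n S) (K : ℝ)

theorem tr_contract (x : Fin n → S) (m : Fin n) {f : Fin n → Fin n → S}
    (h : ∀ i j, f i j = x i * W.g j m) : W.tr f = x m := by
  rw [← W.tr_mul_g x m]; congr 1; funext i j; exact h i j

theorem tr_contract' (x : Fin n → S) (m : Fin n) {f : Fin n → Fin n → S}
    (h : ∀ i j, f i j = x j * W.g i m) : W.tr f = x m := by
  rw [← W.tr_swap]; exact W.tr_contract x m fun i j => h j i

/-- A subalgebra `A` of negligible-error-tolerant quantities and a class `N` of negligible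
quantities, such that the metric and its first derivatives are tame. -/
structure ErrorClasses where
  A : Subalgebra ℝ S
  N : Submodule ℝ S
  mul_mem_N : ∀ u ∈ A, ∀ v ∈ N, u * v ∈ N
  g_mem : ∀ i j, W.g i j ∈ A
  d_g_mem : ∀ k i j, W.d k (W.g i j) ∈ A
  d_d_g_mem : ∀ l k i j, W.d l (W.d k (W.g i j)) ∈ A
  G_mem : ∀ i j, W.G i j ∈ A
  d_G_mem : ∀ k i j, W.d k (W.G i j) ∈ A

namespace ErrorClasses

variable {W} (P : W.ErrorClasses)

/-- Elements of `A` all of whose derivatives are in `A`. -/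
def A1 : Subalgebra ℝ S where
  carrier := {u | u ∈ P.A ∧ ∀ i, W.d i u ∈ P.A}
  mul_mem' := fun {u v} hu hv => ⟨mul_mem hu.1 hv.1, fun i => by
    rw [Derivation.leibniz]
    exact add_mem (mul_mem hu.1 (hv.2 i)) (mul_mem hv.1 (hu.2 i))⟩
  add_mem' := fun {u v} hu hv => ⟨add_mem hu.1 hv.1, fun i => by
    rw [map_add]
    exact add_mem (hu.2 i) (hv.2 i)⟩
  algebraMap_mem' := fun r => ⟨P.A.algebraMap_mem r, fun i => by
    rw [Derivation.map_algebraMap]; exact zero_mem _⟩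

/-- Negligible quantities plus divergences of negligible quantities. -/
def M : Submodule ℝ S := P.N ⊔ ⨆ i, P.N.map (W.d i).toLinearMap

theorem N_le_M {u : S} (hu : u ∈ P.N) : u ∈ P.M := Submodule.mem_sup_left hu

theorem d_mem_M {u : S} (hu : u ∈ P.N) (i : Fin n) : W.d i u ∈ P.M :=
  Submodule.mem_sup_right (Submodule.mem_iSup_of_mem i ⟨u, hu, rfl⟩)

theorem mul_mem_M {b u : S} (hb : b ∈ P.A1) (hu : u ∈ P.M) : b * u ∈ P.M := by
  have : P.M ≤ P.M.comap (LinearMap.mulLeft ℝ b) := by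
    refine sup_le (fun v hv => P.N_le_M (P.mul_mem_N b hb.1 v hv)) (iSup_le fun i => ?_)
    rintro _ ⟨v, hv, rfl⟩
    have e : b * W.d i v = W.d i (b * v) - W.d i b * v := by
      rw [Derivation.leibniz]; simp only [smul_eq_mul]; ring
    change b * W.d i v ∈ P.M
    rw [e]
    exact sub_mem (P.d_mem_M (P.mul_mem_N _ hb.1 _ hv) i) (P.N_le_M (P.mul_mem_N _ (hb.2 i) _ hv))
  exact this hu

theorem mem_N_mul {u v : S} (hu : u ∈ P.N) (hv : v ∈ P.A) : u * v ∈ P.N := by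
  rw [mul_comm]; exact P.mul_mem_N v hv u hu

theorem mem_M_mul {u v : S} (hu : u ∈ P.M) (hv : v ∈ P.A1) : u * v ∈ P.M := by
  rw [mul_comm]; exact P.mul_mem_M hv hu

theorem g_mem1 (i j : Fin n) : W.g i j ∈ P.A1 := ⟨P.g_mem i j, fun k => P.d_g_mem k i j⟩

theorem G_mem1 (i j : Fin n) : W.G i j ∈ P.A1 := ⟨P.G_mem i j, fun k => P.d_G_mem k i j⟩

theorem d_g_mem1 (k i j : Fin n) : W.d k (W.g i j) ∈ P.A1 :=
  ⟨P.d_g_mem k i j, fun l => P.d_d_g_mem l k i j⟩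

theorem chr_mem1 (h i j : Fin n) : W.chr h i j ∈ P.A1 :=
  P.A1.smul_mem (sum_mem fun k _ => mul_mem (P.G_mem1 h k)
    (sub_mem (add_mem (P.d_g_mem1 _ _ _) (P.d_g_mem1 _ _ _)) (P.d_g_mem1 _ _ _))) _

theorem chr_mem (h i j : Fin n) : W.chr h i j ∈ P.A := (P.chr_mem1 h i j).1

theorem Rup_mem (h i k l : Fin n) : W.Rup h i k l ∈ P.A :=
  add_mem (sub_mem ((P.chr_mem1 h l i).2 k) ((P.chr_mem1 h k i).2 l))
    (sub_mem (sum_mem fun _ _ => mul_mem (P.chr_mem _ _ _) (P.chr_mem _ _ _))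
      (sum_mem fun _ _ => mul_mem (P.chr_mem _ _ _) (P.chr_mem _ _ _)))

theorem C_mem (h i k l : Fin n) : W.C K h i k l ∈ P.A :=
  sub_mem (sum_mem fun _ _ => mul_mem (P.g_mem _ _) (P.Rup_mem _ _ _ _))
    (P.A.smul_mem (sub_mem (mul_mem (P.g_mem _ _) (P.g_mem _ _))
      (mul_mem (P.g_mem _ _) (P.g_mem _ _))) _)

theorem tr_mem_A {X : Fin n → Fin n → S} (h : ∀ i j, X i j ∈ P.A) : W.tr X ∈ P.A :=
  sum_mem fun _ _ => sum_mem fun _ _ => mul_mem (P.G_mem _ _) (h _ _)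

theorem tr_mem_N {X : Fin n → Fin n → S} (h : ∀ i j, X i j ∈ P.N) : W.tr X ∈ P.N :=
  sum_mem fun _ _ => sum_mem fun _ _ => P.mul_mem_N _ (P.G_mem _ _) _ (h _ _)

theorem tr_mem_M {X : Fin n → Fin n → S} (h : ∀ i j, X i j ∈ P.M) : W.tr X ∈ P.M :=
  sum_mem fun _ _ => sum_mem fun _ _ => P.mul_mem_M (P.G_mem1 _ _) (h _ _)

theorem corr_mem_N (m : Fin n) {X : Fin n → S} (h : ∀ i, X i ∈ P.N) (i : Fin n) :
    W.corr m X i ∈ P.N :=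
  sum_mem fun _ _ => P.mul_mem_N _ (P.chr_mem _ _ _) _ (h _)

theorem cov2_mem_M {X : Fin n → Fin n → S} (h : ∀ i j, X i j ∈ P.N) (m i j : Fin n) :
    W.cov2 X m i j ∈ P.M :=
  sub_mem (sub_mem (P.d_mem_M (h _ _) m) (P.N_le_M (P.corr_mem_N m (fun _ => h _ _) i)))
    (P.N_le_M (P.corr_mem_N m (fun _ => h _ _) j))

theorem cov4_mem_M {X : Fin n → Fin n → Fin n → Fin n → S} (h : ∀ i j k l, X i j k l ∈ P.N)
    (m i j k l : Fin n) : W.cov4 X m i j k l ∈ P.M :=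
  sub_mem (sub_mem (sub_mem (sub_mem (P.d_mem_M (h _ _ _ _) m)
    (P.N_le_M (P.corr_mem_N m (fun _ => h _ _ _ _) i)))
    (P.N_le_M (P.corr_mem_N m (fun _ => h _ _ _ _) j)))
    (P.N_le_M (P.corr_mem_N m (fun _ => h _ _ _ _) k)))
    (P.N_le_M (P.corr_mem_N m (fun _ => h _ _ _ _) l))

theorem cov3_mem_N {X : Fin n → Fin n → Fin n → S} (h : ∀ i j k, X i j k ∈ P.N)
    (hd : ∀ m i j k, W.d m (X i j k) ∈ P.N) (m i j k : Fin n) : W.cov3 X m i j k ∈ P.N :=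
  sub_mem (sub_mem (sub_mem (hd _ _ _ _) (P.corr_mem_N m (fun _ => h _ _ _) i))
    (P.corr_mem_N m (fun _ => h _ _ _) j)) (P.corr_mem_N m (fun _ => h _ _ _) k)

/-- An approximate solution of the linear system `∇_k a_{ij} = λ_i g_{jk} + λ_j g_{ik}` on an
approximately Einstein metric algebra. -/
structure ApproxSolution (P : W.ErrorClasses) (K : ℝ) where
  a : Fin n → Fin n → S
  lam : Fin n → S
  a_symm : ∀ i j, a i j = a j i
  a_mem : ∀ i j, a i j ∈ P.A1
  lam_mem : ∀ i, lam i ∈ P.A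
  err_mem : ∀ m i j,
    W.cov2 a m i j - (lam i * W.g j m + lam j * W.g i m) ∈ P.N
  d_err_mem : ∀ l m i j,
    W.d l (W.cov2 a m i j - (lam i * W.g j m + lam j * W.g i m)) ∈ P.N
  einstein : ∀ i l, W.tr (fun h k => W.C K h i k l) ∈ P.N

namespace ApproxSolution

variable {P K} (s : P.ApproxSolution K)

/-- The contraction `C^α_{ikl} a_{αj}`. -/
def Q (i k j l : Fin n) : S := W.tr (fun α β => W.C K α i k l * s.a β j)

/-- The contraction `C^α_{ikl} λ_α`. -/
def Y (i k l : Fin n) : S := W.tr (fun α β => W.C K α i k l * s.lam β)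

/-- The tensor `∇_k λ_i + K a_{ki}`. -/
def L (k i : Fin n) : S := W.cov1 s.lam k i + K • s.a k i

/-- The mean trace of `L`. -/
def sigma : S := (1 / n : ℝ) • W.tr s.L

/-- The trace-free part of `L`, up to negligible terms. -/
def T (k i : Fin n) : S := -((1 / n : ℝ) • W.tr (fun j l => s.Q i k j l))

theorem a_memA (i j : Fin n) : s.a i j ∈ P.A := (s.a_mem i j).1

theorem tr_C_14 (s : P.ApproxSolution K) (i k : Fin n) : W.tr (fun h l => W.C K h i k l) ∈ P.N := by
  simp_rw [fun h l => W.C_antisymm_right K h i l k, tr_neg]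
  exact neg_mem (s.einstein i k)

theorem tr_C_23 (s : P.ApproxSolution K) (h l : Fin n) : W.tr (fun i k => W.C K h i k l) ∈ P.N := by
  simp_rw [fun i k => W.C_antisymm_left K i h k l, tr_neg]
  exact neg_mem (s.einstein h l)

theorem tr_C_24 (s : P.ApproxSolution K) (h k : Fin n) : W.tr (fun i l => W.C K h i k l) ∈ P.N := by
  simp_rw [fun i l => W.C_antisymm_left K i h k l, tr_neg]
  exact neg_mem (s.tr_C_14 h k)

theorem tr_C_mul (X : Fin n → S) (i k l : Fin n) :
    ∑ a, W.Rup a i k l * X a =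
      W.tr (fun α β => W.C K α i k l * X β) + K • (W.g i l * X k - W.g i k * X l) := by
  have h1 : W.tr (fun α β => W.g α k * W.g i l * X β) = W.g i l * X k :=
    W.tr_contract' (fun b => W.g i l * X b) k fun a b => by ring
  have h2 : W.tr (fun α β => W.g α l * W.g i k * X β) = W.g i k * X l :=
    W.tr_contract' (fun b => W.g i k * X b) l fun a b => by ring
  rw [← tr_Rlow_mul, ← h1, ← h2]
  simp only [C, sub_mul, tr_sub, smul_mul_assoc, tr_smul]
  abel

theorem curvature_relation (i j k l : Fin n) :
    W.g j l * s.L k i + W.g i l * s.L k j - W.g j k * s.L l i - W.g i k * s.L l j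
      + s.Q i k j l + s.Q j k i l ∈ P.N := by
  set E : Fin n → Fin n → Fin n → S := fun m i j =>
    W.cov2 s.a m i j - (s.lam i * W.g j m + s.lam j * W.g i m) with hE
  have hcov : ∀ k l, W.cov3 (W.cov2 s.a) k l i j =
      W.cov1 s.lam k i * W.g j l + W.cov1 s.lam k j * W.g i l + W.cov3 E k l i j := by
    intro k l
    have e : W.cov2 s.a = fun m i j =>
        s.lam i * W.g j m + s.lam j * W.g i m + E m i j := by
      funext m i j; simp only [hE]; ring
    rw [e]
    have g1 := W.cov2_g k j l
    have g2 := W.cov2_g k i l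
    simp only [cov2] at g1 g2
    simp only [cov3, cov1, corr_add, map_add, corr_congr_mul_left, corr_congr_mul_right,
      Derivation.leibniz, smul_eq_mul]
    linear_combination (s.lam i) * g1 + (s.lam j) * g2
  have hN := sub_mem (P.cov3_mem_N s.err_mem s.d_err_mem l k i j)
    (P.cov3_mem_N s.err_mem s.d_err_mem k l i j)
  have hR := W.ricci_identity2 s.a k l i j
  have sy : ∑ a, W.Rup a j k l * s.a i a = ∑ a, W.Rup a j k l * s.a a i :=
    Finset.sum_congr rfl fun a _ => by rw [s.a_symm]
  rw [hcov, hcov, sy, tr_C_mul (fun a => s.a a j), tr_C_mul (fun a => s.a a i)] at hR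
  convert hN using 1
  simp only [L, Q, Algebra.smul_def] at hR ⊢
  linear_combination hR

theorem T_mul_n (hn : n ≠ 0) (k i : Fin n) :
    (n : S) * s.T k i = - W.tr (fun j l => s.Q i k j l) := by
  have : (n : ℝ) * (1 / n) = 1 := by field_simp
  rw [T, mul_neg, ← nsmul_eq_mul, ← Nat.cast_smul_eq_nsmul ℝ, smul_smul, this, one_smul]

theorem mem_of_n_mul (hn : n ≠ 0) {B : Submodule ℝ S} {x : S} (h : (n : S) * x ∈ B) : x ∈ B := by
  rw [← nsmul_eq_mul, ← Nat.cast_smul_eq_nsmul ℝ] at h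
  exact (B.smul_mem_iff (by exact_mod_cast hn)).mp h

theorem sigma_mul_n (hn : n ≠ 0) : (n : S) * s.sigma = W.tr s.L := by
  have : (n : ℝ) * (1 / n) = 1 := by field_simp
  rw [sigma, ← nsmul_eq_mul, ← Nat.cast_smul_eq_nsmul ℝ, smul_smul, this, one_smul]

theorem L_sub_mem (hn : n ≠ 0) (k i : Fin n) :
    s.L k i - s.sigma * W.g k i - s.T k i ∈ P.N := by
  have h := P.tr_mem_N fun j l => s.curvature_relation i j k l
  simp only [tr_add, tr_sub, tr_mul_const, tr_const_mul] at h
  have e1 : W.tr (fun j l => W.g j l) = n := W.tr_g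
  have e2 : W.tr (fun j l => W.g i l * s.L k j) = s.L k i :=
    W.tr_contract (fun j => s.L k j) i fun j l => by rw [W.g_symm i l]; ring
  have e3 : W.tr (fun j l => W.g j k * s.L l i) = s.L k i :=
    W.tr_contract' (fun l => s.L l i) k fun j l => by ring
  have e4 : W.tr (fun j l => s.L l j) = W.tr s.L := W.tr_swap s.L
  have e5 : W.tr (fun j l => s.Q j k i l) ∈ P.N := by
    unfold Q
    rw [tr_comm]
    refine P.tr_mem_N fun α β => ?_
    rw [tr_mul_const]
    exact P.mem_N_mul (s.tr_C_24 α k) (s.a_memA _ _)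
  rw [e1, e2, e3, e4] at h
  apply mem_of_n_mul hn
  convert sub_mem h e5 using 1
  have := s.T_mul_n hn k i
  have h2 := s.sigma_mul_n hn
  rw [W.g_symm k i]
  linear_combination (-1 : S) * this - W.g i k * h2

theorem T_symm (k i : Fin n) : s.T k i = s.T i k := by
  unfold T Q
  congr 2
  simp_rw [fun α l => W.C_rev K α i k l]
  rw [tr_comm]
  conv_rhs => rw [← W.tr_swap]
  congr 1; funext α β
  rw [← W.tr_swap]
  congr 1; funext l j
  rw [s.a_symm]

theorem tr_T_mem : W.tr s.T ∈ P.N := by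
  have : W.tr s.T = -((1 / n : ℝ) • W.tr (fun j l => W.tr fun α β =>
      W.tr (fun k i => W.C K α i k l) * s.a β j)) := by
    unfold T Q
    rw [tr_neg, tr_smul, tr_comm]
    congr 3; funext j l
    rw [tr_comm]
    congr 1; funext α β
    rw [tr_mul_const]
  rw [this]
  refine neg_mem (P.N.smul_mem _ (P.tr_mem_N fun j l => P.tr_mem_N fun α β => ?_))
  refine P.mem_N_mul ?_ (s.a_memA _ _)
  rw [← W.tr_swap]
  exact s.tr_C_23 α l

theorem T_mem (k i : Fin n) : s.T k i ∈ P.A :=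
  neg_mem (P.A.smul_mem (P.tr_mem_A fun _ _ => P.tr_mem_A fun _ _ =>
    mul_mem (P.C_mem K _ _ _ _) (s.a_memA _ _)) _)

theorem curvature_relation_T (hn : n ≠ 0) (i j k l : Fin n) :
    W.g j l * s.T k i + W.g i l * s.T k j - W.g j k * s.T l i - W.g i k * s.T l j
      + s.Q i k j l + s.Q j k i l ∈ P.N := by
  have h := s.curvature_relation i j k l
  have f := fun i j k l => P.mul_mem_N _ (P.g_mem i j) _ (s.L_sub_mem hn k l)
  convert add_mem (add_mem (sub_mem (sub_mem h (f j l k i)) (f i l k j)) (f j k l i))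
    (f i k l j) using 1
  rw [W.g_symm k i, W.g_symm k j, W.g_symm l i, W.g_symm l j]
  ring

end ApproxSolution
end ErrorClasses
end MetricAlgebra

namespace MetricAlgebra
namespace ErrorClasses
namespace ApproxSolution

variable {n : ℕ} {S : Type*} [CommRing S] [Algebra ℝ S] {W : MetricAlgebra n S}
  {P : W.ErrorClasses} {K : ℝ}

theorem div_C_slot_one (s : P.ApproxSolution K) (i k l : Fin n) :
    W.tr (fun m h => W.cov4 (W.C K) m h i k l) ∈ P.M := by
  have key : ∀ k i l, W.tr (fun m h => W.cov4 (W.C K) k h i l m) ∈ P.M := by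
    intro k i l
    have e := W.cov2_tr (fun i l m h => W.C K h i l m) k i l
    have : ∀ m h, W.cov4 (fun i l m h => W.C K h i l m) k i l m h = W.cov4 (W.C K) k h i l m := by
      intro m h; simp only [cov4]; ring
    simp_rw [this] at e
    rw [← e]
    refine P.cov2_mem_M (fun i l => ?_) k i l
    rw [← W.tr_swap]
    exact s.tr_C_14 i l
  have h2 : W.tr (fun m h => W.cov4 (W.C K) l h i m k) ∈ P.M := by
    have : ∀ m h, W.cov4 (W.C K) l h i m k = - W.cov4 (W.C K) l h i k m := by
      intro m h
      have e : W.C K = fun h i k l => - W.C K h i l k := by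
        funext h i k l; rw [W.C_antisymm_right K h i k l, neg_neg]
      conv_lhs => rw [e]
      simp only [cov4, corr_neg, map_neg]; ring
    simp_rw [this, tr_neg]
    exact neg_mem (key l i k)
  convert neg_mem (add_mem (key k i l) h2) using 1
  rw [← tr_add, ← tr_neg]
  congr 1; funext m h
  linear_combination W.C_second_bianchi K m h i k l

theorem div_C_slot_four (s : P.ApproxSolution K) (h i k : Fin n) :
    W.tr (fun m l => W.cov4 (W.C K) m h i k l) ∈ P.M := by
  have : ∀ m l, W.cov4 (W.C K) m h i k l = W.cov4 (W.C K) m l k i h := by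
    intro m l
    have e : W.C K = fun h i k l => W.C K l k i h := by
      funext h i k l; exact W.C_rev K h i k l
    conv_lhs => rw [e]
    simp only [cov4]; ring
  simp_rw [this]
  exact s.div_C_slot_one k i h

theorem div_C_slot_three (s : P.ApproxSolution K) (h i l : Fin n) :
    W.tr (fun m k => W.cov4 (W.C K) m h i k l) ∈ P.M := by
  have : ∀ m k, W.cov4 (W.C K) m h i k l = - W.cov4 (W.C K) m h i l k := by
    intro m k
    have e : W.C K = fun h i k l => - W.C K h i l k := by
      funext h i k l; rw [W.C_antisymm_right K h i k l, neg_neg]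
    conv_lhs => rw [e]
    simp only [cov4, corr_neg, map_neg]; ring
  simp_rw [this, tr_neg]
  exact neg_mem (s.div_C_slot_four h i l)

variable (s : P.ApproxSolution K)

theorem cov4_Q (m i k j l : Fin n) :
    W.cov4 s.Q m i k j l = W.tr (fun α β => W.cov4 (W.C K) m α i k l * s.a β j
      + W.C K α i k l * W.cov2 s.a m β j) := by
  simp only [Q, cov4, d_tr, corr_tr, ← tr_sub]
  congr 1; funext α β
  simp only [cov2, corr_congr_mul_right, corr_congr_mul_left, Derivation.leibniz, smul_eq_mul]
  ring

/-- The error in the equation for `∇ a`. -/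
def err (m i j : Fin n) : S := W.cov2 s.a m i j - (s.lam i * W.g j m + s.lam j * W.g i m)

theorem cov2_a (m i j : Fin n) :
    W.cov2 s.a m i j = s.lam i * W.g j m + s.lam j * W.g i m + s.err m i j := by
  unfold err; ring

theorem div_Q_slot_four (i k j : Fin n) :
    W.tr (fun m l => W.cov4 s.Q m i k j l) - s.Y i k j ∈ P.M := by
  have h1 : W.tr (fun m l => W.tr (fun α β => W.cov4 (W.C K) m α i k l * s.a β j)) ∈ P.M := by
    rw [tr_comm]
    refine P.tr_mem_M fun α β => ?_
    rw [tr_mul_const]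
    exact P.mem_M_mul (s.div_C_slot_four α i k) (s.a_mem _ _)
  have h2 : W.tr (fun m l => W.tr (fun α β => W.C K α i k l * (s.lam β * W.g j m)))
      = s.Y i k j := by
    rw [tr_comm]
    unfold Y
    congr 1; funext α β
    exact W.tr_contract' (fun l => W.C K α i k l * s.lam β) j fun m l => by
      rw [W.g_symm j m]; ring
  have h3 : W.tr (fun m l => W.tr (fun α β => W.C K α i k l * (s.lam j * W.g β m))) ∈ P.N := by
    have : ∀ m l, W.tr (fun α β => W.C K α i k l * (s.lam j * W.g β m)) =
        W.C K m i k l * s.lam j := fun m l =>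
      W.tr_contract (fun α => W.C K α i k l * s.lam j) m fun α β => by ring
    simp_rw [this, tr_mul_const]
    exact P.mem_N_mul (s.tr_C_14 i k) (s.lam_mem j)
  have h4 : W.tr (fun m l => W.tr (fun α β => W.C K α i k l * s.err m β j)) ∈ P.N :=
    P.tr_mem_N fun m l => P.tr_mem_N fun α β =>
      P.mul_mem_N _ (P.C_mem K _ _ _ _) _ (s.err_mem m β j)
  convert add_mem h1 (P.N_le_M (add_mem h3 h4)) using 1
  rw [← h2]
  simp only [cov4_Q, cov2_a, mul_add, tr_add]
  ring

theorem div_Q_slot_two (i j l : Fin n) :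
    W.tr (fun m k => W.cov4 s.Q m i k j l) - W.tr (fun α β => W.C K α i j l * s.lam β)
      ∈ P.M := by
  have h1 : W.tr (fun m k => W.tr (fun α β => W.cov4 (W.C K) m α i k l * s.a β j)) ∈ P.M := by
    rw [tr_comm]
    refine P.tr_mem_M fun α β => ?_
    rw [tr_mul_const]
    exact P.mem_M_mul (s.div_C_slot_three α i l) (s.a_mem _ _)
  have h2 : W.tr (fun m k => W.tr (fun α β => W.C K α i k l * (s.lam β * W.g j m)))
      = W.tr (fun α β => W.C K α i j l * s.lam β) := by
    rw [tr_comm]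
    congr 1; funext α β
    exact W.tr_contract' (fun k => W.C K α i k l * s.lam β) j fun m k => by
      rw [W.g_symm j m]; ring
  have h3 : W.tr (fun m k => W.tr (fun α β => W.C K α i k l * (s.lam j * W.g β m))) ∈ P.N := by
    have : ∀ m k, W.tr (fun α β => W.C K α i k l * (s.lam j * W.g β m)) =
        W.C K m i k l * s.lam j := fun m k =>
      W.tr_contract (fun α => W.C K α i k l * s.lam j) m fun α β => by ring
    simp_rw [this, tr_mul_const]
    exact P.mem_N_mul (s.einstein i l) (s.lam_mem j)
  have h4 : W.tr (fun m k => W.tr (fun α β => W.C K α i k l * s.err m β j)) ∈ P.N :=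
    P.tr_mem_N fun m l => P.tr_mem_N fun α β =>
      P.mul_mem_N _ (P.C_mem K _ _ _ _) _ (s.err_mem m β j)
  convert add_mem h1 (P.N_le_M (add_mem h3 h4)) using 1
  rw [← h2]
  simp only [cov4_Q, cov2_a, mul_add, tr_add]
  ring

theorem tr_eq_zero_of_antisymm {X : Fin n → Fin n → S} (h : ∀ i j, X j i = - X i j) :
    W.tr X = 0 := by
  apply eq_zero_of_add_self
  nth_rewrite 2 [← W.tr_swap]
  rw [← tr_add]
  have e : (fun i j => X i j + X j i) = fun _ _ => 0 := by
    funext i j; rw [h i j, add_neg_cancel]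
  rw [e]
  simp [tr]

theorem cov2_T (m k i : Fin n) :
    W.cov2 s.T m k i = -((1 / n : ℝ) • W.tr (fun j l => W.cov4 s.Q m i k j l)) := by
  rw [← cov2_tr]
  have e : s.T = fun k i => -((1 / n : ℝ) • (fun i k => W.tr (fun j l => s.Q i k j l)) i k) := rfl
  rw [e]
  simp only [cov2, corr_neg, map_neg, Derivation.map_smul, corr_smul, smul_sub]
  abel

theorem cov2_T_symm (m k i : Fin n) : W.cov2 s.T m k i = W.cov2 s.T m i k := by
  have e : s.T = fun k i => s.T i k := by funext k i; exact s.T_symm k i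
  conv_lhs => rw [e]
  simp only [cov2]; ring

theorem div_T (i : Fin n) : W.tr (fun m k => W.cov2 s.T m k i) ∈ P.M := by
  simp_rw [cov2_T, tr_neg, tr_smul]
  refine neg_mem (P.M.smul_mem _ ?_)
  rw [tr_comm]
  have h := P.tr_mem_M fun j l => s.div_Q_slot_two i j l
  rw [tr_sub] at h
  have : W.tr (fun j l => W.tr (fun α β => W.C K α i j l * s.lam β)) = 0 := by
    rw [tr_comm]
    have : ∀ α β, W.tr (fun j l => W.C K α i j l * s.lam β) = 0 := fun α β => by
      rw [tr_mul_const, tr_eq_zero_of_antisymm (fun j l => W.C_antisymm_right K α i j l), zero_mul]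
    simp_rw [this]
    simp [tr]
  rwa [this, sub_zero] at h

theorem cov4_add (X Y : Fin n → Fin n → Fin n → Fin n → S) (m i j k l : Fin n) :
    W.cov4 (fun i j k l => X i j k l + Y i j k l) m i j k l =
      W.cov4 X m i j k l + W.cov4 Y m i j k l := by
  simp only [cov4, corr_add, map_add]; ring

theorem cov4_sub (X Y : Fin n → Fin n → Fin n → Fin n → S) (m i j k l : Fin n) :
    W.cov4 (fun i j k l => X i j k l - Y i j k l) m i j k l =
      W.cov4 X m i j k l - W.cov4 Y m i j k l := by
  simp only [cov4, corr_sub, map_sub]; ring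

theorem symm_deriv_T (hn : n ≠ 0) (i j k : Fin n) :
    W.cov2 s.T j k i + W.cov2 s.T i k j + s.Y i k j + s.Y j k i ∈ P.M := by
  have g0 : ∀ m i j, W.d m (W.g i j) = W.corr m (fun a => W.g a j) i
      + W.corr m (fun a => W.g i a) j := fun m i j => by
    have := W.cov2_g m i j
    simp only [cov2] at this
    linear_combination this
  have e : ∀ m l, W.cov4 (fun i j k l => W.g j l * s.T k i + W.g i l * s.T k j
      - W.g j k * s.T l i - W.g i k * s.T l j + s.Q i k j l + s.Q j k i l) m i j k l =
      W.g j l * W.cov2 s.T m k i + W.g i l * W.cov2 s.T m k j - W.g j k * W.cov2 s.T m l i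
      - W.g i k * W.cov2 s.T m l j + W.cov4 s.Q m i k j l + W.cov4 s.Q m j k i l := by
    intro m l
    rw [cov4_add, cov4_add, cov4_sub, cov4_sub, cov4_add]
    simp only [cov4, cov2, corr_congr_mul_right, corr_congr_mul_left, Derivation.leibniz,
      smul_eq_mul, g0]
    ring
  have h := P.tr_mem_M fun m l =>
    (e m l) ▸ P.cov4_mem_M (s.curvature_relation_T hn) m i j k l
  simp_rw [tr_add, tr_sub, tr_add, tr_const_mul] at h
  have e1 : W.tr (fun m l => W.g j l * W.cov2 s.T m k i) = W.cov2 s.T j k i :=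
    W.tr_contract (fun m => W.cov2 s.T m k i) j fun m l => by rw [W.g_symm j l]; ring
  have e2 : W.tr (fun m l => W.g i l * W.cov2 s.T m k j) = W.cov2 s.T i k j :=
    W.tr_contract (fun m => W.cov2 s.T m k j) i fun m l => by rw [W.g_symm i l]; ring
  rw [e1, e2] at h
  have f1 := P.mul_mem_M (P.g_mem1 j k) (s.div_T i)
  have f2 := P.mul_mem_M (P.g_mem1 i k) (s.div_T j)
  convert sub_mem (sub_mem (add_mem (add_mem h f1) f2) (s.div_Q_slot_four i k j))
    (s.div_Q_slot_four j k i) using 1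
  ring

theorem curl_L (hn : n ≠ 0) (m k i : Fin n) :
    W.d m s.sigma * W.g k i - W.d k s.sigma * W.g m i + W.cov2 s.T m k i - W.cov2 s.T k m i
      + s.Y i m k + (2 * K) • (W.g i k * s.lam m - W.g i m * s.lam k) ∈ P.M := by
  set X : Fin n → Fin n → S := fun k i => s.L k i - s.sigma * W.g k i - s.T k i with hX
  have hcov : ∀ m k, W.cov2 (W.cov1 s.lam) m k i = W.d m s.sigma * W.g k i + W.cov2 s.T m k i
      - K • (s.lam k * W.g i m + s.lam i * W.g k m + s.err m k i) + W.cov2 X m k i := by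
    intro m k
    have e : W.cov1 s.lam = fun k i => s.sigma * W.g k i + s.T k i - K • s.a k i + X k i := by
      funext k i; simp only [hX, L]; ring
    rw [e, ← cov2_a]
    have g1 := W.cov2_g m k i
    simp only [cov2] at g1
    simp only [cov2, corr_add, corr_sub, map_add, map_sub, corr_congr_mul_left,
      Derivation.leibniz, smul_eq_mul, corr_smul, Derivation.map_smul, smul_sub]
    linear_combination s.sigma * g1
  have hR := W.ricci_identity1 s.lam m k i
  rw [hcov, hcov, tr_C_mul (K := K)] at hR
  have hM := sub_mem (P.cov2_mem_M (s.L_sub_mem hn) k m i) (P.cov2_mem_M (s.L_sub_mem hn) m k i)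
  have hM' := P.N_le_M (P.N.smul_mem K (sub_mem (s.err_mem m k i) (s.err_mem k m i)))
  convert add_mem hM hM' using 1
  change _ = W.cov2 X k m i - W.cov2 X m k i + K • (s.err m k i - s.err k m i)
  simp only [Y, Algebra.smul_def, map_mul, map_ofNat] at hR ⊢
  rw [W.g_symm m k, W.g_symm k i, W.g_symm m i] at *
  linear_combination hR

theorem d_sigma (hn : 2 ≤ n) (m : Fin n) : W.d m s.sigma + (2 * K) • s.lam m ∈ P.M := by
  have h := P.tr_mem_M fun k i => s.curl_L (by omega) m k i
  simp_rw [tr_add, tr_sub, tr_smul, tr_sub, tr_add, tr_sub, tr_const_mul, tr_mul_const] at h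
  have e1 : W.tr (fun k i => W.g k i) = n := W.tr_g
  have e1' : W.tr (fun k i => W.g i k) = n := by rw [← e1, ← W.tr_swap]
  have e2 : W.tr (fun k i => W.d k s.sigma * W.g m i) = W.d m s.sigma :=
    W.tr_contract (fun k => W.d k s.sigma) m fun k i => by rw [W.g_symm m i]
  have e3 : W.tr (fun k i => W.g i m * s.lam k) = s.lam m :=
    W.tr_contract (fun k => s.lam k) m fun k i => by ring
  have e4 : W.tr (fun k i => W.cov2 s.T m k i) ∈ P.M := by
    have := P.d_mem_M s.tr_T_mem m
    rwa [d_tr] at this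
  have e5 : W.tr (fun k i => W.cov2 s.T k m i) ∈ P.M := by
    simp_rw [fun k i => s.cov2_T_symm k m i]
    exact s.div_T m
  have e6 : W.tr (fun k i => s.Y i m k) ∈ P.N := by
    unfold Y
    rw [tr_comm]
    refine P.tr_mem_N fun α β => ?_
    rw [tr_mul_const, ← W.tr_swap]
    exact P.mem_N_mul (s.tr_C_24 α m) (s.lam_mem _)
  rw [e1, e1', e2, e3] at h
  have h' := sub_mem (add_mem (sub_mem h e4) e5) (P.N_le_M e6)
  have hn' : ((n : ℝ) - 1) ≠ 0 := by
    have : (2 : ℝ) ≤ n := by exact_mod_cast hn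
    linarith
  rw [← P.M.smul_mem_iff hn']
  convert h' using 1
  simp only [Algebra.smul_def, map_mul, map_sub, map_natCast, map_one, map_ofNat]
  ring

theorem curl_T (hn : 2 ≤ n) (m k i : Fin n) :
    W.cov2 s.T m k i - W.cov2 s.T k m i + s.Y i m k ∈ P.M := by
  have h := s.curl_L (by omega) m k i
  have f := fun m k => P.mul_mem_M (P.g_mem1 k i) (s.d_sigma hn m)
  convert add_mem (sub_mem h (f m k)) (f k m) using 1
  simp only [Algebra.smul_def, map_mul, map_ofNat, W.g_symm i k, W.g_symm i m]
  ring

theorem Y_antisymm (i k l : Fin n) : s.Y i l k = - s.Y i k l := by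
  simp only [Y, W.C_antisymm_right K _ i k l, neg_mul, tr_neg]

theorem Y_cyclic (i k l : Fin n) : s.Y i k l + s.Y k l i + s.Y l i k = 0 := by
  simp only [Y, ← tr_add, ← add_mul, C_cyclic, zero_mul]
  simp [tr]

theorem mem_of_two_mul {B : Submodule ℝ S} {x : S} (h : 2 * x ∈ B) : x ∈ B :=
  mem_of_n_mul (n := 2) two_ne_zero (by exact_mod_cast h)

theorem cov2_T_add_Y (hn : 2 ≤ n) (k i j : Fin n) :
    W.cov2 s.T k i j - s.Y i j k - s.Y j i k ∈ P.M := by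
  have hB := s.symm_deriv_T (by omega) i j k
  have a1 := s.curl_T hn j k i
  have a2 := s.curl_T hn i k j
  apply mem_of_two_mul
  convert sub_mem (sub_mem hB a1) a2 using 1
  rw [s.cov2_T_symm k j i, s.Y_antisymm i j k, s.Y_antisymm j i k]
  ring

theorem Y_mem (hn : 2 ≤ n) (i k m : Fin n) : s.Y i k m ∈ P.M := by
  have a1 := s.curl_T hn m k i
  have d1 := s.cov2_T_add_Y hn m k i
  have d2 := s.cov2_T_add_Y hn k m i
  apply mem_of_two_mul
  convert add_mem (sub_mem a1 d1) d2 using 1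
  have := s.Y_cyclic k i m
  rw [s.Y_antisymm m i k, s.Y_antisymm i k m] at *
  linear_combination -this

theorem cov2_T_mem (hn : 2 ≤ n) (m k i : Fin n) : W.cov2 s.T m k i ∈ P.M := by
  convert add_mem (add_mem (s.cov2_T_add_Y hn m k i) (s.Y_mem hn k i m)) (s.Y_mem hn i k m)
    using 1
  ring

theorem tr_lam_Q_mem (hn : 2 ≤ n) (i k j : Fin n) :
    W.tr (fun l m => s.lam m * s.Q i k j l) ∈ P.M := by
  have : W.tr (fun l m => s.lam m * s.Q i k j l) = W.tr (fun α β => s.Y k i α * s.a β j) := by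
    unfold Q Y
    simp_rw [← tr_const_mul]
    rw [tr_comm]
    congr 1; funext α β
    rw [← tr_mul_const]
    congr 1; funext l m
    rw [W.C_rev K α i k l]; ring
  rw [this]
  exact P.tr_mem_M fun α β => P.mem_M_mul (s.Y_mem hn _ _ _) (s.a_mem _ _)

theorem lam_mul_T_mem (hn : 2 ≤ n) (i j k : Fin n) :
    s.lam j * s.T k i + s.lam i * s.T k j ∈ P.M := by
  set t : Fin n → S := fun i => W.tr (fun l m => s.lam m * s.T l i) with ht
  have key : ∀ i j k, s.lam j * s.T k i + s.lam i * s.T k j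
      - W.g j k * t i - W.g i k * t j ∈ P.M := by
    intro i j k
    have h := P.tr_mem_N fun l m => P.mul_mem_N _ (s.lam_mem m) _
      (s.curvature_relation_T (by omega) i j k l)
    simp_rw [mul_add, mul_sub, mul_add, tr_add, tr_sub, tr_add] at h
    have e1 : ∀ i j, W.tr (fun l m => s.lam m * (W.g j l * s.T k i)) = s.lam j * s.T k i :=
      fun i j => W.tr_contract' (fun m => s.lam m * s.T k i) j fun l m => by
        rw [W.g_symm j l]; ring
    have e2 : ∀ i j, W.tr (fun l m => s.lam m * (W.g j k * s.T l i)) = W.g j k * t i := by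
      intro i j
      rw [ht, ← tr_const_mul]
      congr 1; funext l m; ring
    rw [e1, e1, e2, e2] at h
    convert sub_mem (sub_mem (P.N_le_M h) (s.tr_lam_Q_mem hn i k j)) (s.tr_lam_Q_mem hn j k i)
      using 1
    ring
  have ht_mem : ∀ i, t i ∈ P.M := by
    intro i
    have h := P.tr_mem_M fun k j => key i j k
    simp_rw [tr_sub, tr_add, tr_const_mul, tr_mul_const] at h
    have e1 : W.tr (fun k j => s.lam j * s.T k i) = t i := rfl
    have e2 : W.tr (fun k j => W.g j k) = n := by rw [← W.tr_g, ← W.tr_swap]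
    have e3 : W.tr (fun k j => W.g i k * t j) = t i :=
      W.tr_contract' t i fun k j => by rw [W.g_symm i k]; ring
    have e4 : s.lam i * W.tr (fun k j => s.T k j) ∈ P.N := P.mul_mem_N _ (s.lam_mem i) _ s.tr_T_mem
    rw [e1, e2, e3] at h
    apply mem_of_n_mul (by omega : n ≠ 0)
    convert sub_mem (P.N_le_M e4) h using 1
    ring
  convert add_mem (add_mem (key i j k) (P.mul_mem_M (P.g_mem1 j k) (ht_mem i)))
    (P.mul_mem_M (P.g_mem1 i k) (ht_mem j)) using 1
  ring

theorem d_tr_a (m : Fin n) : W.d m (W.tr s.a) - 2 * s.lam m ∈ P.N := by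
  convert P.tr_mem_N fun i j => s.err_mem m i j using 1
  rw [d_tr, tr_sub, tr_add, W.tr_mul_g,
    W.tr_contract' s.lam m (f := fun i j => s.lam j * W.g i m) fun i j => rfl]
  ring

end ApproxSolution
end ErrorClasses
end MetricAlgebra

namespace MetricAlgebra
namespace ErrorClasses

variable {n : ℕ} {S : Type*} [CommRing S] [Algebra ℝ S] {W : MetricAlgebra n S}

/-- The components `a_{ij}` obtained by lowering the indices of `a^{ij}`. -/
def lower2 (W : MetricAlgebra n S) (a : Fin n → Fin n → S) (i j : Fin n) : S :=
  ∑ h, W.g i h * ∑ l, W.g j l * a h l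

/-- The components `v_i` obtained by lowering the index of `v^i`. -/
def lower1 (W : MetricAlgebra n S) (v : Fin n → S) (i : Fin n) : S := ∑ h, W.g i h * v h

/-- The covariant derivative of a contravariant 2-tensor. -/
def covUp (W : MetricAlgebra n S) (a : Fin n → Fin n → S) (m h l : Fin n) : S :=
  W.d m (a h l) + ∑ c, W.chr h m c * a c l + ∑ c, W.chr l m c * a h c

theorem cov2_lower2 (a : Fin n → Fin n → S) (m i j : Fin n) :
    W.cov2 (lower2 W a) m i j = ∑ h, W.g i h * ∑ l, W.g j l * covUp W a m h l := by
  have h1 := W.cov1_lower (fun h => ∑ l, W.g j l * a h l) m i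
  have h2 := fun h => W.cov1_lower (fun l => a h l) m j
  have h3 : W.corr m (fun c => lower2 W a i c) j =
      ∑ h, W.g i h * W.corr m (fun c => ∑ l, W.g c l * a h l) j := by
    simp only [corr, lower2, Finset.mul_sum]
    rw [Finset.sum_comm]
    refine Finset.sum_congr rfl fun h _ => Finset.sum_congr rfl fun b _ =>
      Finset.sum_congr rfl fun l _ => ?_
    ring
  have h4 : W.cov2 (lower2 W a) m i j =
      W.cov1 (fun h => ∑ a_1, W.g h a_1 * ∑ l, W.g j l * a a_1 l) m i
      - W.corr m (fun c => lower2 W a i c) j := rfl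
  rw [h4, h1, h3, ← Finset.sum_sub_distrib]
  refine Finset.sum_congr rfl fun h _ => ?_
  rw [← mul_sub]
  congr 1
  have := h2 h
  simp only [cov1] at this
  have h5 : ∑ b, W.chr h m b * ∑ l, W.g j l * a b l =
      ∑ l, W.g j l * ∑ c, W.chr h m c * a c l := by
    simp only [Finset.mul_sum]
    rw [Finset.sum_comm]
    refine Finset.sum_congr rfl fun h _ => Finset.sum_congr rfl fun b _ => ?_
    ring
  have h6 : ∑ l, W.g j l * covUp W a m h l =
      ∑ l, W.g j l * (W.d m (a h l) + ∑ b, W.chr l m b * a h b)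
      + ∑ l, W.g j l * ∑ c, W.chr h m c * a c l := by
    rw [← Finset.sum_add_distrib]
    refine Finset.sum_congr rfl fun l _ => ?_
    simp only [covUp]; ring
  rw [h5, h6]
  linear_combination this

theorem lower2_symm {a : Fin n → Fin n → S} (ha : ∀ i j, a i j = a j i) (i j : Fin n) :
    lower2 W a i j = lower2 W a j i := by
  simp only [lower2, Finset.mul_sum]
  rw [Finset.sum_comm]
  refine Finset.sum_congr rfl fun h _ => Finset.sum_congr rfl fun l _ => ?_
  rw [ha h l]; ring

theorem cov2_lower2_sub (a : Fin n → Fin n → S) (v : Fin n → S) (m i j : Fin n) :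
    W.cov2 (lower2 W a) m i j - (lower1 W v i * W.g j m + lower1 W v j * W.g i m) =
      ∑ h, W.g i h * ∑ l, W.g j l * (covUp W a m h l
        - v h * (if l = m then 1 else 0) - v l * (if h = m then 1 else 0)) := by
  simp only [cov2_lower2, mul_sub, Finset.sum_sub_distrib, lower1]
  have e1 : ∀ h, ∑ l, W.g j l * (v h * if l = m then 1 else 0) = W.g j m * v h := by
    intro h; simp
  have e2 : ∀ h, ∑ l, W.g j l * (v l * if h = m then 1 else 0) =
      (∑ l, W.g j l * v l) * if h = m then 1 else 0 := by
    intro h; simp only [Finset.sum_mul, mul_assoc]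
  simp only [e1, e2]
  have e3 : ∑ h, W.g i h * (W.g j m * v h) = (∑ h, W.g i h * v h) * W.g j m := by
    rw [Finset.sum_mul]; refine Finset.sum_congr rfl fun h _ => ?_; ring
  have e4 : ∑ h, W.g i h * ((∑ l, W.g j l * v l) * if h = m then 1 else 0)
      = (∑ l, W.g j l * v l) * W.g i m := by
    simp; ring
  rw [e3, e4]; ring

theorem sum_G_mul_lower1 (v : Fin n → S) (h : Fin n) : ∑ i, W.G h i * lower1 W v i = v h := by
  simp only [lower1, Finset.mul_sum]
  rw [Finset.sum_comm]
  simp_rw [← mul_assoc, ← Finset.sum_mul, W.G_mul_g]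
  simp

theorem sum_G_mul_lower2 {a : Fin n → Fin n → S} (ha : ∀ i j, a i j = a j i) (h k : Fin n) :
    ∑ i, W.G h i * lower2 W a k i = ∑ c, a h c * W.g c k := by
  rw [← sum_G_mul_lower1 (W := W) (fun h => ∑ c, a h c * W.g c k) h]
  refine Finset.sum_congr rfl fun i _ => ?_
  rw [lower2_symm ha]
  congr 1
  refine Finset.sum_congr rfl fun l _ => ?_
  congr 1
  refine Finset.sum_congr rfl fun c _ => ?_
  rw [W.g_symm k c]; ring

variable (P : W.ErrorClasses) (K : ℝ)

/-- The approximate solution with lowered indices attached to an approximate solution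
`a^{ij}, λ^i` of the contravariant system. -/
def ofUpper (a : Fin n → Fin n → S) (v : Fin n → S) (a_symm : ∀ i j, a i j = a j i)
    (a_mem : ∀ i j, a i j ∈ P.A1) (v_mem : ∀ i, v i ∈ P.A)
    (err_mem : ∀ m h l, covUp W a m h l - v h * (if l = m then 1 else 0)
      - v l * (if h = m then 1 else 0) ∈ P.N)
    (d_err_mem : ∀ c m h l, W.d c (covUp W a m h l - v h * (if l = m then 1 else 0)
      - v l * (if h = m then 1 else 0)) ∈ P.N)
    (einstein : ∀ i l, W.ric i l - ((n - 1) * K : ℝ) • W.g i l ∈ P.N) :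
    P.ApproxSolution K where
  a := lower2 W a
  lam := lower1 W v
  a_symm := lower2_symm a_symm
  a_mem := fun i j => sum_mem fun h _ => mul_mem (P.g_mem1 _ _)
    (sum_mem fun l _ => mul_mem (P.g_mem1 _ _) (a_mem _ _))
  lam_mem := fun i => sum_mem fun h _ => mul_mem (P.g_mem _ _) (v_mem _)
  err_mem := fun m i j => by
    rw [cov2_lower2_sub]
    exact sum_mem fun h _ => P.mul_mem_N _ (P.g_mem _ _) _
      (sum_mem fun l _ => P.mul_mem_N _ (P.g_mem _ _) _ (err_mem m h l))
  d_err_mem := fun c m i j => by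
    rw [cov2_lower2_sub, map_sum]
    refine sum_mem fun h _ => ?_
    rw [Derivation.leibniz]
    refine add_mem (P.mul_mem_N _ (P.g_mem _ _) _ ?_) (P.mem_N_mul
      (sum_mem fun l _ => P.mul_mem_N _ (P.g_mem _ _) _ (err_mem m h l)) (P.d_g_mem _ _ _))
    rw [map_sum]
    refine sum_mem fun l _ => ?_
    rw [Derivation.leibniz]
    exact add_mem (P.mul_mem_N _ (P.g_mem _ _) _ (d_err_mem c m h l))
      (P.mem_N_mul (err_mem m h l) (P.d_g_mem _ _ _))
  einstein := fun i l => by rw [tr_C]; exact einstein i l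

variable {P K} in
/-- Consequences of an approximate solution of the contravariant system. -/
theorem exists_of_upper (hn : 2 ≤ n) (a : Fin n → Fin n → S) (v : Fin n → S)
    (a_symm : ∀ i j, a i j = a j i)
    (a_mem : ∀ i j, a i j ∈ P.A1) (v_mem : ∀ i, v i ∈ P.A)
    (err_mem : ∀ m h l, covUp W a m h l - v h * (if l = m then 1 else 0)
      - v l * (if h = m then 1 else 0) ∈ P.N)
    (d_err_mem : ∀ c m h l, W.d c (covUp W a m h l - v h * (if l = m then 1 else 0)
      - v l * (if h = m then 1 else 0)) ∈ P.N)
    (einstein : ∀ i l, W.ric i l - ((n - 1) * K : ℝ) • W.g i l ∈ P.N) :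
    ∃ (σ : S) (T : Fin n → Fin n → S),
      (∀ k i, T k i ∈ P.A) ∧
      (∀ h k, W.d k (v h) + ∑ c, W.chr h k c * v c -
        (σ * (if h = k then 1 else 0) - K • ∑ c, a h c * W.g c k + ∑ c, W.G h c * T k c) ∈ P.N) ∧
      (∀ m, W.d m (σ + K • ∑ i, ∑ j, W.g i j * a i j) ∈ P.M) ∧
      (∑ i, ∑ j, W.G i j * T i j ∈ P.N) ∧
      (∀ m k i, W.d m (T k i) - ∑ c, W.chr c m k * T c i - ∑ c, W.chr c m i * T k c ∈ P.M) ∧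
      (∀ i j k, (∑ c, W.g j c * v c) * T k i + (∑ c, W.g i c * v c) * T k j ∈ P.M) := by
  set s := P.ofUpper K a v a_symm a_mem v_mem err_mem d_err_mem einstein with hs
  refine ⟨s.sigma, s.T, s.T_mem, fun h k => ?_, fun m => ?_, s.tr_T_mem, s.cov2_T_mem hn,
    s.lam_mul_T_mem hn⟩
  · have h1 : ∑ i, W.G h i * (s.L k i - s.sigma * W.g k i - s.T k i) ∈ P.N :=
      sum_mem fun i _ => P.mul_mem_N _ (P.G_mem _ _) _ (s.L_sub_mem (by omega) k i)
    convert h1 using 1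
    have e1 : ∀ i, s.L k i = lower1 W (fun h => W.d k (v h) + ∑ c, W.chr h k c * v c) i
        + K • lower2 W a k i := fun i => by
      rw [ApproxSolution.L]
      congr 1
      exact W.cov1_lower v k i
    have e2 : ∀ i, W.G h i * (s.sigma * W.g k i) = s.sigma * (W.G h i * W.g i k) := fun i => by
      rw [W.g_symm k i]; ring
    simp only [mul_sub, mul_add, Finset.sum_sub_distrib, Finset.sum_add_distrib, e1, e2,
      mul_smul_comm, ← Finset.smul_sum, ← Finset.mul_sum, sum_G_mul_lower1,
      sum_G_mul_lower2 a_symm, W.G_mul_g]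
    ring
  · have e : W.tr s.a = ∑ i, ∑ j, W.g i j * a i j := by
      have : ∀ i, ∑ j, W.G i j * s.a i j = ∑ j, W.g i j * a i j := fun i => by
        have := sum_G_mul_lower2 (W := W) a_symm i i
        rw [show s.a = lower2 W a from rfl, this]
        refine Finset.sum_congr rfl fun j _ => ?_
        rw [a_symm i j, W.g_symm j i, a_symm j i]; ring
      simp only [tr, this]
    rw [← e]
    convert add_mem (s.d_sigma hn m) (P.N_le_M (P.N.smul_mem K (s.d_tr_a m))) using 1
    rw [map_add, Derivation.map_smul]
    simp only [Algebra.smul_def, map_mul, map_ofNat]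
    ring

end ErrorClasses
end MetricAlgebra

section Analysis

open scoped ContDiff Topology
open Filter Set

section PartialDerivatives

variable {n : ℕ}

theorem pd_add {i : Fin n} {f h : (Fin n → ℝ) → ℝ} {x : Fin n → ℝ}
    (hf : DifferentiableAt ℝ f x) (hh : DifferentiableAt ℝ h x) :
    pd i (fun y => f y + h y) x = pd i f x + pd i h x := by
  simp only [pd]; rw [fderiv_fun_add hf hh]; rfl

theorem pd_sub {i : Fin n} {f h : (Fin n → ℝ) → ℝ} {x : Fin n → ℝ}
    (hf : DifferentiableAt ℝ f x) (hh : DifferentiableAt ℝ h x) :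
    pd i (fun y => f y - h y) x = pd i f x - pd i h x := by
  simp only [pd]; rw [fderiv_fun_sub hf hh]; rfl

theorem pd_mul {i : Fin n} {f h : (Fin n → ℝ) → ℝ} {x : Fin n → ℝ}
    (hf : DifferentiableAt ℝ f x) (hh : DifferentiableAt ℝ h x) :
    pd i (fun y => f y * h y) x = f x * pd i h x + h x * pd i f x := by
  simp only [pd]; rw [fderiv_fun_mul hf hh]; rfl

theorem pd_const_mul {i : Fin n} {f : (Fin n → ℝ) → ℝ} {x : Fin n → ℝ}
    (hf : DifferentiableAt ℝ f x) (r : ℝ) :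
    pd i (fun y => r * f y) x = r * pd i f x := by
  simp only [pd]; rw [fderiv_const_mul hf]; rfl

theorem pd_neg {i : Fin n} (f : (Fin n → ℝ) → ℝ) (x : Fin n → ℝ) :
    pd i (fun y => -f y) x = -pd i f x := by
  simp only [pd]; rw [fderiv_fun_neg]; rfl

theorem pd_sum {ι : Type*} {s : Finset ι} {i : Fin n} {f : ι → (Fin n → ℝ) → ℝ} {x : Fin n → ℝ}
    (hf : ∀ a ∈ s, DifferentiableAt ℝ (f a) x) :
    pd i (fun y => ∑ a ∈ s, f a y) x = ∑ a ∈ s, pd i (f a) x := by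
  simp only [pd]; rw [fderiv_fun_sum hf, sum_apply]

theorem pd_const (i : Fin n) (r : ℝ) (x : Fin n → ℝ) : pd i (fun _ => r) x = 0 := by
  simp [pd]

theorem pd_congr {i : Fin n} {f h : (Fin n → ℝ) → ℝ} {U : Set (Fin n → ℝ)} (hU : IsOpen U)
    (hfh : ∀ x ∈ U, f x = h x) {x : Fin n → ℝ} (hx : x ∈ U) : pd i f x = pd i h x := by
  simp only [pd]
  rw [Filter.EventuallyEq.fderiv_eq (eventually_of_mem (hU.mem_nhds hx) hfh)]

theorem contDiff_pd {f : (Fin n → ℝ) → ℝ} (hf : ContDiff ℝ ∞ f) (i : Fin n) :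
    ContDiff ℝ ∞ (pd i f) :=
  (hf.fderiv_right (m := ∞) (by simp)).clm_apply contDiff_const

theorem contDiffOn_pd {f : (Fin n → ℝ) → ℝ} {U : Set (Fin n → ℝ)} {r s : ℕ∞} (hU : IsOpen U)
    (hf : ContDiffOn ℝ s f U) (hrs : r + 1 ≤ s) (i : Fin n) : ContDiffOn ℝ r (pd i f) U :=
  (hf.fderiv_of_isOpen hU (by exact_mod_cast hrs)).clm_apply contDiffOn_const

/-- The continuous linear form with prescribed components. -/
def covec (c : Fin n → ℝ) : (Fin n → ℝ) →L[ℝ] ℝ :=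
  ∑ l, c l • ContinuousLinearMap.proj (R := ℝ) (φ := fun _ : Fin n => ℝ) l

theorem covec_single (c : Fin n → ℝ) (i : Fin n) : covec c (Pi.single i 1) = c i := by
  simp [covec, Pi.single_apply]

theorem fderiv_eq_covec (f : (Fin n → ℝ) → ℝ) (x : Fin n → ℝ) :
    fderiv ℝ f x = covec fun l => pd l f x := by
  ext v
  have : v = ∑ l, v l • (Pi.single l 1 : Fin n → ℝ) := by
    ext j; simp [Finset.sum_apply, Pi.single_apply]
  conv_lhs => rw [this]
  simp [covec, pd, mul_comm]

theorem continuous_covec : Continuous (covec : (Fin n → ℝ) → (Fin n → ℝ) →L[ℝ] ℝ) := by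
  unfold covec; fun_prop

theorem pd_eq_of_hasFDerivAt {f : (Fin n → ℝ) → ℝ} {c : Fin n → ℝ} {x : Fin n → ℝ}
    (h : HasFDerivAt f (covec c) x) (i : Fin n) : pd i f x = c i := by
  rw [pd, h.fderiv, covec_single]

theorem contDiffOn_succ_of_pd {f : (Fin n → ℝ) → ℝ} {U : Set (Fin n → ℝ)} {r : ℕ} (hU : IsOpen U)
    (hf : DifferentiableOn ℝ f U) (h : ∀ i, ContDiffOn ℝ r (pd i f) U) :
    ContDiffOn ℝ ((r + 1 : ℕ) : WithTop ℕ∞) f U := by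
  have : ((r + 1 : ℕ) : WithTop ℕ∞) = (r : WithTop ℕ∞) + 1 := by push_cast; rfl
  rw [this, contDiffOn_succ_iff_fderiv_of_isOpen hU]
  refine ⟨hf, fun h => by simp at h, ?_⟩
  have e : fderiv ℝ f = fun x => covec fun l => pd l f x := funext (fderiv_eq_covec f)
  rw [e]
  unfold covec
  exact ContDiffOn.sum fun i _ => (h i).smul contDiffOn_const

theorem pd_comm {f : (Fin n → ℝ) → ℝ} {x : Fin n → ℝ} (hf : ContDiffAt ℝ 2 f x) (i j : Fin n) :
    pd i (pd j f) x = pd j (pd i f) x := by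
  have hs := hf.isSymmSndFDerivAt (by simp)
  have hd : DifferentiableAt ℝ (fderiv ℝ f) x :=
    (hf.fderiv_right (m := 1) (by norm_num)).differentiableAt (by simp)
  have key : ∀ i j : Fin n, pd i (pd j f) x =
      fderiv ℝ (fderiv ℝ f) x (Pi.single i 1) (Pi.single j 1) := by
    intro i j
    have : pd j f = fun y => fderiv ℝ f y (Pi.single j 1) := rfl
    rw [pd, this, fderiv_clm_apply hd (differentiableAt_const _)]
    simp
  rw [key, key, hs.eq]

end PartialDerivatives

/-- Sequences of smooth functions on `ℝⁿ`. -/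
def SmoothSeq (n : ℕ) : Subalgebra ℝ (ℕ → (Fin n → ℝ) → ℝ) where
  carrier := {u | ∀ m, ContDiff ℝ ∞ (u m)}
  mul_mem' := fun hu hv m => (hu m).mul (hv m)
  add_mem' := fun hu hv m => (hu m).add (hv m)
  algebraMap_mem' := fun _ _ => contDiff_const

namespace SmoothSeq

variable {n : ℕ}

theorem differentiable (u : SmoothSeq n) (m : ℕ) : Differentiable ℝ (u.1 m) :=
  (u.2 m).differentiable (by simp)

/-- Termwise partial derivative. -/
def d (i : Fin n) : Derivation ℝ (SmoothSeq n) (SmoothSeq n) :=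
  Derivation.mk'
    { toFun := fun u => ⟨fun m => pd i (u.1 m), fun m => contDiff_pd (u.2 m) i⟩
      map_add' := fun u v => by
        ext m x
        exact pd_add (differentiable u m x) (differentiable v m x)
      map_smul' := fun r u => by
        ext m x
        exact pd_const_mul (differentiable u m x) r }
    fun u v => by
      ext m x
      exact pd_mul (differentiable u m x) (differentiable v m x)

theorem d_apply (i : Fin n) (u : SmoothSeq n) (m : ℕ) : (d i u).1 m = pd i (u.1 m) := rfl

theorem d_comm (i j : Fin n) (u : SmoothSeq n) : d i (d j u) = d j (d i u) := by
  ext m x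
  exact pd_comm (contDiff_infty.1 (u.2 m) 2).contDiffAt i j

end SmoothSeq

/-- Continuous (locally uniform) convergence of a sequence of functions on a set. -/
def LimOn {X β : Type*} [TopologicalSpace X] [TopologicalSpace β] (V : Set X)
    (u : ℕ → X → β) (f : X → β) : Prop :=
  ∀ x ∈ V, Tendsto (fun q : ℕ × X => u q.1 q.2) (atTop ×ˢ 𝓝 x) (𝓝 (f x))

namespace LimOn

variable {X β γ δ : Type*} [TopologicalSpace X] [TopologicalSpace β] [TopologicalSpace γ]
  [TopologicalSpace δ] {V : Set X}

theorem comp {u : ℕ → X → β} {f : X → β} (h : LimOn V u f) {F : β → γ}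
    (hF : ∀ x ∈ V, ContinuousAt F (f x)) : LimOn V (fun m x => F (u m x)) (fun x => F (f x)) :=
  fun x hx => (hF x hx).tendsto.comp (h x hx)

theorem const (b : β) : LimOn V (fun _ _ => b) (fun _ => b) := fun _ _ => tendsto_const_nhds

theorem add {u v : ℕ → X → ℝ} {f g : X → ℝ} (hu : LimOn V u f) (hv : LimOn V v g) :
    LimOn V (fun m x => u m x + v m x) (fun x => f x + g x) := fun x hx => (hu x hx).add (hv x hx)

theorem sub {u v : ℕ → X → ℝ} {f g : X → ℝ} (hu : LimOn V u f) (hv : LimOn V v g) :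
    LimOn V (fun m x => u m x - v m x) (fun x => f x - g x) := fun x hx => (hu x hx).sub (hv x hx)

theorem mul {u v : ℕ → X → ℝ} {f g : X → ℝ} (hu : LimOn V u f) (hv : LimOn V v g) :
    LimOn V (fun m x => u m x * v m x) (fun x => f x * g x) := fun x hx => (hu x hx).mul (hv x hx)

theorem const_mul {u : ℕ → X → ℝ} {f : X → ℝ} (r : ℝ) (hu : LimOn V u f) :
    LimOn V (fun m x => r * u m x) (fun x => r * f x) := (const r).mul hu

theorem sum {ι : Type*} {s : Finset ι} {u : ι → ℕ → X → ℝ} {f : ι → X → ℝ}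
    (hu : ∀ a ∈ s, LimOn V (u a) (f a)) :
    LimOn V (fun m x => ∑ a ∈ s, u a m x) (fun x => ∑ a ∈ s, f a x) :=
  fun x hx => tendsto_finsetSum _ fun a ha => hu a ha x hx

theorem congr {u v : ℕ → X → β} {f g : X → β} (hV : IsOpen V) (hu : LimOn V u f)
    (huv : ∀ m, ∀ x ∈ V, u m x = v m x) (hfg : ∀ x ∈ V, f x = g x) : LimOn V v g := by
  intro x hx
  rw [← hfg x hx]
  refine (hu x hx).congr' ?_
  have : ∀ᶠ q : ℕ × X in atTop ×ˢ 𝓝 x, q.2 ∈ V := tendsto_snd.eventually (hV.mem_nhds hx)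
  filter_upwards [this] with q hq using huv _ _ hq

theorem mono {u : ℕ → X → β} {f : X → β} {V' : Set X} (hu : LimOn V u f) (h : V' ⊆ V) :
    LimOn V' u f := fun x hx => hu x (h hx)

theorem tendsto {u : ℕ → X → β} {f : X → β} (hu : LimOn V u f) {x : X} (hx : x ∈ V) :
    Tendsto (fun m => u m x) atTop (𝓝 (f x)) :=
  (hu x hx).comp (tendsto_id.prodMk (tendsto_const_nhds (x := x)))

theorem eq [T2Space β] {u : ℕ → X → β} {f g : X → β} (hu : LimOn V u f) (hv : LimOn V u g) :
    ∀ x ∈ V, f x = g x := fun _ hx => tendsto_nhds_unique (hu.tendsto hx) (hv.tendsto hx)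

theorem continuousOn [RegularSpace β] {u : ℕ → X → β} {f : X → β} (hV : IsOpen V)
    (hu : LimOn V u f) : ContinuousOn f V := by
  intro x hx
  refine ContinuousAt.continuousWithinAt ?_
  refine (closed_nhds_basis (f x)).tendsto_right_iff.2 fun t ⟨ht, htc⟩ => ?_
  have h1 := (hu x hx).eventually (eventually_mem_set.2 ht)
  obtain ⟨pa, hpa, pb, hpb, hab⟩ := eventually_prod_iff.1 h1
  filter_upwards [hpb, hV.mem_nhds hx] with y hy hyV
  exact htc.mem_of_tendsto (hu.tendsto hyV) (hpa.mono fun m hm => hab hm hy)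

theorem tendstoLocallyUniformlyOn {Y : Type*} [UniformSpace Y] {u : ℕ → X → Y} {f : X → Y}
    (hV : IsOpen V) (hu : LimOn V u f) : TendstoLocallyUniformlyOn u f atTop V := by
  rw [tendstoLocallyUniformlyOn_iff_forall_tendsto]
  intro x hx
  rw [hV.nhdsWithin_eq hx]
  have hc : Tendsto (fun q : ℕ × X => f q.2) (atTop ×ˢ 𝓝 x) (𝓝 (f x)) :=
    ((hu.continuousOn hV).continuousAt (hV.mem_nhds hx)).tendsto.comp tendsto_snd
  exact (hc.prodMk_nhds (hu x hx)).mono_right (nhds_le_uniformity _)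

end LimOn

theorem LimOn.hasFDerivAt {n : ℕ} {V : Set (Fin n → ℝ)} (hV : IsOpen V) {u : ℕ → (Fin n → ℝ) → ℝ}
    (hd : ∀ m, ∀ x ∈ V, DifferentiableAt ℝ (u m) x) {f : (Fin n → ℝ) → ℝ}
    {h : Fin n → (Fin n → ℝ) → ℝ} (hu : LimOn V u f) (hdu : ∀ l, LimOn V (fun m => pd l (u m)) (h l))
    {x : Fin n → ℝ} (hx : x ∈ V) : HasFDerivAt f (covec fun l => h l x) x := by
  have h1 : LimOn V (fun m y => covec fun l => pd l (u m) y) (fun y => covec fun l => h l y) := by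
    intro y hy
    exact (continuous_covec.tendsto _).comp (tendsto_pi_nhds.2 fun l => hdu l y hy)
  refine hasFDerivAt_of_tendstoLocallyUniformlyOn hV (h1.tendstoLocallyUniformlyOn hV)
    (fun m y hy => ?_) (fun y hy => hu.tendsto hy) hx
  rw [← fderiv_eq_covec]
  exact (hd m y hy).hasFDerivAt

open MeasureTheory Metric

section Mollification

variable {n : ℕ}

theorem pd_tsupport_subset (i : Fin n) (f : (Fin n → ℝ) → ℝ) : tsupport (pd i f) ⊆ tsupport f :=
  closure_minimal (fun x hx => by
    by_contra h
    exact hx (by simp [pd, image_eq_zero_of_notMem_tsupport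
      (fun h' => h (tsupport_fderiv_subset ℝ h'))])) (isClosed_tsupport f)

theorem HasCompactSupport.pd {f : (Fin n → ℝ) → ℝ} (hf : HasCompactSupport f) (i : Fin n) :
    HasCompactSupport (pd i f) := hf.mono' (subset_closure.trans (pd_tsupport_subset i f))

/-- Convolution of real functions on `ℝⁿ`. -/
def conv (φ v : (Fin n → ℝ) → ℝ) : (Fin n → ℝ) → ℝ :=
  convolution φ v (ContinuousLinearMap.lsmul ℝ ℝ) volume

theorem conv_apply (φ v : (Fin n → ℝ) → ℝ) (x : Fin n → ℝ) :
    conv φ v x = ∫ t, φ t * v (x - t) := by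
  simp [conv, convolution_def]

theorem conv_apply_swap (φ v : (Fin n → ℝ) → ℝ) (x : Fin n → ℝ) :
    conv φ v x = ∫ t, φ (x - t) * v t := by
  simp [conv, convolution_eq_swap]

theorem contDiff_conv {φ v : (Fin n → ℝ) → ℝ} (hφ : HasCompactSupport φ) (hφs : ContDiff ℝ ∞ φ)
    (hv : Continuous v) : ContDiff ℝ ∞ (conv φ v) :=
  hφ.contDiff_convolution_left _ hφs hv.locallyIntegrable

theorem pd_conv_right {φ v : (Fin n → ℝ) → ℝ} (hφ : Continuous φ)
    (hvs : HasCompactSupport v) (hv : ContDiff ℝ 1 v) (i : Fin n) (x : Fin n → ℝ) :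
    pd i (conv φ v) x = conv φ (pd i v) x := by
  have h := hvs.hasFDerivAt_convolution_right (ContinuousLinearMap.lsmul ℝ ℝ)
    (hφ.locallyIntegrable (μ := volume)) hv x
  rw [pd, conv, h.fderiv]
  rw [convolution_precompR_apply]
  · rfl
  · exact hφ.locallyIntegrable
  · exact hvs.fderiv ℝ
  · exact hv.continuous_fderiv (by simp)

theorem conv_comm (φ v : (Fin n → ℝ) → ℝ) : conv φ v = conv v φ := by
  funext x
  rw [conv_apply, conv_apply_swap]
  simp [mul_comm]

theorem pd_conv_left {φ v : (Fin n → ℝ) → ℝ} (hφ : HasCompactSupport φ) (hφs : ContDiff ℝ 1 φ)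
    (hv : Continuous v) (i : Fin n) (x : Fin n → ℝ) :
    pd i (conv φ v) x = conv (pd i φ) v x := by
  rw [conv_comm φ v, pd_conv_right hv hφ hφs, conv_comm]

theorem conv_add {φ v w : (Fin n → ℝ) → ℝ} (hφ : HasCompactSupport φ) (hφc : Continuous φ)
    (hv : Continuous v) (hw : Continuous w) (x : Fin n → ℝ) :
    conv φ (fun y => v y + w y) x = conv φ v x + conv φ w x := by
  simp only [conv_apply, mul_add]
  refine integral_add ?_ ?_ <;>
  exact (Continuous.integrable_of_hasCompactSupport (by fun_prop) hφ.mul_right)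

theorem conv_const_mul (φ v : (Fin n → ℝ) → ℝ) (r : ℝ) (x : Fin n → ℝ) :
    conv φ (fun y => r * v y) x = r * conv φ v x := by
  simp only [conv_apply]
  rw [← integral_const_mul]
  congr 1; funext t; ring

/-- The `m`-th mollifying kernel, supported in the ball of radius `R / (4 (m + 1))`. -/
def kernelBump {R : ℝ} (hR : 0 < R) (m : ℕ) : ContDiffBump (0 : Fin n → ℝ) where
  rIn := R / (8 * (m + 1))
  rOut := R / (4 * (m + 1))
  rIn_pos := by positivity
  rIn_lt_rOut := by
    apply div_lt_div_of_pos_left hR (by positivity)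
    have : (0 : ℝ) < m + 1 := by positivity
    linarith

/-- A cutoff equal to one on the half ball. -/
def cutoff (p : Fin n → ℝ) {R : ℝ} (hR : 0 < R) : ContDiffBump p where
  rIn := R / 2
  rOut := R
  rIn_pos := by positivity
  rIn_lt_rOut := by linarith

/-- The normalised mollifying kernel. -/
def kernel (n : ℕ) {R : ℝ} (hR : 0 < R) (m : ℕ) : (Fin n → ℝ) → ℝ :=
  (kernelBump (n := n) hR m).normed volume

variable {p : Fin n → ℝ} {R : ℝ} {hR : 0 < R} {U : Set (Fin n → ℝ)}

theorem kernel_hasCompactSupport (m : ℕ) : HasCompactSupport (kernel n hR m) :=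
  (kernelBump hR m).hasCompactSupport_normed

theorem kernel_contDiff (m : ℕ) : ContDiff ℝ ∞ (kernel n hR m) :=
  (kernelBump hR m).contDiff_normed

theorem kernelBump_rOut_le (m : ℕ) : (kernelBump (n := n) hR m).rOut ≤ R / 4 := by
  change R / (4 * (m + 1)) ≤ R / 4
  apply div_le_div_of_nonneg_left hR.le (by norm_num)
  have : (0 : ℝ) ≤ m := by positivity
  linarith

theorem kernel_tsupport (m : ℕ) : tsupport (kernel n hR m) ⊆ closedBall 0 (R / 4) := by
  rw [kernel, ContDiffBump.tsupport_normed_eq]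
  exact closedBall_subset_closedBall (kernelBump_rOut_le m)

/-- The product of a function with the cutoff. -/
def cut (p : Fin n → ℝ) {R : ℝ} (hR : 0 < R) (u : (Fin n → ℝ) → ℝ) (x : Fin n → ℝ) : ℝ :=
  cutoff p hR x * u x

theorem cut_eq {u : (Fin n → ℝ) → ℝ} {x : Fin n → ℝ} (hx : x ∈ closedBall p (R / 2)) :
    cut p hR u x = u x := by
  rw [cut, (cutoff p hR).one_of_mem_closedBall hx, one_mul]

theorem cut_tsupport (u : (Fin n → ℝ) → ℝ) : tsupport (cut p hR u) ⊆ closedBall p R := by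
  refine (tsupport_mul_subset_left (f := fun x => cutoff p hR x)).trans ?_
  rw [ContDiffBump.tsupport_eq]; rfl

theorem cut_hasCompactSupport (u : (Fin n → ℝ) → ℝ) : HasCompactSupport (cut p hR u) :=
  HasCompactSupport.of_support_subset_isCompact (isCompact_closedBall p R)
    (subset_closure.trans (cut_tsupport u))

theorem cut_contDiff (hU : IsOpen U) (hRU : closedBall p R ⊆ U) {u : (Fin n → ℝ) → ℝ} {r : ℕ∞}
    (hu : ContDiffOn ℝ r u U) : ContDiff ℝ r (cut p hR u) := by
  rw [contDiff_iff_contDiffAt]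
  intro x
  by_cases hx : x ∈ tsupport (cut p hR u)
  · exact (cutoff p hR).contDiff.contDiffAt.mul
      (hu.contDiffAt (hU.mem_nhds (hRU (cut_tsupport u hx))))
  · have : cut p hR u =ᶠ[𝓝 x] 0 := notMem_tsupport_iff_eventuallyEq.1 hx
    exact contDiffAt_const.congr_of_eventuallyEq this

theorem cut_continuous (hU : IsOpen U) (hRU : closedBall p R ⊆ U) {u : (Fin n → ℝ) → ℝ}
    (hu : ContinuousOn u U) : Continuous (cut p hR u) := by
  have := cut_contDiff (hR := hR) (r := 0) hU hRU (u := u) (by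
    simpa [contDiffOn_zero] using hu)
  exact this.continuous

/-- Mollification of a function near a point. -/
def mollify (p : Fin n → ℝ) {R : ℝ} (hR : 0 < R) (u : (Fin n → ℝ) → ℝ) (m : ℕ) :
    (Fin n → ℝ) → ℝ := conv (kernel n hR m) (cut p hR u)

theorem mollify_contDiff (hU : IsOpen U) (hRU : closedBall p R ⊆ U) {u : (Fin n → ℝ) → ℝ}
    (hu : ContinuousOn u U) (m : ℕ) : ContDiff ℝ ∞ (mollify p hR u m) :=
  contDiff_conv (kernel_hasCompactSupport m) (kernel_contDiff m) (cut_continuous hU hRU hu)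

theorem mollify_limOn (hU : IsOpen U) (hRU : closedBall p R ⊆ U) {u : (Fin n → ℝ) → ℝ}
    (hu : ContinuousOn u U) : LimOn (closedBall p (R / 2)) (mollify p hR u) u := by
  intro x hx
  have hc : Continuous (cut p hR u) := cut_continuous hU hRU hu
  have h0 : Tendsto (fun m : ℕ => (kernelBump (n := n) hR m).rOut) atTop (𝓝 0) := by
    change Tendsto (fun m : ℕ => R / (4 * ((m : ℝ) + 1))) atTop (𝓝 0)
    refine Tendsto.const_div_atTop ?_ R
    exact (tendsto_atTop_add_const_right _ _ tendsto_natCast_atTop_atTop).const_mul_atTop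
      (by norm_num)
  have := ContDiffBump.convolution_tendsto_right (μ := volume) (ι := ℕ × (Fin n → ℝ))
    (φ := fun q => kernelBump hR q.1) (g := fun _ => cut p hR u) (k := fun q => q.2)
    (x₀ := x) (z₀ := u x) (l := atTop ×ˢ 𝓝 x) (h0.comp tendsto_fst)
    (Eventually.of_forall fun _ => hc.aestronglyMeasurable) ?_ tendsto_snd
  · exact this
  · have h1 : Tendsto (fun y => cut p hR u y) (𝓝 x) (𝓝 (u x)) := by
      have := hc.tendsto x
      rwa [cut_eq hx] at this
    exact h1.comp tendsto_snd

theorem conv_congr_ball {φ v w : (Fin n → ℝ) → ℝ} {r s : ℝ} (hφ : tsupport φ ⊆ closedBall 0 r)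
    (h : ∀ y ∈ ball p (s + r), v y = w y) {x : Fin n → ℝ} (hx : x ∈ ball p s) :
    conv φ v x = conv φ w x := by
  simp only [conv_apply]
  congr 1; funext t
  by_cases ht : t ∈ tsupport φ
  · rw [h]
    have h1 := hφ ht
    simp only [mem_closedBall, mem_ball, dist_eq_norm, sub_zero] at *
    calc ‖x - t - p‖ = ‖(x - p) - t‖ := by congr 1; abel
      _ ≤ ‖x - p‖ + ‖t‖ := norm_sub_le _ _
      _ < s + r := by linarith
  · simp [image_eq_zero_of_notMem_tsupport ht]

theorem mollify_pd (hU : IsOpen U) (hRU : closedBall p R ⊆ U) {u : (Fin n → ℝ) → ℝ}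
    (hu : ContDiffOn ℝ 1 u U) (m : ℕ) (i : Fin n) {x : Fin n → ℝ} (hx : x ∈ ball p (R / 4)) :
    pd i (mollify p hR u m) x = mollify p hR (pd i u) m x := by
  rw [mollify, pd_conv_right (kernel_contDiff m).continuous (cut_hasCompactSupport u)
    (cut_contDiff (r := 1) hU hRU hu), mollify]
  refine conv_congr_ball (kernel_tsupport m) (fun y hy => ?_) hx
  have hy' : y ∈ ball p (R / 2) := by convert hy using 2; ring
  rw [cut_eq (ball_subset_closedBall hy')]
  exact pd_congr isOpen_ball (fun z hz => cut_eq (ball_subset_closedBall hz)) hy'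

theorem mollify_congr {u v : (Fin n → ℝ) → ℝ} (m : ℕ) (h : ∀ x ∈ closedBall p R, u x = v x) :
    mollify p hR u m = mollify p hR v m := by
  have : cut p hR u = cut p hR v := by
    funext x
    by_cases hx : x ∈ closedBall p R
    · rw [cut, cut, h x hx]
    · have h1 : x ∉ tsupport (cut p hR u) := fun h => hx (cut_tsupport u h)
      have h2 : x ∉ tsupport (cut p hR v) := fun h => hx (cut_tsupport v h)
      rw [image_eq_zero_of_notMem_tsupport h1, image_eq_zero_of_notMem_tsupport h2]
  rw [mollify, mollify, this]

theorem mollify_add (hU : IsOpen U) (hRU : closedBall p R ⊆ U) {u v : (Fin n → ℝ) → ℝ}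
    (hu : ContinuousOn u U) (hv : ContinuousOn v U) (m : ℕ) (x : Fin n → ℝ) :
    mollify p hR (fun y => u y + v y) m x = mollify p hR u m x + mollify p hR v m x := by
  rw [mollify, mollify, mollify, ← conv_add (kernel_hasCompactSupport m)
    (kernel_contDiff m).continuous (cut_continuous hU hRU hu) (cut_continuous hU hRU hv)]
  congr 1; funext y; exact mul_add _ _ _

theorem mollify_const_mul (u : (Fin n → ℝ) → ℝ) (r : ℝ) (m : ℕ) (x : Fin n → ℝ) :
    mollify p hR (fun y => r * u y) m x = r * mollify p hR u m x := by
  rw [mollify, mollify, ← conv_const_mul]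
  congr 1; funext y; exact mul_left_comm _ _ _

theorem mollify_abs_le {u : (Fin n → ℝ) → ℝ} (hU : IsOpen U) (hRU : closedBall p R ⊆ U)
    (hu : ContinuousOn u U) {ε : ℝ} (hε : 0 ≤ ε) (h : ∀ x ∈ closedBall p R, |u x| ≤ ε) (m : ℕ)
    (x : Fin n → ℝ) : |mollify p hR u m x| ≤ ε := by
  have hb : ∀ y, |cut p hR u y| ≤ ε := by
    intro y
    by_cases hy : y ∈ closedBall p R
    · rw [cut, abs_mul]
      calc _ ≤ 1 * ε := mul_le_mul (by
            rw [abs_of_nonneg (cutoff p hR).nonneg]; exact (cutoff p hR).le_one) (h y hy)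
            (abs_nonneg _) zero_le_one
        _ = ε := one_mul _
    · rw [image_eq_zero_of_notMem_tsupport fun h => hy (cut_tsupport u h)]; simpa using hε
  have := dist_convolution_le (μ := volume) (f := kernel n hR m) (g := cut p hR u) (x₀ := x)
    (z₀ := 0) hε (kernelBump hR m).support_normed_eq.subset
    (fun y => (kernelBump hR m).nonneg_normed y) ((kernelBump hR m).integral_normed)
    (cut_continuous hU hRU hu).aestronglyMeasurable (fun y _ => by simpa using hb y)
  simpa [mollify, conv] using this

end Mollification

/-- Smooth test functions compactly supported in `V`. -/
structure IsTest {n : ℕ} (V : Set (Fin n → ℝ)) (φ : (Fin n → ℝ) → ℝ) : Prop where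
  contDiff : ContDiff ℝ ∞ φ
  compact : HasCompactSupport φ
  tsupport_subset : tsupport φ ⊆ V

section Testing

variable {n : ℕ} {V : Set (Fin n → ℝ)} {φ : (Fin n → ℝ) → ℝ}

theorem IsTest.pd (h : IsTest V φ) (i : Fin n) : IsTest V (pd i φ) :=
  ⟨contDiff_pd h.contDiff i, h.compact.pd i, (pd_tsupport_subset i φ).trans h.tsupport_subset⟩

theorem IsTest.mono {V' : Set (Fin n → ℝ)} (h : IsTest V φ) (hV : V ⊆ V') : IsTest V' φ :=
  ⟨h.contDiff, h.compact, h.tsupport_subset.trans hV⟩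

theorem IsTest.continuous_mul (h : IsTest V φ) (hV : IsOpen V) {f : (Fin n → ℝ) → ℝ}
    (hf : ContinuousOn f V) : Continuous fun x => f x * φ x := by
  refine continuous_of_tsupport fun x hx => ?_
  have hx' : x ∈ V := h.tsupport_subset (tsupport_mul_subset_right hx)
  exact (hf.continuousAt (hV.mem_nhds hx')).mul h.contDiff.continuous.continuousAt

theorem IsTest.integrable_mul (h : IsTest V φ) (hV : IsOpen V) {f : (Fin n → ℝ) → ℝ}
    (hf : ContinuousOn f V) : Integrable fun x => f x * φ x :=
  (h.continuous_mul hV hf).integrable_of_hasCompactSupport h.compact.mul_left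

theorem LimOn.tendsto_integral {u : ℕ → (Fin n → ℝ) → ℝ} {f : (Fin n → ℝ) → ℝ} (hV : IsOpen V)
    (hu : LimOn V u f) (hc : ∀ m, ContinuousOn (u m) V) (h : IsTest V φ) :
    Tendsto (fun m => ∫ x, u m x * φ x) atTop (𝓝 (∫ x, f x * φ x)) := by
  have hf : ContinuousOn f V := hu.continuousOn hV
  have hunif := (tendstoLocallyUniformlyOn_iff_forall_isCompact hV).1
    (hu.tendstoLocallyUniformlyOn hV) _ h.tsupport_subset h.compact
  rw [Metric.tendstoUniformlyOn_iff] at hunif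
  have h1 := hunif 1 one_pos
  refine tendsto_integral_filter_of_dominated_convergence
    (fun x => ‖f x * φ x‖ + ‖φ x‖) ?_ ?_ ?_ ?_
  · exact Eventually.of_forall fun m => (h.continuous_mul hV (hc m)).aestronglyMeasurable
  · filter_upwards [h1] with m hm
    refine Eventually.of_forall fun x => ?_
    by_cases hx : x ∈ tsupport φ
    · have h2 : dist (f x) (u m x) < 1 := hm x hx
      rw [norm_mul, norm_mul, ← add_one_mul]
      refine mul_le_mul_of_nonneg_right ?_ (norm_nonneg _)
      rw [dist_comm, dist_eq_norm] at h2
      have := norm_le_norm_add_norm_sub (f x) (u m x)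
      rw [norm_sub_rev] at this
      linarith
    · simp [image_eq_zero_of_notMem_tsupport hx]
  · exact (h.integrable_mul hV hf).norm.add
      (h.contDiff.continuous.integrable_of_hasCompactSupport h.compact).norm
  · refine Eventually.of_forall fun x => ?_
    by_cases hx : x ∈ tsupport φ
    · exact (hu.tendsto (h.tsupport_subset hx)).mul_const _
    · simp [image_eq_zero_of_notMem_tsupport hx]

theorem integral_pd_mul {u : (Fin n → ℝ) → ℝ} (hu : ContDiff ℝ ∞ u) (h : IsTest V φ) (i : Fin n) :
    ∫ x, pd i u x * φ x = -∫ x, u x * pd i φ x := by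
  have hi : ∀ {a b : (Fin n → ℝ) → ℝ}, Continuous a → Continuous b → HasCompactSupport b →
      Integrable fun x => a x * b x := fun ha hb hbs =>
    (ha.mul hb).integrable_of_hasCompactSupport hbs.mul_left
  have := integral_mul_fderiv_eq_neg_fderiv_mul_of_integrable (𝕜 := ℝ) (μ := volume) (f := u)
    (g := φ) (v := Pi.single i 1)
    (hi (contDiff_pd hu i).continuous h.contDiff.continuous h.compact)
    (hi hu.continuous (h.pd i).contDiff.continuous (h.pd i).compact)
    (hi hu.continuous h.contDiff.continuous h.compact)
    (fun x _ => (hu.differentiable (by simp)) x) (fun x _ => (h.contDiff.differentiable (by simp)) x)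
  change ∫ x, u x * pd i φ x = -∫ x, pd i u x * φ x at this
  linarith

theorem eq_zero_of_integral_eq_zero (hV : IsOpen V) {f : (Fin n → ℝ) → ℝ} (hf : ContinuousOn f V)
    (h : ∀ φ, IsTest V φ → ∫ x, f x * φ x = 0) : ∀ x ∈ V, f x = 0 := by
  have h1 := hV.ae_eq_zero_of_integral_contDiff_smul_eq_zero (μ := volume)
    (hf.locallyIntegrableOn hV.measurableSet) (fun g hg hgs hgV => by
      rw [← h g ⟨hg, hgs, hgV⟩]
      congr 1; funext x; simp [mul_comm])
  have h2 := Measure.eqOn_open_of_ae_eq (μ := volume) (g := fun _ => (0 : ℝ))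
    ((ae_restrict_iff' hV.measurableSet).2 h1) hV hf continuousOn_const
  exact h2

/-- Sequences tending to zero in the sense of distributions on `V`. -/
def weakNull (V : Set (Fin n → ℝ)) : Submodule ℝ (SmoothSeq n) where
  carrier := {u | ∀ φ, IsTest V φ → Tendsto (fun m => ∫ x, u.1 m x * φ x) atTop (𝓝 0)}
  zero_mem' := fun φ _ => by simp
  add_mem' := fun {u v} hu hv φ hφ => by
    have := (hu φ hφ).add (hv φ hφ)
    rw [add_zero] at this
    refine this.congr fun m => ?_
    rw [← integral_add]
    · simp [add_mul]
    all_goals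
      exact (Continuous.mul (ContDiff.continuous (𝕜 := ℝ) (n := ∞) (by first | exact u.2 m | exact v.2 m))
        hφ.contDiff.continuous).integrable_of_hasCompactSupport hφ.compact.mul_left
  smul_mem' := fun r u hu φ hφ => by
    have := (hu φ hφ).const_mul r
    rw [mul_zero] at this
    refine this.congr fun m => ?_
    rw [← integral_const_mul]
    simp [mul_assoc]

theorem weakNull_of_limOn (hV : IsOpen V) {u : SmoothSeq n} (hu : LimOn V u.1 fun _ => 0) :
    u ∈ weakNull V := fun φ hφ => by
  simpa using hu.tendsto_integral hV (fun m => (u.2 m).continuous.continuousOn) hφ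

theorem d_mem_weakNull {u : SmoothSeq n} (hu : u ∈ weakNull V) (i : Fin n) :
    SmoothSeq.d i u ∈ weakNull V := fun φ hφ => by
  have := (hu _ (hφ.pd i)).neg
  rw [neg_zero] at this
  refine this.congr fun m => ?_
  rw [SmoothSeq.d_apply, integral_pd_mul (u.2 m) hφ]

theorem tendsto_integral_d (hV : IsOpen V) {u : SmoothSeq n} {f : (Fin n → ℝ) → ℝ}
    (hu : LimOn V u.1 f) (i : Fin n) (hφ : IsTest V φ) :
    Tendsto (fun m => ∫ x, (SmoothSeq.d i u).1 m x * φ x) atTop (𝓝 (-∫ x, f x * pd i φ x)) := by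
  refine (hu.tendsto_integral hV (fun m => (u.2 m).continuous.continuousOn) (hφ.pd i)).neg.congr
    fun m => ?_
  rw [SmoothSeq.d_apply, integral_pd_mul (u.2 m) hφ]

theorem eq_zero_of_weakNull (hV : IsOpen V) {u : SmoothSeq n} {f : (Fin n → ℝ) → ℝ}
    (h0 : u ∈ weakNull V) (hu : LimOn V u.1 f) : ∀ x ∈ V, f x = 0 :=
  eq_zero_of_integral_eq_zero hV (hu.continuousOn hV) fun φ hφ => tendsto_nhds_unique
    (hu.tendsto_integral hV (fun m => (u.2 m).continuous.continuousOn) hφ) (h0 φ hφ)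

end Testing

section WeakDerivatives

variable {n : ℕ} {V : Set (Fin n → ℝ)} {p : Fin n → ℝ} {R : ℝ} {κ : (Fin n → ℝ) → ℝ}

theorem pd_comp_sub (hκ : ContDiff ℝ ∞ κ) (x t : Fin n → ℝ) (i : Fin n) :
    pd i (fun s => κ (x - s)) t = -pd i κ (x - t) := by
  have h := ((hκ.differentiable (by simp)) (x - t)).hasFDerivAt.comp t
    ((hasFDerivAt_id t).const_sub x)
  have h' := h.fderiv
  change fderiv ℝ (fun s => κ (x - s)) t = _ at h'
  rw [pd, h']
  simp [pd]

theorem isTest_comp_sub (hκ : ContDiff ℝ ∞ κ) (hκs : tsupport κ ⊆ closedBall 0 (R / 4))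
    {x : Fin n → ℝ} (hx : x ∈ ball p (R / 4)) : IsTest (ball p (R / 2)) fun t => κ (x - t) := by
  have hs : tsupport (fun t => κ (x - t)) ⊆ closedBall x (R / 4) := by
    refine closure_minimal (fun t ht => ?_) isClosed_closedBall
    have := hκs (subset_closure (a := x - t) ht)
    rwa [mem_closedBall, dist_zero_right, ← dist_eq_norm, dist_comm] at this
  refine ⟨hκ.comp (contDiff_const.sub contDiff_id), ?_, hs.trans fun t ht => ?_⟩
  · exact HasCompactSupport.of_support_subset_isCompact (isCompact_closedBall x (R / 4))
      (subset_closure.trans hs)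
  · rw [mem_ball] at *
    have h2 : dist t x ≤ R / 4 := ht
    linarith [dist_triangle t x p]

theorem conv_cut_apply {hR : 0 < R} (hκs : tsupport κ ⊆ closedBall 0 (R / 4))
    (u : (Fin n → ℝ) → ℝ) {x : Fin n → ℝ} (hx : x ∈ ball p (R / 4)) :
    conv κ (cut p hR u) x = ∫ t, u t * κ (x - t) := by
  have : conv κ (cut p hR u) x = conv κ u x := conv_congr_ball hκs (fun y hy => by
    refine cut_eq (ball_subset_closedBall ?_)
    convert hy using 2; ring) hx
  rw [this, conv_apply_swap]
  simp only [mul_comm]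

/-- A continuous function with continuous weak partial derivatives is differentiable. -/
theorem hasFDerivAt_of_weak (hV : IsOpen V) {f : (Fin n → ℝ) → ℝ} {s : Fin n → (Fin n → ℝ) → ℝ}
    (hf : ContinuousOn f V) (hs : ∀ k, ContinuousOn (s k) V)
    (h : ∀ k φ, IsTest V φ → ∫ x, s k x * φ x = -∫ x, f x * pd k φ x) :
    ∀ x ∈ V, HasFDerivAt f (covec fun k => s k x) x := by
  intro x hx
  obtain ⟨R, hR, hRV⟩ := nhds_basis_closedBall.mem_iff.1 (hV.mem_nhds hx)
  have hsub : ball x (R / 4) ⊆ closedBall x (R / 2) :=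
    ball_subset_closedBall.trans (closedBall_subset_closedBall (by linarith))
  have hsub' : ball x (R / 2) ⊆ V :=
    (ball_subset_closedBall.trans (closedBall_subset_closedBall (by linarith))).trans hRV
  have hxm : x ∈ ball x (R / 4) := mem_ball_self (by linarith)
  refine LimOn.hasFDerivAt (V := ball x (R / 4)) isOpen_ball
    (u := mollify x hR f) (h := s)
    (fun m y _ => ((mollify_contDiff hV hRV hf m).differentiable (by simp)) y)
    ((mollify_limOn hV hRV hf).mono hsub) (fun k => ?_) hxm
  refine ((mollify_limOn (hR := hR) hV hRV (hs k)).mono hsub).congr isOpen_ball (fun m y hy => ?_)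
    fun _ _ => rfl
  have hκ := kernel_contDiff (n := n) (hR := hR) m
  rw [mollify, mollify, conv_cut_apply (kernel_tsupport m) _ hy, pd_conv_left
    (kernel_hasCompactSupport m) (contDiff_infty.1 hκ 1) (cut_continuous hV hRV hf),
    conv_cut_apply ((pd_tsupport_subset k _).trans (kernel_tsupport m)) _ hy,
    h k _ ((isTest_comp_sub hκ (kernel_tsupport m) hy).mono hsub')]
  simp [pd_comp_sub hκ, integral_neg]

/-- A distribution of the form `∂_i f - s` all of whose partial derivatives vanish is constant
near each point. -/
theorem exists_const_of_weak_pd_eq_zero (hV : IsOpen V) {f s : (Fin n → ℝ) → ℝ} {i : Fin n}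
    (hf : ContinuousOn f V) (hs : ContinuousOn s V) (hR : 0 < R) (hRV : closedBall p R ⊆ V)
    (h : ∀ j φ, IsTest V φ → -(∫ x, f x * pd i (pd j φ) x) - ∫ x, s x * pd j φ x = 0) :
    ∃ C : ℝ, ∀ φ, IsTest (ball p (R / 4)) φ →
      -(∫ x, f x * pd i φ x) - ∫ x, s x * φ x = C * ∫ x, φ x := by
  have hsub : ball p (R / 4) ⊆ closedBall p (R / 2) :=
    ball_subset_closedBall.trans (closedBall_subset_closedBall (by linarith))
  have hsub' : ball p (R / 2) ⊆ V :=
    (ball_subset_closedBall.trans (closedBall_subset_closedBall (by linarith))).trans hRV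
  set w : ℕ → (Fin n → ℝ) → ℝ := fun m x => pd i (mollify p hR f m) x - mollify p hR s m x with hw
  have hcf := cut_continuous (hR := hR) hV hRV hf
  have hcs := cut_continuous (hR := hR) hV hRV hs
  have hwd : ∀ m, ContDiff ℝ ∞ (w m) := fun m =>
    (contDiff_pd (mollify_contDiff hV hRV hf m) i).sub (mollify_contDiff hV hRV hs m)
  have hwpd : ∀ m j, ∀ x ∈ ball p (R / 4), pd j (w m) x = 0 := by
    intro m j x hx
    have hκ := kernel_contDiff (n := n) (hR := hR) m
    have hκc := kernel_hasCompactSupport (n := n) (hR := hR) m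
    have hκs := kernel_tsupport (n := n) (hR := hR) m
    have e1 : pd i (mollify p hR f m) = conv (pd i (kernel n hR m)) (cut p hR f) :=
      funext fun y => pd_conv_left hκc (contDiff_infty.1 hκ 1) hcf i y
    have hx2 := h j _ ((isTest_comp_sub hκ hκs hx).mono hsub')
    have e2 : pd j (fun t => kernel n hR m (x - t)) = fun t => -pd j (kernel n hR m) (x - t) :=
      funext fun t => pd_comp_sub hκ x t j
    have e3 : pd i (fun t => -pd j (kernel n hR m) (x - t)) =
        fun t => pd i (pd j (kernel n hR m)) (x - t) :=
      funext fun t => by rw [pd_neg, pd_comp_sub (contDiff_pd hκ j), neg_neg]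
    rw [e2, e3] at hx2
    rw [hw, pd_sub (((contDiff_pd (mollify_contDiff hV hRV hf m) i).differentiable (by simp)) x)
      (((mollify_contDiff hV hRV hs m).differentiable (by simp)) x), e1,
      pd_conv_left (hκc.pd i) (contDiff_infty.1 (contDiff_pd hκ i) 1) hcf, mollify,
      pd_conv_left hκc (contDiff_infty.1 hκ 1) hcs,
      conv_cut_apply ((pd_tsupport_subset j _).trans ((pd_tsupport_subset i _).trans hκs)) _ hx,
      conv_cut_apply ((pd_tsupport_subset j _).trans hκs) _ hx]
    simp only [mul_neg, integral_neg] at hx2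
    have e4 : ∀ y, pd j (pd i (kernel n hR m)) y = pd i (pd j (kernel n hR m)) y := fun y =>
      pd_comm (contDiff_infty.1 hκ 2).contDiffAt j i
    simp only [e4]
    linarith
  have hwc : ∀ m, ∀ x ∈ ball p (R / 4), w m x = w m p := by
    intro m x hx
    refine (convex_ball p (R / 4)).is_const_of_fderivWithin_eq_zero (𝕜 := ℝ) (f := w m)
      ((hwd m).differentiable (by simp)).differentiableOn (fun y hy => ?_) hx
      (mem_ball_self (by linarith))
    rw [fderivWithin_of_isOpen isOpen_ball hy, fderiv_eq_covec]
    simp only [hwpd m _ y hy]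
    simp [covec]
  have hlim : ∀ φ, IsTest (ball p (R / 4)) φ → Tendsto (fun m => w m p * ∫ x, φ x) atTop
      (𝓝 (-(∫ x, f x * pd i φ x) - ∫ x, s x * φ x)) := by
    intro φ hφ
    have h1 := ((mollify_limOn (hR := hR) hV hRV hf).mono hsub).tendsto_integral isOpen_ball
      (fun m => (mollify_contDiff hV hRV hf m).continuous.continuousOn) (hφ.pd i)
    have h2 := ((mollify_limOn (hR := hR) hV hRV hs).mono hsub).tendsto_integral isOpen_ball
      (fun m => (mollify_contDiff hV hRV hs m).continuous.continuousOn) hφ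
    refine (h1.neg.sub h2).congr fun m => ?_
    rw [← integral_pd_mul (mollify_contDiff hV hRV hf m) hφ, ← integral_sub
      (hφ.integrable_mul isOpen_ball (contDiff_pd (mollify_contDiff hV hRV hf m) i).continuous.continuousOn)
      (hφ.integrable_mul isOpen_ball (mollify_contDiff hV hRV hs m).continuous.continuousOn),
      ← integral_const_mul]
    congr 1; funext x
    rw [← sub_mul]
    by_cases hx : x ∈ ball p (R / 4)
    · rw [← hwc m x hx]
    · rw [image_eq_zero_of_notMem_tsupport fun h => hx (hφ.tsupport_subset h)]; simp
  let b : ContDiffBump p := ⟨R / 16, R / 8, by positivity, by linarith⟩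
  have hb : IsTest (ball p (R / 4)) (b.normed volume) :=
    ⟨b.contDiff_normed, b.hasCompactSupport_normed, by
      rw [b.tsupport_normed_eq]; exact closedBall_subset_ball (by change R / 8 < R / 4; linarith)⟩
  have hC := hlim _ hb
  rw [b.integral_normed] at hC
  simp only [mul_one] at hC
  exact ⟨_, fun φ hφ => tendsto_nhds_unique (hlim φ hφ) (hC.mul_const _)⟩

end WeakDerivatives

section MatrixInverse

variable {n : ℕ} {E : Type*} [NormedAddCommGroup E] [NormedSpace ℝ E]

theorem contDiffOn_det {r : WithTop ℕ∞} {U : Set E} {F : E → Matrix (Fin n) (Fin n) ℝ}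
    (hF : ∀ i j, ContDiffOn ℝ r (fun x => F x i j) U) : ContDiffOn ℝ r (fun x => (F x).det) U := by
  simp only [Matrix.det_apply']
  exact ContDiffOn.sum fun σ _ => contDiffOn_const.mul (contDiffOn_prod fun i _ => hF _ _)

theorem contDiffOn_inv_entry {r : WithTop ℕ∞} {U : Set E} {F : E → Matrix (Fin n) (Fin n) ℝ}
    (hF : ∀ i j, ContDiffOn ℝ r (fun x => F x i j) U) (hdet : ∀ x ∈ U, (F x).det ≠ 0)
    (i j : Fin n) : ContDiffOn ℝ r (fun x => (F x)⁻¹ i j) U := by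
  have e : ∀ x, (F x)⁻¹ i j = (F x).det⁻¹ * ((F x).updateRow j (Pi.single i 1)).det := fun x => by
    rw [Matrix.inv_def, Matrix.smul_apply, smul_eq_mul, Matrix.adjugate_apply, Ring.inverse_eq_inv']
  simp only [e]
  refine ((contDiffOn_det hF).inv hdet).mul (contDiffOn_det fun k l => ?_)
  simp only [Matrix.updateRow_apply]
  split_ifs
  · exact contDiffOn_const
  · exact hF k l

theorem inv_entry_symm {A : Matrix (Fin n) (Fin n) ℝ} (hA : ∀ i j, A i j = A j i) (i j : Fin n) :
    A⁻¹ i j = A⁻¹ j i := by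
  have : A.transpose = A := by ext k l; exact hA l k
  conv_lhs => rw [← this, ← Matrix.transpose_nonsing_inv]
  rfl

theorem sum_inv_mul {A : Matrix (Fin n) (Fin n) ℝ} (hA : A.det ≠ 0) (i j : Fin n) :
    ∑ k, A⁻¹ i k * A k j = if i = j then 1 else 0 := by
  rw [← Matrix.mul_apply, Matrix.nonsing_inv_mul A (isUnit_iff_ne_zero.2 hA), Matrix.one_apply]

end MatrixInverse

section MetricRegularity

variable {n : ℕ} {g : Fin n → Fin n → (Fin n → ℝ) → ℝ} {U : Set (Fin n → ℝ)}

theorem IsMetric.det_ne_zero {r : WithTop ℕ∞} (hg : IsMetric r g U) {x : Fin n → ℝ} (hx : x ∈ U) :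
    (matAt g x).det ≠ 0 := isUnit_iff_ne_zero.1 (hg.inv x hx)

theorem IsMetric.contDiffOn_ginv {r : WithTop ℕ∞} (hg : IsMetric r g U) (i j : Fin n) :
    ContDiffOn ℝ r (ginv g i j) U :=
  contDiffOn_inv_entry (F := matAt g) hg.contDiff (fun _ hx => hg.det_ne_zero hx) i j

theorem IsMetric.pd_symm {r : WithTop ℕ∞} (hg : IsMetric r g U) (hU : IsOpen U) (k i j : Fin n)
    {x : Fin n → ℝ} (hx : x ∈ U) : pd k (g i j) x = pd k (g j i) x :=
  pd_congr hU (fun y hy => hg.symm i j y hy) hx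

theorem IsMetric.christoffel_symm {r : WithTop ℕ∞} (hg : IsMetric r g U) (hU : IsOpen U)
    (h i j : Fin n) {x : Fin n → ℝ} (hx : x ∈ U) : Christoffel g h i j x = Christoffel g h j i x := by
  simp only [Christoffel]
  congr 1
  refine Finset.sum_congr rfl fun k _ => ?_
  rw [hg.pd_symm hU k i j hx]; ring

theorem IsMetric.contDiffOn_christoffel {r : ℕ∞} (hg : IsMetric (r + 1 : ℕ∞) g U) (hU : IsOpen U)
    (h i j : Fin n) : ContDiffOn ℝ r (Christoffel g h i j) U := by
  have hp : ∀ k i j, ContDiffOn ℝ r (pd k (g i j)) U := fun k i j =>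
    contDiffOn_pd hU (hg.contDiff i j) le_rfl k
  have hi : ∀ i j, ContDiffOn ℝ r (ginv g i j) U := fun i j =>
    (hg.contDiffOn_ginv i j).of_le (by exact_mod_cast le_self_add)
  exact contDiffOn_const.mul (ContDiffOn.sum fun k _ =>
    (hi h k).mul (((hp _ _ _).add (hp _ _ _)).sub (hp _ _ _)))

end MetricRegularity

/-- Convergence of a sequence of smooth functions, uniform near each point of `V`. -/
def SeqLim {n : ℕ} (V : Set (Fin n → ℝ)) (u : SmoothSeq n) (f : (Fin n → ℝ) → ℝ) : Prop :=
  LimOn V u.1 f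

namespace SeqLim

variable {n : ℕ} {V : Set (Fin n → ℝ)} {u v : SmoothSeq n} {f h : (Fin n → ℝ) → ℝ}

theorem add (hu : SeqLim V u f) (hv : SeqLim V v h) : SeqLim V (u + v) fun x => f x + h x :=
  LimOn.add hu hv

theorem sub (hu : SeqLim V u f) (hv : SeqLim V v h) : SeqLim V (u - v) fun x => f x - h x :=
  LimOn.sub hu hv

theorem mul (hu : SeqLim V u f) (hv : SeqLim V v h) : SeqLim V (u * v) fun x => f x * h x :=
  LimOn.mul hu hv

theorem smul (r : ℝ) (hu : SeqLim V u f) : SeqLim V (r • u) fun x => r * f x :=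
  LimOn.const_mul r hu

theorem algebraMap (r : ℝ) : SeqLim V (algebraMap ℝ (SmoothSeq n) r) fun _ => r := LimOn.const r

theorem zero : SeqLim V (0 : SmoothSeq n) fun _ => 0 := LimOn.const 0

theorem ite (q : Prop) [Decidable q] :
    SeqLim V (if q then 1 else 0 : SmoothSeq n) fun _ => if q then (1 : ℝ) else 0 := by
  split_ifs
  · exact LimOn.const 1
  · exact LimOn.const 0

theorem sum {ι : Type*} {s : Finset ι} {u : ι → SmoothSeq n} {f : ι → (Fin n → ℝ) → ℝ}
    (hu : ∀ a, SeqLim V (u a) (f a)) : SeqLim V (∑ a ∈ s, u a) fun x => ∑ a ∈ s, f a x := by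
  have : (∑ a ∈ s, u a).1 = fun m x => ∑ a ∈ s, (u a).1 m x := by
    funext m x
    rw [AddSubmonoidClass.coe_finsetSum, Finset.sum_apply, Finset.sum_apply]
  rw [SeqLim, this]
  exact LimOn.sum fun a _ => hu a

theorem congr (hV : IsOpen V) (hu : SeqLim V u f) (hfh : ∀ x ∈ V, f x = h x) : SeqLim V u h :=
  LimOn.congr hV hu (fun _ _ _ => rfl) hfh

theorem eq (hu : SeqLim V u f) (hv : SeqLim V u h) : ∀ x ∈ V, f x = h x := LimOn.eq hu hv

end SeqLim

/-- Convergent sequences. -/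
def limAlg {n : ℕ} (V : Set (Fin n → ℝ)) : Subalgebra ℝ (SmoothSeq n) where
  carrier := {u | ∃ f, SeqLim V u f}
  mul_mem' := fun ⟨_, hf⟩ ⟨_, hh⟩ => ⟨_, hf.mul hh⟩
  add_mem' := fun ⟨_, hf⟩ ⟨_, hh⟩ => ⟨_, hf.add hh⟩
  algebraMap_mem' := fun r => ⟨_, SeqLim.algebraMap r⟩

/-- Null sequences. -/
def limNull {n : ℕ} (V : Set (Fin n → ℝ)) : Submodule ℝ (SmoothSeq n) where
  carrier := {u | SeqLim V u fun _ => 0}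
  zero_mem' := SeqLim.zero
  add_mem' := fun hf hh => by simpa using SeqLim.add hf hh
  smul_mem' := fun r _ hf => by simpa using SeqLim.smul r hf

theorem SeqLim.d {n : ℕ} {V : Set (Fin n → ℝ)} (hV : IsOpen V) {u : SmoothSeq n}
    {f : (Fin n → ℝ) → ℝ} (hu : SeqLim V u f) (hd : ∀ l, SmoothSeq.d l u ∈ limAlg V) (l : Fin n) :
    SeqLim V (SmoothSeq.d l u) (pd l f) := by
  choose h hh using hd
  refine (hh l).congr hV fun x hx => ?_
  exact (pd_eq_of_hasFDerivAt (LimOn.hasFDerivAt hV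
    (fun m x _ => SmoothSeq.differentiable u m x) hu hh hx) l).symm

section Approximation

variable {n : ℕ} {U : Set (Fin n → ℝ)} {p : Fin n → ℝ} {R : ℝ}

/-- The sequence of mollifications of a continuous function. -/
def mollSeq (hU : IsOpen U) (hR : 0 < R) (hRU : closedBall p R ⊆ U) (u : (Fin n → ℝ) → ℝ)
    (hu : ContinuousOn u U) : SmoothSeq n :=
  ⟨mollify p hR u, mollify_contDiff hU hRU hu⟩

variable {hU : IsOpen U} {hR : 0 < R} {hRU : closedBall p R ⊆ U}

theorem mollSeq_lim {u : (Fin n → ℝ) → ℝ} (hu : ContinuousOn u U) :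
    SeqLim (ball p (R / 4)) (mollSeq hU hR hRU u hu) u :=
  (mollify_limOn hU hRU hu).mono
    (ball_subset_closedBall.trans (closedBall_subset_closedBall (by linarith)))

theorem mollSeq_d_lim {u : (Fin n → ℝ) → ℝ} (hu : ContDiffOn ℝ 1 u U) (i : Fin n) :
    SeqLim (ball p (R / 4)) (SmoothSeq.d i (mollSeq hU hR hRU u hu.continuousOn)) (pd i u) :=
  LimOn.congr isOpen_ball (mollSeq_lim (hU := hU) (hR := hR) (hRU := hRU)
    (contDiffOn_pd (r := 0) (s := 1) hU hu (by simp) i).continuousOn)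
    (fun m _ hx => (mollify_pd hU hRU hu m i hx).symm) fun _ _ => rfl

theorem mollSeq_d_d_lim {u : (Fin n → ℝ) → ℝ} (hu : ContDiffOn ℝ 2 u U) (i j : Fin n) :
    SeqLim (ball p (R / 4)) (SmoothSeq.d j (SmoothSeq.d i (mollSeq hU hR hRU u hu.continuousOn)))
      (pd j (pd i u)) := by
  have h1 : ContDiffOn ℝ 1 (pd i u) U :=
    contDiffOn_pd (r := 1) (s := 2) hU hu (by norm_num) i
  have h2 : ContDiffOn ℝ 1 u U := hu.of_le (by norm_num)
  refine LimOn.congr isOpen_ball (mollSeq_d_lim (hU := hU) (hR := hR) (hRU := hRU) h1 j)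
    (fun m x hx => ?_) fun _ _ => rfl
  exact pd_congr isOpen_ball (fun y hy => (mollify_pd hU hRU h2 m i hy).symm) hx

end Approximation

section ApproximateMetric

variable {n : ℕ} {U : Set (Fin n → ℝ)} {g : Fin n → Fin n → (Fin n → ℝ) → ℝ} {p : Fin n → ℝ}

/-- Mollification of the components of a metric, without loss of nondegeneracy. -/
def approxMetric (p : Fin n → ℝ) {R : ℝ} (hR : 0 < R) (g : Fin n → Fin n → (Fin n → ℝ) → ℝ)
    (m : ℕ) (x : Fin n → ℝ) : Matrix (Fin n) (Fin n) ℝ :=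
  Matrix.of fun i j => g i j p + mollify p hR (fun y => g i j y - g i j p) m x

theorem exists_radius (hU : IsOpen U) (hg : IsMetric 2 g U) (hp : p ∈ U) :
    ∃ R, ∃ hR : 0 < R, closedBall p R ⊆ U ∧ ∀ m x, (approxMetric p hR g m x).det ≠ 0 := by
  have hdet : Continuous fun A : Fin n → Fin n → ℝ => (Matrix.of A).det :=
    Continuous.matrix_det continuous_id
  have h0 : {A : Fin n → Fin n → ℝ | (Matrix.of A).det ≠ 0} ∈ 𝓝 (fun i j => g i j p) :=
    (isOpen_ne.preimage hdet).mem_nhds (hg.det_ne_zero hp)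
  obtain ⟨δ, hδ, hδs⟩ := nhds_basis_closedBall.mem_iff.1 h0
  have h1 : ∀ᶠ x in 𝓝 p, x ∈ U ∧ ∀ i j, |g i j x - g i j p| ≤ δ := by
    refine (hU.mem_nhds hp |> eventually_mem_set.2).and ?_
    refine eventually_all.2 fun i => eventually_all.2 fun j => ?_
    have hc : ContinuousAt (g i j) p := (hg.contDiff i j).continuousOn.continuousAt (hU.mem_nhds hp)
    filter_upwards [Metric.tendsto_nhds.1 hc δ hδ] with x hx
    rw [Real.dist_eq] at hx; exact hx.le
  obtain ⟨R, hR, hRs⟩ := nhds_basis_closedBall.mem_iff.1 h1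
  have hRU : closedBall p R ⊆ U := fun x hx => (hRs hx).1
  refine ⟨R, hR, hRU, fun m x => ?_⟩
  refine hδs (a := fun i j => g i j p + mollify p hR (fun y => g i j y - g i j p) m x) ?_
  rw [mem_closedBall, dist_pi_le_iff hδ.le]
  intro i
  rw [dist_pi_le_iff hδ.le]
  intro j
  rw [Real.dist_eq, add_sub_cancel_left]
  exact mollify_abs_le hU hRU ((hg.contDiff i j).continuousOn.sub continuousOn_const) hδ.le
    (fun y hy => (hRs hy).2 i j) m x

variable {R : ℝ}

/-- The metric algebra of the mollified metric. -/
def approxAlgebra (hU : IsOpen U) (hg : IsMetric 2 g U) (hR : 0 < R) (hRU : closedBall p R ⊆ U)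
    (hdet : ∀ m x, (approxMetric p hR g m x).det ≠ 0) : MetricAlgebra n (SmoothSeq n) :=
  have hs : ∀ m x i j, approxMetric p hR g m x i j = approxMetric p hR g m x j i := by
    intro m x i j
    simp only [approxMetric, Matrix.of_apply]
    rw [hg.symm i j p (hRU (mem_closedBall_self hR.le)),
      mollify_congr m fun y hy => by rw [hg.symm i j y (hRU hy)]]
  have hsm : ∀ m i j, ContDiff ℝ ∞ fun x => approxMetric p hR g m x i j := fun m i j =>
    contDiff_const.add
      (mollify_contDiff hU hRU ((hg.contDiff i j).continuousOn.sub continuousOn_const) m)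
  { d := SmoothSeq.d
    d_comm := SmoothSeq.d_comm
    g := fun i j => ⟨fun m x => approxMetric p hR g m x i j, fun m => hsm m i j⟩
    G := fun i j => ⟨fun m x => (approxMetric p hR g m x)⁻¹ i j, fun m => contDiffOn_univ.1
      (contDiffOn_inv_entry (fun k l => (hsm m k l).contDiffOn) (fun x _ => hdet m x) i j)⟩
    g_symm := fun i j => by ext m x; exact hs m x i j
    G_symm := fun i j => by ext m x; exact inv_entry_symm (hs m x) i j
    G_mul_g := fun i j => by
      ext m x
      rw [AddSubmonoidClass.coe_finsetSum, Finset.sum_apply, Finset.sum_apply]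
      refine (sum_inv_mul (hdet m x) i j).trans ?_
      split_ifs <;> rfl }

variable {hU : IsOpen U} {hg : IsMetric 2 g U} {hR : 0 < R} {hRU : closedBall p R ⊆ U}
  {hdet : ∀ m x, (approxMetric p hR g m x).det ≠ 0}

theorem approx_g_eq (i j : Fin n) : (approxAlgebra hU hg hR hRU hdet).g i j =
    algebraMap ℝ (SmoothSeq n) (g i j p) + mollSeq hU hR hRU (fun y => g i j y - g i j p)
      ((hg.contDiff i j).continuousOn.sub continuousOn_const) := rfl

theorem approx_g_lim (i j : Fin n) :
    SeqLim (ball p (R / 4)) ((approxAlgebra hU hg hR hRU hdet).g i j) (g i j) := by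
  rw [approx_g_eq]
  exact ((SeqLim.algebraMap _).add (mollSeq_lim _)).congr isOpen_ball fun x _ => by ring

theorem approx_d_g_mem (k i j : Fin n) :
    SmoothSeq.d k ((approxAlgebra hU hg hR hRU hdet).g i j) ∈ limAlg (ball p (R / 4)) := by
  rw [approx_g_eq, map_add, Derivation.map_algebraMap, zero_add]
  exact ⟨_, mollSeq_d_lim (((hg.contDiff i j).of_le (by norm_num)).sub contDiffOn_const) k⟩

theorem approx_d_g_lim (k i j : Fin n) : SeqLim (ball p (R / 4))
    (SmoothSeq.d k ((approxAlgebra hU hg hR hRU hdet).g i j)) (pd k (g i j)) :=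
  (approx_g_lim i j).d isOpen_ball (fun l => approx_d_g_mem l i j) k

theorem approx_d_d_g_mem (l k i j : Fin n) :
    SmoothSeq.d l (SmoothSeq.d k ((approxAlgebra hU hg hR hRU hdet).g i j)) ∈
      limAlg (ball p (R / 4)) := by
  rw [approx_g_eq, map_add, Derivation.map_algebraMap, zero_add]
  exact ⟨_, mollSeq_d_d_lim ((hg.contDiff i j).sub contDiffOn_const) k l⟩

theorem quarter_ball_subset (hR : 0 < R) (hRU : closedBall p R ⊆ U) : ball p (R / 4) ⊆ U :=
  (ball_subset_closedBall.trans (closedBall_subset_closedBall (by linarith))).trans hRU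

theorem approx_G_lim (i j : Fin n) :
    SeqLim (ball p (R / 4)) ((approxAlgebra hU hg hR hRU hdet).G i j) (ginv g i j) := by
  have h1 : LimOn (ball p (R / 4))
      (fun m x k l => approxMetric p hR g m x k l) (fun x k l => g k l x) := by
    intro x hx
    exact tendsto_pi_nhds.2 fun k => tendsto_pi_nhds.2 fun l =>
      approx_g_lim (hU := hU) (hg := hg) (hRU := hRU) (hdet := hdet) k l x hx
  refine h1.comp (F := fun A : Fin n → Fin n → ℝ => (Matrix.of A)⁻¹ i j) fun x hx => ?_
  have hx' := quarter_ball_subset hR hRU hx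
  have hc := contDiffOn_inv_entry (r := 0) (U := {A : Fin n → Fin n → ℝ | (Matrix.of A).det ≠ 0})
    (F := fun A => Matrix.of A) (fun k l => (by
      have : ContDiff ℝ 0 fun A : Fin n → Fin n → ℝ => A k l :=
        contDiff_zero.2 (by fun_prop)
      exact this.contDiffOn)) (fun A hA => hA) i j
  refine hc.continuousOn.continuousAt (IsOpen.mem_nhds ?_ (hg.det_ne_zero hx'))
  exact isOpen_ne.preimage (Continuous.matrix_det continuous_id)

theorem approx_chr_lim (h i j : Fin n) :
    SeqLim (ball p (R / 4)) ((approxAlgebra hU hg hR hRU hdet).chr h i j) (Christoffel g h i j) :=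
  (SeqLim.sum fun k => (approx_G_lim h k).mul
    (((approx_d_g_lim i j k).add (approx_d_g_lim j i k)).sub (approx_d_g_lim k i j))).smul (1 / 2)

theorem approx_G_mem (i j : Fin n) :
    (approxAlgebra hU hg hR hRU hdet).G i j ∈ limAlg (ball p (R / 4)) := ⟨_, approx_G_lim i j⟩

theorem approx_chr_mem (h i j : Fin n) :
    (approxAlgebra hU hg hR hRU hdet).chr h i j ∈ limAlg (ball p (R / 4)) :=
  ⟨_, approx_chr_lim h i j⟩

/-- The error classes of convergent and null sequences. -/
def approxClasses (hU : IsOpen U) (hg : IsMetric 2 g U) (hR : 0 < R) (hRU : closedBall p R ⊆ U)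
    (hdet : ∀ m x, (approxMetric p hR g m x).det ≠ 0) :
    (approxAlgebra hU hg hR hRU hdet).ErrorClasses where
  A := limAlg (ball p (R / 4))
  N := limNull (ball p (R / 4))
  mul_mem_N := fun u ⟨f, hf⟩ v hv => by
    have := SeqLim.mul hf hv
    simp only [mul_zero] at this
    exact this
  g_mem := fun i j => ⟨_, approx_g_lim i j⟩
  d_g_mem := approx_d_g_mem
  d_d_g_mem := approx_d_d_g_mem
  G_mem := approx_G_mem
  d_G_mem := fun k i j => by
    rw [MetricAlgebra.d_G]
    exact sub_mem (neg_mem (sum_mem fun a _ =>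
      mul_mem (approx_chr_mem i k a) (approx_G_mem a j))) (sum_mem fun a _ =>
      mul_mem (approx_chr_mem j k a) (approx_G_mem i a))


theorem approx_d_chr_lim (l h i j : Fin n) : SeqLim (ball p (R / 4))
    (SmoothSeq.d l ((approxAlgebra hU hg hR hRU hdet).chr h i j)) (pd l (Christoffel g h i j)) :=
  (approx_chr_lim h i j).d isOpen_ball
    (fun l => ((approxClasses hU hg hR hRU hdet).chr_mem1 h i j).2 l) l

theorem approx_ric_lim (i j : Fin n) :
    SeqLim (ball p (R / 4)) ((approxAlgebra hU hg hR hRU hdet).ric i j) (Ricci g i j) := by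
  have h1 := SeqLim.sum (s := Finset.univ) fun k =>
    ((approx_d_chr_lim (hU := hU) (hg := hg) (hR := hR) (hRU := hRU) (hdet := hdet) k k j i).sub
      (approx_d_chr_lim (hU := hU) (hg := hg) (hR := hR) (hRU := hRU) (hdet := hdet) j k k i)).add
    ((SeqLim.sum (s := Finset.univ) fun a =>
      (approx_chr_lim (hU := hU) (hg := hg) (hR := hR) (hRU := hRU) (hdet := hdet) k k a).mul
        (approx_chr_lim (hU := hU) (hg := hg) (hR := hR) (hRU := hRU) (hdet := hdet) a j i)).sub
      (SeqLim.sum (s := Finset.univ) fun a =>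
      (approx_chr_lim (hU := hU) (hg := hg) (hR := hR) (hRU := hRU) (hdet := hdet) k j a).mul
        (approx_chr_lim (hU := hU) (hg := hg) (hR := hR) (hRU := hRU) (hdet := hdet) a k i)))
  refine SeqLim.congr isOpen_ball h1 fun x hx => ?_
  have hx' := quarter_ball_subset hR hRU hx
  have hd : ∀ h i j, DifferentiableAt ℝ (Christoffel g h i j) x := fun h i j =>
    ((hg.contDiffOn_christoffel (r := 1) hU h i j).contDiffAt (hU.mem_nhds hx')).differentiableAt
      (by simp)
  rw [Ricci, pd_sum fun a _ => hd a i a]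
  simp only [Finset.sum_add_distrib, Finset.sum_sub_distrib]
  have s1 : ∀ l h i j, pd l (Christoffel g h i j) x = pd l (Christoffel g h j i) x :=
    fun l h i j => pd_congr hU (fun y hy => hg.christoffel_symm hU h i j hy) hx'
  have e1 : ∑ k, pd k (Christoffel g k j i) x = ∑ k, pd k (Christoffel g k i j) x :=
    Finset.sum_congr rfl fun k _ => s1 _ _ _ _
  have e2 : ∑ k, pd j (Christoffel g k k i) x = ∑ k, pd j (Christoffel g k i k) x :=
    Finset.sum_congr rfl fun k _ => s1 _ _ _ _
  have e3 : ∑ k, ∑ a, Christoffel g k k a x * Christoffel g a j i x =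
      ∑ k, ∑ a, Christoffel g k k a x * Christoffel g a i j x :=
    Finset.sum_congr rfl fun k _ => Finset.sum_congr rfl fun a _ => by
      rw [hg.christoffel_symm hU a j i hx']
  have e4 : ∑ k, ∑ a, Christoffel g k j a x * Christoffel g a k i x =
      ∑ k, ∑ a, Christoffel g k j a x * Christoffel g a i k x :=
    Finset.sum_congr rfl fun k _ => Finset.sum_congr rfl fun a _ => by
      rw [hg.christoffel_symm hU a k i hx']
  rw [e1, e2, e3, e4]; ring

theorem approx_M_le : (approxClasses hU hg hR hRU hdet).M ≤ weakNull (ball p (R / 4)) := by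
  refine sup_le (fun u hu => weakNull_of_limOn isOpen_ball hu) (iSup_le fun i => ?_)
  rintro _ ⟨u, hu, rfl⟩
  exact d_mem_weakNull (weakNull_of_limOn isOpen_ball hu) i

end ApproximateMetric

/-- A solution `(a, v)` of the linear equations governing the geodesic mappings of `g`:
`∇_m a^{hl} = v^h δ^l_m + v^l δ^h_m`. -/
structure IsSinyukov {n : ℕ} (g : Fin n → Fin n → (Fin n → ℝ) → ℝ) (U : Set (Fin n → ℝ))
    (a : Fin n → Fin n → (Fin n → ℝ) → ℝ) (v : Fin n → (Fin n → ℝ) → ℝ) : Prop where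
  symm : ∀ h l, ∀ x ∈ U, a h l x = a l h x
  contDiffOn : ∀ h l, ContDiffOn ℝ 1 (a h l) U
  continuousOn : ∀ h, ContinuousOn (v h) U
  pd_eq : ∀ m h l, ∀ x ∈ U, pd m (a h l) x =
    (-∑ c, Christoffel g h m c x * a c l x - ∑ c, Christoffel g l m c x * a h c x)
      + v h x * (if l = m then 1 else 0) + v l x * (if h = m then 1 else 0)

/-- The trace `g_{ij} a^{ij}`. -/
def trUp {n : ℕ} (g a : Fin n → Fin n → (Fin n → ℝ) → ℝ) (x : Fin n → ℝ) : ℝ :=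
  ∑ i, ∑ j, g i j x * a i j x

/-- The right-hand side of the equation for `∂_k v^h`, with `s` the trace part and `T` the
remaining part of the covariant derivative. -/
def vDeriv {n : ℕ} (g a : Fin n → Fin n → (Fin n → ℝ) → ℝ) (v : Fin n → (Fin n → ℝ) → ℝ) (K : ℝ)
    (s : (Fin n → ℝ) → ℝ) (T : Fin n → Fin n → (Fin n → ℝ) → ℝ) (h k : Fin n) (x : Fin n → ℝ) : ℝ :=
  -(∑ c, Christoffel g h k c x * v c x) + s x * (if h = k then 1 else 0)
    - K * (∑ c, a h c x * g c k x) + ∑ c, ginv g h c x * T k c x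

section LocalSolution

variable {n : ℕ} {U : Set (Fin n → ℝ)} {g a : Fin n → Fin n → (Fin n → ℝ) → ℝ}
  {v : Fin n → (Fin n → ℝ) → ℝ} {p : Fin n → ℝ} {R K : ℝ}

variable (hU : IsOpen U) (hg : IsMetric 2 g U) (hR : 0 < R) (hRU : closedBall p R ⊆ U)
  (hdet : ∀ m x, (approxMetric p hR g m x).det ≠ 0) (hav : IsSinyukov g U a v)

theorem approx_err (m h l : Fin n) :
    ∃ e : SmoothSeq n, SeqLim (ball p (R / 4)) e (fun _ => 0) ∧
      (∀ c, SmoothSeq.d c e ∈ limAlg (ball p (R / 4))) ∧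
      ∀ q, ∀ x ∈ ball p (R / 4), (MetricAlgebra.ErrorClasses.covUp (approxAlgebra hU hg hR hRU hdet)
        (fun i j => mollSeq hU hR hRU (a i j) (hav.contDiffOn i j).continuousOn) m h l
        - mollSeq hU hR hRU (v h) (hav.continuousOn h) * (if l = m then 1 else 0)
        - mollSeq hU hR hRU (v l) (hav.continuousOn l) * (if h = m then 1 else 0)).1 q x
        = e.1 q x := by
  set W := approxAlgebra hU hg hR hRU hdet with hW
  set P := approxClasses hU hg hR hRU hdet with hP
  have hΓ := fun h i j => hg.contDiffOn_christoffel (r := 1) hU h i j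
  set Q : (Fin n → ℝ) → ℝ := fun x =>
    -∑ c, Christoffel g h m c x * a c l x - ∑ c, Christoffel g l m c x * a h c x with hQ
  have hQ1 : ContDiffOn ℝ 1 Q U :=
    (ContDiffOn.sum fun c _ => (hΓ h m c).mul (hav.contDiffOn c l)).neg.sub
      (ContDiffOn.sum fun c _ => (hΓ l m c).mul (hav.contDiffOn h c))
  let α : Fin n → Fin n → SmoothSeq n := fun i j =>
    mollSeq hU hR hRU (a i j) (hav.contDiffOn i j).continuousOn
  have hα : ∀ i j, SeqLim (ball p (R / 4)) (α i j) (a i j) := fun i j => mollSeq_lim _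
  have hα1 : ∀ i j, α i j ∈ P.A1 := fun i j => ⟨⟨_, hα i j⟩, fun k =>
    ⟨_, mollSeq_d_lim (hav.contDiffOn i j) k⟩⟩
  let qs : SmoothSeq n := mollSeq hU hR hRU Q hQ1.continuousOn
  have hq1 : qs ∈ P.A1 := ⟨⟨_, mollSeq_lim _⟩, fun k => ⟨_, mollSeq_d_lim hQ1 k⟩⟩
  have hmem : qs + ∑ c, W.chr h m c * α c l + ∑ c, W.chr l m c * α h c ∈ P.A1 :=
    add_mem (add_mem hq1 (sum_mem fun c _ => mul_mem (P.chr_mem1 h m c) (hα1 c l)))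
      (sum_mem fun c _ => mul_mem (P.chr_mem1 l m c) (hα1 h c))
  refine ⟨qs + ∑ c, W.chr h m c * α c l + ∑ c, W.chr l m c * α h c, ?_, fun c => hmem.2 c, ?_⟩
  · refine (((mollSeq_lim _).add (SeqLim.sum fun c => (approx_chr_lim h m c).mul (hα c l))).add
      (SeqLim.sum fun c => (approx_chr_lim l m c).mul (hα h c))).congr isOpen_ball fun x _ => ?_
    simp only [hQ]; ring
  · intro q x hx
    have e1 : (SmoothSeq.d m (α h l)).1 q x = qs.1 q x
        + (if l = m then 1 else 0) * mollify p hR (v h) q x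
        + (if h = m then 1 else 0) * mollify p hR (v l) q x := by
      change pd m (mollify p hR (a h l) q) x = mollify p hR Q q x + _ + _
      have hc : ∀ (r : ℝ) (i : Fin n), ContinuousOn (fun y => r * v i y) U :=
        fun r i => continuousOn_const.mul (hav.continuousOn i)
      rw [mollify_pd hU hRU (hav.contDiffOn h l) q m hx, ← mollify_const_mul, ← mollify_const_mul,
        ← mollify_add hU hRU hQ1.continuousOn (hc _ _), ← mollify_add hU hRU
          (u := fun y => Q y + _ * v h y) (hQ1.continuousOn.add (hc _ _)) (hc _ _)]
      refine congrFun (mollify_congr q fun y hy => ?_) x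
      rw [hav.pd_eq m h l y (hRU hy)]
      ring
    have e2 : ∀ (r : Prop) [Decidable r], ((if r then 1 else 0 : SmoothSeq n)).1 q x
        = if r then (1 : ℝ) else 0 := by
      intro r _; split_ifs <;> rfl
    change (SmoothSeq.d m (α h l)).1 q x + (∑ c, W.chr h m c * α c l).1 q x
        + (∑ c, W.chr l m c * α h c).1 q x
        - mollify p hR (v h) q x * ((if l = m then 1 else 0 : SmoothSeq n)).1 q x
        - mollify p hR (v l) q x * ((if h = m then 1 else 0 : SmoothSeq n)).1 q x
      = qs.1 q x + (∑ c, W.chr h m c * α c l).1 q x + (∑ c, W.chr l m c * α h c).1 q x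
    rw [e1, e2, e2]
    ring

/-- Local regularity: the data of a solution are differentiable and satisfy the prolonged
system. -/
theorem exists_local_prolongation (hn : 2 ≤ n) (hU : IsOpen U) (hg : IsMetric 2 g U)
    (hE : ∀ i j, ∀ x ∈ U, Ricci g i j x = ((n - 1) * K) * g i j x) (hav : IsSinyukov g U a v)
    (hp : p ∈ U) :
    ∃ r > 0, ball p r ⊆ U ∧ ∃ (C : ℝ) (T : Fin n → Fin n → (Fin n → ℝ) → ℝ), ∀ x ∈ ball p r,
      (∀ h, HasFDerivAt (v h) (covec fun k => vDeriv g a v K (fun y => C - K * trUp g a y) T h k x) x)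
      ∧ (∑ i, ∑ j, ginv g i j x * T i j x = 0)
      ∧ (∀ k i, HasFDerivAt (T k i) (covec fun m =>
          ∑ c, Christoffel g c m k x * T c i x + ∑ c, Christoffel g c m i x * T k c x) x)
      ∧ (∀ i j k, (∑ c, g j c x * v c x) * T k i x + (∑ c, g i c x * v c x) * T k j x = 0) := by
  obtain ⟨R, hR, hRU, hdet⟩ := exists_radius hU hg hp
  set V := ball p (R / 4) with hV
  have hVo : IsOpen V := isOpen_ball
  have hVU : V ⊆ U := quarter_ball_subset hR hRU
  set W := approxAlgebra hU hg hR hRU hdet with hW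
  set P := approxClasses hU hg hR hRU hdet with hP
  let α : Fin n → Fin n → SmoothSeq n := fun i j =>
    mollSeq hU hR hRU (a i j) (hav.contDiffOn i j).continuousOn
  let ν : Fin n → SmoothSeq n := fun i => mollSeq hU hR hRU (v i) (hav.continuousOn i)
  have hα : ∀ i j, SeqLim V (α i j) (a i j) := fun i j => mollSeq_lim _
  have hν : ∀ i, SeqLim V (ν i) (v i) := fun i => mollSeq_lim _
  have hΓ : ∀ h i j, SeqLim V (W.chr h i j) (Christoffel g h i j) := approx_chr_lim
  have hgl : ∀ i j, SeqLim V (W.g i j) (g i j) := approx_g_lim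
  have hGl : ∀ i j, SeqLim V (W.G i j) (ginv g i j) := approx_G_lim
  have hM : ∀ {u}, u ∈ P.M → u ∈ weakNull V := fun hu => approx_M_le hu
  obtain ⟨σ, T, hTm, hv1, hσ, hTtr, hTd, hTv⟩ := P.exists_of_upper (K := K) hn α ν
    (fun i j => by
      ext q x
      exact congrFun (mollify_congr q fun y hy => hav.symm i j y (hRU hy)) x)
    (fun i j => ⟨⟨_, hα i j⟩, fun k => ⟨_, mollSeq_d_lim (hav.contDiffOn i j) k⟩⟩)
    (fun i => ⟨_, hν i⟩)
    (fun m h l => by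
      obtain ⟨e, he, -, hee⟩ := approx_err hU hg hR hRU hdet hav m h l
      exact LimOn.congr isOpen_ball he (fun q x hx => (hee q x hx).symm) fun _ _ => rfl)
    (fun c m h l => by
      obtain ⟨e, he, hed, hee⟩ := approx_err hU hg hR hRU hdet hav m h l
      refine LimOn.congr isOpen_ball (he.d isOpen_ball hed c)
        (fun q x hx => ?_) fun x _ => pd_const c 0 x
      exact (pd_congr isOpen_ball (hee q) hx).symm)
    (fun i j => by
      refine ((approx_ric_lim i j).sub ((hgl i j).smul _)).congr isOpen_ball fun x hx => ?_
      rw [hE i j x (hVU hx)]; ring)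
  choose T0 hT0 using hTm
  -- the trace-modified scalar and the regular part of the derivative of `v`
  have htr : SeqLim V (∑ i, ∑ j, W.g i j * α i j) (trUp g a) :=
    SeqLim.sum fun i => SeqLim.sum fun j => (hgl i j).mul (hα i j)
  set s : Fin n → Fin n → (Fin n → ℝ) → ℝ := fun h k =>
    vDeriv g a v K (fun y => -(K * trUp g a y)) T0 h k with hs
  set σ' : SmoothSeq n := σ + K • ∑ i, ∑ j, W.g i j * α i j with hσ'
  have hS : ∀ h k, ∃ Sq : SmoothSeq n, SeqLim V Sq (s h k) ∧
      SmoothSeq.d k (ν h) - Sq - σ' * (if h = k then 1 else 0) ∈ weakNull V := by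
    intro h k
    refine ⟨(-1 : ℝ) • (∑ c, W.chr h k c * ν c)
      + (-1 : ℝ) • (K • ∑ i, ∑ j, W.g i j * α i j) * (if h = k then 1 else 0)
      - K • (∑ c, α h c * W.g c k) + ∑ c, W.G h c * T k c, ?_, ?_⟩
    · refine (((((SeqLim.sum fun c => (hΓ h k c).mul (hν c)).smul (-1)).add
        ((((htr.smul K)).smul (-1)).mul (SeqLim.ite (h = k)))).sub
        ((SeqLim.sum fun c => (hα h c).mul (hgl c k)).smul K)).add
        (SeqLim.sum fun c => (hGl h c).mul (hT0 k c))).congr hVo fun x _ => ?_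
      simp only [hs, vDeriv]; ring
    · have h1 := weakNull_of_limOn hVo (hv1 h k)
      convert h1 using 1
      simp only [hσ', neg_smul, one_smul]
      change SmoothSeq.d k (ν h) - _ - _ = SmoothSeq.d k (ν h) + _ - _
      ring
  have hsc : ∀ h k, ContinuousOn (s h k) V := fun h k => by
    obtain ⟨Sq, h1, -⟩ := hS h k
    exact LimOn.continuousOn hVo h1
  have hvc : ∀ h, ContinuousOn (v h) V := fun h => (hav.continuousOn h).mono hVU
  have hIntegrable : ∀ {φ : (Fin n → ℝ) → ℝ}, IsTest V φ → ∀ (u : SmoothSeq n) q,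
      Integrable fun x => u.1 q x * φ x := fun hφ u q =>
    hφ.integrable_mul hVo (u.2 q).continuous.continuousOn
  have hw : ∀ h k φ, IsTest V φ →
      Tendsto (fun q => ∫ x, (σ' * (if h = k then 1 else 0)).1 q x * φ x) atTop
        (𝓝 (-(∫ x, v h x * pd k φ x) - ∫ x, s h k x * φ x)) := by
    intro h k φ hφ
    obtain ⟨Sq, h1, h2⟩ := hS h k
    have l1 := tendsto_integral_d hVo (hν h) k hφ
    have l2 := h1.tendsto_integral hVo (fun m => (Sq.2 m).continuous.continuousOn) hφ
    have := (l1.sub l2).sub (h2 φ hφ)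
    rw [sub_zero] at this
    refine this.congr fun q => ?_
    rw [← integral_sub (hIntegrable hφ _ q) (hIntegrable hφ _ q), ← integral_sub
      (f := fun x => (SmoothSeq.d k (ν h)).1 q x * φ x - Sq.1 q x * φ x)
      ((hIntegrable hφ _ q).sub (hIntegrable hφ _ q)) (hIntegrable hφ _ q)]
    congr 1; funext x
    change (SmoothSeq.d k (ν h)).1 q x * φ x - Sq.1 q x * φ x
      - ((SmoothSeq.d k (ν h)).1 q x - Sq.1 q x - (σ' * (if h = k then 1 else 0)).1 q x) * φ x = _
    ring
  let i0 : Fin n := ⟨0, by omega⟩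
  have hw0 : ∀ i φ, IsTest V φ → Tendsto (fun q => ∫ x, σ'.1 q x * φ x) atTop
        (𝓝 (-(∫ x, v i x * pd i φ x) - ∫ x, s i i x * φ x)) := by
    intro i φ hφ
    have := hw i i φ hφ
    simp only [if_true, mul_one] at this
    exact this
  have hRV : closedBall p (R / 8) ⊆ V := closedBall_subset_ball (by linarith)
  obtain ⟨C, hC⟩ := exists_const_of_weak_pd_eq_zero (p := p) (R := R / 8) (i := i0) hVo (hvc i0)
    (hsc i0 i0) (by positivity) hRV (fun j φ hφ => by
      refine tendsto_nhds_unique (hw0 i0 _ (hφ.pd j)) ?_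
      have := (hM (hσ j) φ hφ).neg
      rw [neg_zero] at this
      refine this.congr fun q => ?_
      change -∫ x, pd j (σ'.1 q) x * φ x = _
      rw [integral_pd_mul (σ'.2 q) hφ, neg_neg])
  set r := R / 8 / 4 with hr
  have hrV : ball p r ⊆ V := ball_subset_ball (by rw [hr]; linarith)
  have hTc : ∀ k i, ContinuousOn (T0 k i) V := fun k i => LimOn.continuousOn hVo (hT0 k i)
  refine ⟨r, by positivity, hrV.trans hVU, C, T0, fun x hx => ⟨fun h => ?_, ?_, fun k i => ?_, ?_⟩⟩
  · have key := hasFDerivAt_of_weak (V := ball p r) isOpen_ball (f := v h)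
      (s := fun k y => s h k y + C * if h = k then 1 else 0) ((hvc h).mono hrV)
      (fun k => ((hsc h k).mono hrV).add continuousOn_const) (fun k φ hφ => by
        have hφV := hφ.mono hrV
        have e : -(∫ x, v h x * pd k φ x) - ∫ x, s h k x * φ x
            = (C * if h = k then 1 else 0) * ∫ x, φ x := by
          split_ifs with hhk
          · subst hhk
            rw [mul_one, ← hC φ hφ]
            exact tendsto_nhds_unique (hw0 h φ hφV) (hw0 i0 φ hφV)
          · refine tendsto_nhds_unique (hw h k φ hφV) ?_
            simp [hhk]
        have e2 : ∫ x, (s h k x + C * if h = k then 1 else 0) * φ x =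
            (∫ x, s h k x * φ x) + (C * if h = k then 1 else 0) * ∫ x, φ x := by
          rw [← integral_const_mul, ← integral_add (hφV.integrable_mul hVo (hsc h k))
            ((hφV.contDiff.continuous.integrable_of_hasCompactSupport hφV.compact).const_mul _)]
          simp only [add_mul]
        rw [e2, ← e]; ring) x hx
    convert key using 2
    funext k
    simp only [hs, vDeriv]; ring
  · exact SeqLim.eq (SeqLim.sum fun i => SeqLim.sum fun j => (hGl i j).mul (hT0 i j)) hTtr x (hrV hx)
  · have hrhs : ∀ m, SeqLim V (∑ c, W.chr c m k * T c i + ∑ c, W.chr c m i * T k c)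
        (fun x => ∑ c, Christoffel g c m k x * T0 c i x + ∑ c, Christoffel g c m i x * T0 k c x) :=
      fun m => (SeqLim.sum fun c => (hΓ c m k).mul (hT0 c i)).add
        (SeqLim.sum fun c => (hΓ c m i).mul (hT0 k c))
    refine hasFDerivAt_of_weak hVo (hTc k i)
      (fun m => LimOn.continuousOn hVo (hrhs m)) (fun m φ hφ => ?_) x (hrV hx)
    have l1 := tendsto_integral_d hVo (hT0 k i) m hφ
    have l2 := (hrhs m).tendsto_integral hVo (fun q =>
      ((∑ c, W.chr c m k * T c i + ∑ c, W.chr c m i * T k c).2 q).continuous.continuousOn) hφ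
    have l3 := (l1.sub (hM (hTd m k i) φ hφ))
    rw [sub_zero] at l3
    refine tendsto_nhds_unique l2 (l3.congr fun q => ?_)
    rw [← integral_sub (hIntegrable hφ _ q) (hIntegrable hφ _ q)]
    congr 1; funext x
    change (SmoothSeq.d m (T k i)).1 q x * φ x - ((SmoothSeq.d m (T k i)).1 q x
      - (∑ c, W.chr c m k * T c i).1 q x - (∑ c, W.chr c m i * T k c).1 q x) * φ x
      = ((∑ c, W.chr c m k * T c i).1 q x + (∑ c, W.chr c m i * T k c).1 q x) * φ x
    ring
  · intro i j k
    exact eq_zero_of_weakNull hVo (hM (hTv i j k))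
      (((SeqLim.sum fun c => (hgl j c).mul (hν c)).mul (hT0 k i)).add
        ((SeqLim.sum fun c => (hgl i c).mul (hν c)).mul (hT0 k j))) x (hrV hx)

end LocalSolution

section MetricDerivatives

variable {n : ℕ} {g : Fin n → Fin n → (Fin n → ℝ) → ℝ} {U : Set (Fin n → ℝ)} {r : WithTop ℕ∞}

theorem IsMetric.differentiableAt (hg : IsMetric r g U) (hr : r ≠ 0) (hU : IsOpen U) (i j : Fin n)
    {x : Fin n → ℝ} (hx : x ∈ U) : DifferentiableAt ℝ (g i j) x :=
  ((hg.contDiff i j).differentiableOn hr).differentiableAt (hU.mem_nhds hx)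

theorem IsMetric.differentiableAt_ginv (hg : IsMetric r g U) (hr : r ≠ 0) (hU : IsOpen U)
    (i j : Fin n) {x : Fin n → ℝ} (hx : x ∈ U) : DifferentiableAt ℝ (ginv g i j) x :=
  ((hg.contDiffOn_ginv i j).differentiableOn hr).differentiableAt (hU.mem_nhds hx)

theorem IsMetric.sum_ginv_mul (hg : IsMetric r g U) {x : Fin n → ℝ} (hx : x ∈ U) (i j : Fin n) :
    ∑ k, ginv g i k x * g k j x = if i = j then 1 else 0 :=
  sum_inv_mul (hg.det_ne_zero hx) i j

theorem IsMetric.sum_mul_ginv (hg : IsMetric r g U) {x : Fin n → ℝ} (hx : x ∈ U) (i j : Fin n) :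
    ∑ k, g i k x * ginv g k j x = if i = j then 1 else 0 := by
  have := congrFun (congrFun (Matrix.mul_nonsing_inv (matAt g x) (hg.inv x hx)) i) j
  rwa [Matrix.mul_apply, Matrix.one_apply] at this

theorem IsMetric.ginv_symm (hg : IsMetric r g U) {x : Fin n → ℝ} (hx : x ∈ U) (i j : Fin n) :
    ginv g i j x = ginv g j i x :=
  inv_entry_symm (fun i j => hg.symm i j x hx) i j

theorem IsMetric.pd_eq (hg : IsMetric r g U) (hU : IsOpen U) (k i j : Fin n)
    {x : Fin n → ℝ} (hx : x ∈ U) : pd k (g i j) x =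
      ∑ c, Christoffel g c k i x * g c j x + ∑ c, Christoffel g c k j x * g i c x :=
  levi_civita_compat (S := ℝ) (g := fun i j => g i j x) (G := fun i j => ginv g i j x)
    (dg := fun k i j => pd k (g i j) x) (fun i j => hg.symm i j x hx) (hg.sum_mul_ginv hx)
    (fun k i j => hg.pd_symm hU k i j hx) (fun h i j => Christoffel g h i j x)
    (fun h i j => by simp [Christoffel]) k i j

theorem IsMetric.pd_ginv (hg : IsMetric r g U) (hr : r ≠ 0) (hU : IsOpen U) (m i j : Fin n)
    {x : Fin n → ℝ} (hx : x ∈ U) : pd m (ginv g i j) x =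
      -∑ c, Christoffel g i m c x * ginv g c j x - ∑ c, Christoffel g j m c x * ginv g i c x := by
  have h0 : ∀ l, ∑ k, (ginv g i k x * pd m (g k l) x + g k l x * pd m (ginv g i k) x) = 0 := by
    intro l
    have e := pd_congr (i := m) hU (fun y hy => hg.sum_ginv_mul hy i l) hx
    rw [pd_const, pd_sum fun k _ => (hg.differentiableAt_ginv hr hU i k hx).fun_mul
      (hg.differentiableAt hr hU k l hx)] at e
    rw [← e]
    refine Finset.sum_congr rfl fun k _ => ?_
    rw [pd_mul (hg.differentiableAt_ginv hr hU i k hx) (hg.differentiableAt hr hU k l hx)]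
  have h1 : ∀ l, ∑ k, g k l x * pd m (ginv g i k) x =
      -∑ c, (∑ k, ginv g i k x * Christoffel g c m k x) * g c l x - Christoffel g i m l x := by
    intro l
    have h := h0 l
    rw [Finset.sum_add_distrib] at h
    have e : ∑ k, ginv g i k x * pd m (g k l) x =
        ∑ c, (∑ k, ginv g i k x * Christoffel g c m k x) * g c l x + Christoffel g i m l x := by
      simp_rw [hg.pd_eq hU m _ l hx, mul_add, Finset.sum_add_distrib, Finset.mul_sum,
        Finset.sum_mul]
      congr 1
      · rw [Finset.sum_comm]; simp_rw [mul_assoc]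
      · rw [Finset.sum_comm]
        simp_rw [mul_left_comm (ginv g i _ x), ← Finset.mul_sum, hg.sum_ginv_mul hx]
        simp
    linarith
  have h2 : pd m (ginv g i j) x = ∑ l, (∑ k, g k l x * pd m (ginv g i k) x) * ginv g l j x := by
    simp_rw [Finset.sum_mul]
    rw [Finset.sum_comm]
    simp_rw [mul_right_comm, ← Finset.sum_mul, hg.sum_mul_ginv hx]
    simp
  rw [h2]
  simp_rw [h1, sub_mul, neg_mul, Finset.sum_sub_distrib, Finset.sum_neg_distrib]
  have h3 : ∑ l, (∑ c, (∑ k, ginv g i k x * Christoffel g c m k x) * g c l x) * ginv g l j x =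
      ∑ c, Christoffel g j m c x * ginv g i c x := by
    simp_rw [Finset.sum_mul _ _ (ginv g _ j x)]
    rw [Finset.sum_comm]
    simp_rw [mul_assoc, ← Finset.mul_sum, hg.sum_mul_ginv hx]
    simp [mul_comm]
  rw [h3]; ring

theorem pd_det (m : Fin n) {x : Fin n → ℝ} (h : ∀ i j, DifferentiableAt ℝ (g i j) x) :
    pd m (fun y => (matAt g y).det) x =
      ∑ i, ∑ j, (matAt g x).adjugate j i * pd m (g i j) x := by
  let D : ContinuousMultilinearMap ℝ (fun _ : Fin n => Fin n → ℝ) ℝ :=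
    ⟨(Matrix.detRowAlternating (n := Fin n) (R := ℝ)).toMultilinearMap,
      Continuous.matrix_det continuous_id⟩
  have hm : HasFDerivAt (fun y i j => g i j y)
      (ContinuousLinearMap.pi fun i => ContinuousLinearMap.pi fun j => fderiv ℝ (g i j) x) x :=
    hasFDerivAt_pi.2 fun i => hasFDerivAt_pi.2 fun j => (h i j).hasFDerivAt
  have hd := (D.hasFDerivAt (fun i j => g i j x)).comp x hm
  have e : (fun y => (matAt g y).det) = D ∘ fun y i j => g i j y := rfl
  rw [pd, e, hd.fderiv, ContinuousLinearMap.comp_apply,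
    ContinuousMultilinearMap.linearDeriv_apply]
  refine Finset.sum_congr rfl fun i _ => ?_
  have e2 := Matrix.cramer_transpose_apply (matAt g x) (fun j => pd m (g i j) x) i
  rw [Matrix.cramer_eq_adjugate_mulVec, ← Matrix.adjugate_transpose] at e2
  exact e2.symm

theorem IsMetric.pd_log_det (hg : IsMetric r g U) (hr : r ≠ 0) (hU : IsOpen U) (m : Fin n)
    {x : Fin n → ℝ} (hx : x ∈ U) :
    DifferentiableAt ℝ (fun y => Real.log (matAt g y).det) x ∧
      pd m (fun y => Real.log (matAt g y).det) x = 2 * ∑ c, Christoffel g c m c x := by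
  have hd : DifferentiableAt ℝ (fun y => (matAt g y).det) x :=
    ((contDiffOn_det (F := matAt g) hg.contDiff).differentiableOn hr).differentiableAt
      (hU.mem_nhds hx)
  have h0 := hg.det_ne_zero hx
  refine ⟨hd.log h0, ?_⟩
  have e1 : pd m (fun y => Real.log (matAt g y).det) x =
      ((matAt g x).det)⁻¹ * pd m (fun y => (matAt g y).det) x := by
    rw [pd, fderiv.log hd h0]; rfl
  have e2 : ∀ i j, ((matAt g x).det)⁻¹ * (matAt g x).adjugate j i = ginv g j i x := fun i j => by
    rw [ginv, Matrix.inv_def, Ring.inverse_eq_inv']; rfl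
  rw [e1, pd_det m fun i j => hg.differentiableAt hr hU i j hx]
  simp_rw [Finset.mul_sum, ← mul_assoc, e2, hg.pd_eq hU m _ _ hx, mul_add, Finset.sum_add_distrib,
    Finset.mul_sum]
  have e3 : ∑ i, ∑ j, ∑ c, ginv g j i x * (Christoffel g c m i x * g c j x) =
      ∑ c, Christoffel g c m c x := by
    have : ∀ i, ∑ j, ∑ c, ginv g j i x * (Christoffel g c m i x * g c j x) =
        Christoffel g i m i x := by
      intro i
      rw [Finset.sum_comm]
      simp_rw [mul_left_comm (ginv g _ i x), ← Finset.mul_sum, mul_comm (ginv g _ i x),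
        hg.sum_mul_ginv hx]
      simp
    exact Finset.sum_congr rfl fun i _ => this i
  have e4 : ∑ i, ∑ j, ∑ c, ginv g j i x * (Christoffel g c m j x * g i c x) =
      ∑ c, Christoffel g c m c x := by
    rw [Finset.sum_comm]
    have : ∀ j, ∑ i, ∑ c, ginv g j i x * (Christoffel g c m j x * g i c x) =
        Christoffel g j m j x := by
      intro j
      rw [Finset.sum_comm]
      simp_rw [mul_left_comm (ginv g j _ x), ← Finset.mul_sum, hg.sum_ginv_mul hx]
      simp
    exact Finset.sum_congr rfl fun i _ => this i
  rw [e3, e4, ← Finset.mul_sum, two_mul]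

end MetricDerivatives

section GeodesicMapping

variable {n : ℕ} {g gbar : Fin n → Fin n → (Fin n → ℝ) → ℝ} {ψ : Fin n → (Fin n → ℝ) → ℝ}
  {U : Set (Fin n → ℝ)}

theorem GeodesicallyRelated.sum_christoffel (hgeo : GeodesicallyRelated g gbar ψ U) (m : Fin n)
    {x : Fin n → ℝ} (hx : x ∈ U) :
    ∑ c, Christoffel gbar c m c x = ∑ c, Christoffel g c m c x + (n + 1) * ψ m x := by
  simp_rw [hgeo _ _ _ x hx, Finset.sum_add_distrib]
  simp; ring

/-- The weight `|det ḡ / det g| ^ (1 / (n + 1))`. -/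
def geodesicWeight (g gbar : Fin n → Fin n → (Fin n → ℝ) → ℝ) (x : Fin n → ℝ) : ℝ :=
  Real.exp (((n : ℝ) + 1)⁻¹ * (Real.log (matAt gbar x).det - Real.log (matAt g x).det))

theorem contDiffOn_geodesicWeight {r : WithTop ℕ∞} (hg : IsMetric r g U)
    (hgbar : IsMetric r gbar U) : ContDiffOn ℝ r (geodesicWeight g gbar) U :=
  (contDiffOn_const.mul
    (((contDiffOn_det (F := matAt gbar) hgbar.contDiff).log fun _ hx => hgbar.det_ne_zero hx).sub
      ((contDiffOn_det (F := matAt g) hg.contDiff).log fun _ hx => hg.det_ne_zero hx))).exp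

theorem GeodesicallyRelated.pd_geodesicWeight (hgeo : GeodesicallyRelated g gbar ψ U)
    (hU : IsOpen U) (hg : IsMetric 1 g U) (hgbar : IsMetric 1 gbar U) (m : Fin n)
    {x : Fin n → ℝ} (hx : x ∈ U) :
    pd m (geodesicWeight g gbar) x = 2 * geodesicWeight g gbar x * ψ m x := by
  obtain ⟨d1, p1⟩ := hg.pd_log_det one_ne_zero hU m hx
  obtain ⟨d2, p2⟩ := hgbar.pd_log_det one_ne_zero hU m hx
  have e1 : pd m (geodesicWeight g gbar) x = geodesicWeight g gbar x * pd m (fun y =>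
      ((n : ℝ) + 1)⁻¹ * (Real.log (matAt gbar y).det - Real.log (matAt g y).det)) x := by
    unfold geodesicWeight
    rw [pd, fderiv_exp ((d2.fun_sub d1).const_mul _)]; rfl
  rw [e1, pd_const_mul (d2.fun_sub d1), pd_sub d2 d1, p1, p2, hgeo.sum_christoffel m hx]
  have : (n : ℝ) + 1 ≠ 0 := by positivity
  field_simp
  ring

/-- The weighted inverse metric `a^{hl} = w ḡ^{hl}` attached to a geodesic mapping. -/
def geodesicTensor (g gbar : Fin n → Fin n → (Fin n → ℝ) → ℝ) (h l : Fin n) (x : Fin n → ℝ) : ℝ :=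
  geodesicWeight g gbar x * ginv gbar h l x

/-- The vector field `v^h = - a^{hc} ψ_c` attached to a geodesic mapping. -/
def geodesicVector (g gbar : Fin n → Fin n → (Fin n → ℝ) → ℝ) (ψ : Fin n → (Fin n → ℝ) → ℝ)
    (h : Fin n) (x : Fin n → ℝ) : ℝ :=
  -∑ c, geodesicTensor g gbar h c x * ψ c x

theorem GeodesicallyRelated.isSinyukov (hgeo : GeodesicallyRelated g gbar ψ U)
    (hU : IsOpen U) (hg : IsMetric 1 g U) (hgbar : IsMetric 1 gbar U)
    (hψ : ∀ i, ContinuousOn (ψ i) U) :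
    IsSinyukov g U (geodesicTensor g gbar) (geodesicVector g gbar ψ) where
  symm h l x hx := by simp only [geodesicTensor, hgbar.ginv_symm hx h l]
  contDiffOn h l := (contDiffOn_geodesicWeight hg hgbar).mul (hgbar.contDiffOn_ginv h l)
  continuousOn h := (continuousOn_finsetSum _ fun c _ =>
    (((contDiffOn_geodesicWeight hg hgbar).mul (hgbar.contDiffOn_ginv h c)).continuousOn).mul
      (hψ c)).neg
  pd_eq m h l x hx := by
    have dw : DifferentiableAt ℝ (geodesicWeight g gbar) x :=
      ((contDiffOn_geodesicWeight hg hgbar).differentiableOn one_ne_zero).differentiableAt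
        (hU.mem_nhds hx)
    have e : ∀ h l, ∑ c, Christoffel gbar h m c x * ginv gbar c l x =
        ∑ c, Christoffel g h m c x * ginv gbar c l x + ψ m x * ginv gbar h l x
          + (if h = m then 1 else 0) * ∑ c, ginv gbar l c x * ψ c x := by
      intro h l
      simp_rw [hgeo _ _ _ x hx, add_mul, Finset.sum_add_distrib, hgbar.ginv_symm hx l,
        Finset.mul_sum]
      congr 1
      · simp
      · exact Finset.sum_congr rfl fun c _ => by ring
    have e' : ∀ h l, ∑ c, Christoffel gbar l m c x * ginv gbar h c x =
        ∑ c, Christoffel g l m c x * ginv gbar h c x + ψ m x * ginv gbar h l x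
          + (if l = m then 1 else 0) * ∑ c, ginv gbar h c x * ψ c x := by
      intro h l
      simp_rw [hgbar.ginv_symm hx h]
      rw [e l h]
      simp_rw [hgbar.ginv_symm hx h]
    unfold geodesicTensor geodesicVector
    rw [pd_mul dw (hgbar.differentiableAt_ginv one_ne_zero hU h l hx),
      hgeo.pd_geodesicWeight hU hg hgbar m hx, hgbar.pd_ginv one_ne_zero hU m h l hx, e h l, e' h l]
    simp only [geodesicTensor, mul_left_comm _ (geodesicWeight g gbar x),
      mul_assoc (geodesicWeight g gbar x), ← Finset.mul_sum]
    ring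

end GeodesicMapping

section LinearSystem

variable {n : ℕ}

theorem eq_zero_of_linear_pd {ι : Type*} [Fintype ι] {V : Set (Fin n → ℝ)} (hV : Convex ℝ V)
    {F : ι → (Fin n → ℝ) → ℝ} {B : ι → ι → Fin n → (Fin n → ℝ) → ℝ}
    (hB : ∀ p q m, ContinuousOn (B p q m) V)
    (hF : ∀ x ∈ V, ∀ p, HasFDerivAt (F p) (covec fun m => ∑ q, B p q m x * F q x) x)
    {x y : Fin n → ℝ} (hx : x ∈ V) (hy : y ∈ V) (h0 : ∀ p, F p x = 0) (p : ι) : F p y = 0 := by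
  let γ : ℝ → Fin n → ℝ := fun t => x + t • (y - x)
  have hγ : ∀ t ∈ Icc (0 : ℝ) 1, γ t ∈ V := fun t ht => by
    have := hV hx hy (sub_nonneg.2 ht.2) ht.1 (by ring)
    convert this using 1
    simp only [γ]; module
  have hγc : Continuous γ := by fun_prop
  have hγd : ∀ t, HasDerivAt γ (y - x) t := fun t => by
    have := ((hasDerivAt_id t).smul_const (y - x)).const_add x
    rwa [one_smul] at this
  obtain ⟨M, hM⟩ := isCompact_Icc.exists_bound_of_continuousOn
    (f := fun t (p q : ι) m => B p q m (γ t) * (y - x) m) (s := Icc (0 : ℝ) 1)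
    (continuousOn_pi.2 fun p => continuousOn_pi.2 fun q => continuousOn_pi.2 fun m =>
      ((hB p q m).comp hγc.continuousOn hγ).mul continuousOn_const)
  have hd : ∀ t ∈ Icc (0 : ℝ) 1, HasDerivAt (fun t p => F p (γ t))
      (fun p => ∑ m, (∑ q, B p q m (γ t) * F q (γ t)) * (y - x) m) t := by
    intro t ht
    refine hasDerivAt_pi.2 fun p => ?_
    convert (hF (γ t) (hγ t ht) p).comp_hasDerivAt t (hγd t) using 1
    · rfl
    · simp [covec]
  have key := eq_zero_of_abs_deriv_le_mul_abs_self_of_eq_zero_right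
    (f := fun t p => F p (γ t)) (K := n * (Fintype.card ι * M)) (a := 0) (b := 1)
    (fun t ht => (hd t ht).continuousAt.continuousWithinAt)
    (fun t ht => (hd t (Ico_subset_Icc_self ht)).hasDerivWithinAt)
    (by funext p; simpa [γ] using h0 p) (fun t ht => by
      have hMt := hM t (Ico_subset_Icc_self ht)
      have hM0 : 0 ≤ M := (norm_nonneg _).trans hMt
      refine (pi_norm_le_iff_of_nonneg (by positivity)).2 fun p => ?_
      have hb : ∀ q m, ‖B p q m (γ t) * F q (γ t) * (y - x) m‖ ≤ M * ‖fun p => F p (γ t)‖ := by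
        intro q m
        rw [mul_right_comm, norm_mul]
        have h1 := norm_le_pi_norm (fun (p q : ι) m => B p q m (γ t) * (y - x) m) p
        have h2 := norm_le_pi_norm (fun (q : ι) m => B p q m (γ t) * (y - x) m) q
        have h3 := norm_le_pi_norm (fun m => B p q m (γ t) * (y - x) m) m
        exact mul_le_mul (h3.trans (h2.trans (h1.trans hMt)))
          (norm_le_pi_norm (fun p => F p (γ t)) q) (norm_nonneg _) hM0
      calc ‖∑ m, (∑ q, B p q m (γ t) * F q (γ t)) * (y - x) m‖
          ≤ ∑ m : Fin n, ∑ q : ι, M * ‖fun p => F p (γ t)‖ := by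
            refine norm_sum_le_of_le _ fun m _ => ?_
            rw [Finset.sum_mul]
            exact norm_sum_le_of_le _ fun q _ => hb q m
        _ = _ := by simp; ring) 1 (by simp)
  have := congrFun key p
  simpa [γ] using this

theorem eq_zero_of_parallel {V : Set (Fin n → ℝ)} (hV : Convex ℝ V)
    {T : Fin n → Fin n → (Fin n → ℝ) → ℝ} {Γ : Fin n → Fin n → Fin n → (Fin n → ℝ) → ℝ}
    (hΓ : ∀ h i j, ContinuousOn (Γ h i j) V)
    (hT : ∀ x ∈ V, ∀ k i, HasFDerivAt (T k i)
      (covec fun m => ∑ c, Γ c m k x * T c i x + ∑ c, Γ c m i x * T k c x) x)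
    {x y : Fin n → ℝ} (hx : x ∈ V) (hy : y ∈ V) (h0 : ∀ k i, T k i x = 0) (k i : Fin n) :
    T k i y = 0 := by
  refine eq_zero_of_linear_pd (ι := Fin n × Fin n) hV (F := fun p => T p.1 p.2)
    (B := fun p q m z => Γ q.1 m p.1 z * (if q.2 = p.2 then 1 else 0)
      + Γ q.2 m p.2 z * (if q.1 = p.1 then 1 else 0))
    (fun p q m => ((hΓ _ _ _).mul continuousOn_const).add ((hΓ _ _ _).mul continuousOn_const))
    (fun z hz p => ?_) hx hy (fun p => h0 _ _) (k, i)
  convert hT z hz p.1 p.2 using 2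
  funext m
  simp [Fintype.sum_prod_type, add_mul, Finset.sum_add_distrib]

end LinearSystem

section GlobalSolution

variable {n : ℕ} {U : Set (Fin n → ℝ)} {g a : Fin n → Fin n → (Fin n → ℝ) → ℝ}
  {v : Fin n → (Fin n → ℝ) → ℝ} {K : ℝ}

theorem exists_lower_ne_zero {r : WithTop ℕ∞} (hg : IsMetric r g U) {x : Fin n → ℝ} (hx : x ∈ U)
    {u : Fin n → ℝ} {h : Fin n} (hu : u h ≠ 0) : ∃ j, ∑ c, g j c x * u c ≠ 0 := by
  by_contra! H
  apply hu
  have : u h = ∑ j, ginv g h j x * ∑ c, g j c x * u c := by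
    simp_rw [Finset.mul_sum]
    rw [Finset.sum_comm]
    simp_rw [← mul_assoc, ← Finset.sum_mul, hg.sum_ginv_mul hx]
    simp
  rw [this]; simp [H]

theorem eq_zero_of_symm_mul_eq_zero {l : Fin n → ℝ} {T : Fin n → Fin n → ℝ} {j : Fin n}
    (hl : l j ≠ 0) (h : ∀ i j k, l j * T k i + l i * T k j = 0) (k i : Fin n) : T k i = 0 := by
  have h1 : T k j = 0 := by
    have := h j j k
    rw [← two_mul] at this
    simpa [hl] using this
  have := h i j k
  rw [h1] at this
  simpa [hl] using this

/-- On a connected domain, a solution of the linear equations with nonvanishing vector part has a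
vector part satisfying a closed first-order system. -/
theorem exists_prolongation (hn : 2 ≤ n) (hU : IsOpen U) (hUc : IsPreconnected U)
    (hg : IsMetric 2 g U) (hE : ∀ i j, ∀ x ∈ U, Ricci g i j x = ((n - 1) * K) * g i j x)
    (hav : IsSinyukov g U a v) {p : Fin n → ℝ} (hp : p ∈ U) {h₀ : Fin n} (hv : v h₀ p ≠ 0) :
    ∃ C : ℝ, ∀ x ∈ U, ∀ h, HasFDerivAt (v h)
      (covec fun k => vDeriv g a v K (fun y => C - K * trUp g a y) (fun _ _ _ => 0) h k x) x := by
  let D : Fin n → Fin n → (Fin n → ℝ) → ℝ := fun h k x => pd k (v h) x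
    + (∑ c, Christoffel g h k c x * v c x) + K * (∑ c, a h c x * g c k x)
  let s : (Fin n → ℝ) → ℝ := fun x => (n : ℝ)⁻¹ * ∑ h, D h h x
  have hn0 : (n : ℝ) ≠ 0 := by positivity
  have hloc : ∀ q ∈ U, ∃ r > 0, ball q r ⊆ U ∧ ∃ (C : ℝ) (T : Fin n → Fin n → (Fin n → ℝ) → ℝ),
      (∀ x ∈ ball q r, s x + K * trUp g a x = C) ∧
      (∀ x ∈ ball q r, (∀ k i, T k i x = 0) ↔ ∀ h k, D h k x = s x * (if h = k then 1 else 0)) ∧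
      (∀ x ∈ ball q r, ∀ h, HasFDerivAt (v h)
        (covec fun k => vDeriv g a v K (fun y => C - K * trUp g a y) T h k x) x) ∧
      (∀ x ∈ ball q r, ∀ y ∈ ball q r, (∀ k i, T k i x = 0) → ∀ k i, T k i y = 0) ∧
      (∀ x ∈ ball q r, ∀ h, v h x ≠ 0 → ∀ k i, T k i x = 0) := by
    intro q hq
    obtain ⟨r, hr, hrU, C, T, hT⟩ := exists_local_prolongation hn hU hg hE hav hq
    have hD : ∀ x ∈ ball q r, ∀ h k, D h k x = (C - K * trUp g a x) * (if h = k then 1 else 0)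
        + ∑ c, ginv g h c x * T k c x := by
      intro x hx h k
      simp only [D]
      rw [pd_eq_of_hasFDerivAt ((hT x hx).1 h) k]
      simp only [vDeriv]; ring
    have hs : ∀ x ∈ ball q r, s x = C - K * trUp g a x := by
      intro x hx
      have : ∑ h, ∑ c, ginv g h c x * T h c x = 0 := (hT x hx).2.1
      simp only [s, hD x hx, Finset.sum_add_distrib, this]
      simp; field_simp
    refine ⟨r, hr, hrU, C, T, fun x hx => by rw [hs x hx]; ring, fun x hx => ⟨fun h0 h k => ?_,
      fun h0 k i => ?_⟩, fun x hx => (hT x hx).1, fun x hx y hy => ?_, fun x hx h hvx => ?_⟩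
    · rw [hD x hx, hs x hx]; simp [h0]
    · have h1 : ∀ h k, ∑ c, ginv g h c x * T k c x = 0 := fun h k => by
        have := h0 h k
        rw [hD x hx, hs x hx] at this
        linarith
      have : T k i x = ∑ h, g i h x * ∑ c, ginv g h c x * T k c x := by
        simp_rw [Finset.mul_sum]
        rw [Finset.sum_comm]
        simp_rw [← mul_assoc, ← Finset.sum_mul, hg.sum_mul_ginv (hrU hx)]
        simp
      rw [this]; simp [h1]
    · exact eq_zero_of_parallel (convex_ball q r)
        (fun h i j => ((hg.contDiffOn_christoffel (r := 1) hU h i j).mono hrU).continuousOn)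
        (fun x hx => (hT x hx).2.2.1) hx hy
    · obtain ⟨j, hj⟩ := exists_lower_ne_zero hg (hrU hx) (u := fun c => v c x) hvx
      exact eq_zero_of_symm_mul_eq_zero (l := fun j => ∑ c, g j c x * v c x) hj (hT x hx).2.2.2
  have hC : ∀ x ∈ U, s x + K * trUp g a x = s p + K * trUp g a p := fun x hx =>
    hUc.induction₂ (fun x y => s x + K * trUp g a x = s y + K * trUp g a y)
      (fun q hq => by
        obtain ⟨r, hr, -, C, T, h1, -⟩ := hloc q hq
        filter_upwards [mem_nhdsWithin_of_mem_nhds (ball_mem_nhds q hr)] with y hy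
        rw [h1 q (mem_ball_self hr), h1 y hy])
      (fun x y z _ _ _ h1 h2 => h1.trans h2) (fun x y _ _ h => h.symm) hx hp
  have hD0 : ∀ x ∈ U, ∀ h k, D h k x = s x * (if h = k then 1 else 0) := fun x hx =>
    (hUc.induction₂ (fun x y => (∀ h k, D h k x = s x * (if h = k then 1 else 0)) ↔
        ∀ h k, D h k y = s y * (if h = k then 1 else 0))
      (fun q hq => by
        obtain ⟨r, hr, -, C, T, -, h2, -, h4, -⟩ := hloc q hq
        filter_upwards [mem_nhdsWithin_of_mem_nhds (ball_mem_nhds q hr)] with y hy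
        rw [← h2 q (mem_ball_self hr), ← h2 y hy]
        exact ⟨h4 q (mem_ball_self hr) y hy, h4 y hy q (mem_ball_self hr)⟩)
      (fun x y z _ _ _ h1 h2 => h1.trans h2) (fun x y _ _ h => h.symm) hx hp).2 (by
        obtain ⟨r, hr, -, C, T, -, h2, -, -, h5⟩ := hloc p hp
        exact (h2 p (mem_ball_self hr)).1 (h5 p (mem_ball_self hr) h₀ hv))
  refine ⟨s p + K * trUp g a p, fun x hx h => ?_⟩
  obtain ⟨r, hr, -, C, T, h1, h2, h3, -, -⟩ := hloc x hx
  have hx' := mem_ball_self (x := x) hr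
  convert h3 x hx' h using 2
  have hT := (h2 x hx').2 (hD0 x hx)
  funext k
  simp only [vDeriv, hT, ← hC x hx, h1 x hx']

end GlobalSolution

section Regularity

variable {n : ℕ} {g gbar a : Fin n → Fin n → (Fin n → ℝ) → ℝ} {ψ v : Fin n → (Fin n → ℝ) → ℝ}
  {U : Set (Fin n → ℝ)} {K C : ℝ}

theorem geodesicWeight_mul_swap (x : Fin n → ℝ) :
    geodesicWeight g gbar x * geodesicWeight gbar g x = 1 := by
  rw [geodesicWeight, geodesicWeight, ← Real.exp_add, Real.exp_eq_one_iff]; ring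

theorem GeodesicallyRelated.swap (hgeo : GeodesicallyRelated g gbar ψ U) :
    GeodesicallyRelated gbar g (fun i x => -ψ i x) U := fun h i j x hx => by
  rw [hgeo h i j x hx]; ring

/-- The weighted metric `w⁻¹ ḡ_{ij}`, inverse to `geodesicTensor`. -/
def geodesicCotensor (g gbar : Fin n → Fin n → (Fin n → ℝ) → ℝ) (i j : Fin n) (x : Fin n → ℝ) : ℝ :=
  geodesicWeight gbar g x * gbar i j x

theorem geodesicCotensor_symm {r : WithTop ℕ∞} (hgbar : IsMetric r gbar U) (i j : Fin n)
    {x : Fin n → ℝ} (hx : x ∈ U) : geodesicCotensor g gbar i j x = geodesicCotensor g gbar j i x := by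
  rw [geodesicCotensor, hgbar.symm i j x hx, geodesicCotensor]

theorem sum_geodesicCotensor_mul {r : WithTop ℕ∞} (hgbar : IsMetric r gbar U) (i j : Fin n)
    {x : Fin n → ℝ} (hx : x ∈ U) :
    ∑ k, geodesicCotensor g gbar i k x * geodesicTensor g gbar k j x = if i = j then 1 else 0 := by
  rw [← hgbar.sum_mul_ginv hx i j]
  refine Finset.sum_congr rfl fun k _ => ?_
  rw [geodesicCotensor, geodesicTensor]
  linear_combination (gbar i k x * ginv gbar k j x) * geodesicWeight_mul_swap (g := g) (gbar := gbar) x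

theorem form_eq_geodesicVector {r : WithTop ℕ∞} (hgbar : IsMetric r gbar U) (i : Fin n)
    {x : Fin n → ℝ} (hx : x ∈ U) :
    ψ i x = -∑ h, geodesicCotensor g gbar i h x * geodesicVector g gbar ψ h x := by
  simp_rw [geodesicVector, mul_neg, Finset.sum_neg_distrib, neg_neg, Finset.mul_sum]
  rw [Finset.sum_comm]
  simp_rw [← mul_assoc, ← Finset.sum_mul, sum_geodesicCotensor_mul hgbar _ _ hx]
  simp

theorem contDiffOn_geodesicCotensor {r : WithTop ℕ∞} (hg : IsMetric r g U)
    (hgbar : IsMetric r gbar U) (i j : Fin n) : ContDiffOn ℝ r (geodesicCotensor g gbar i j) U :=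
  (contDiffOn_geodesicWeight hgbar hg).mul (hgbar.contDiff i j)

theorem contDiffOn_trUp {r : WithTop ℕ∞} (hg : ∀ i j, ContDiffOn ℝ r (g i j) U)
    (ha : ∀ i j, ContDiffOn ℝ r (a i j) U) : ContDiffOn ℝ r (trUp g a) U :=
  ContDiffOn.sum fun i _ => ContDiffOn.sum fun j _ => (hg i j).mul (ha i j)

theorem IsSinyukov.contDiffOn_vector (hav : IsSinyukov g U a v) (hU : IsOpen U)
    (hg : IsMetric 2 g U) (hv : ∀ x ∈ U, ∀ h, HasFDerivAt (v h)
      (covec fun k => vDeriv g a v K (fun y => C - K * trUp g a y) (fun _ _ _ => 0) h k x) x)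
    (h : Fin n) : ContDiffOn ℝ 1 (v h) U := by
  refine contDiffOn_succ_of_pd (r := 0) hU
    (fun x hx => (hv x hx h).differentiableAt.differentiableWithinAt) fun k => ?_
  have hcg := fun i j => (hg.contDiff i j).continuousOn
  have hca := fun i j => (hav.contDiffOn i j).continuousOn
  have htr : ContinuousOn (trUp g a) U :=
    continuousOn_finsetSum _ fun i _ => continuousOn_finsetSum _ fun j _ => (hcg i j).mul (hca i j)
  have hc : ContinuousOn (fun x =>
      vDeriv g a v K (fun y => C - K * trUp g a y) (fun _ _ _ => 0) h k x) U := by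
    simp only [vDeriv, mul_zero, Finset.sum_const_zero, add_zero]
    exact (((continuousOn_finsetSum _ fun c _ =>
      (hg.contDiffOn_christoffel (r := 1) hU h k c).continuousOn.mul (hav.continuousOn c)).neg).add
      ((continuousOn_const.sub (continuousOn_const.mul htr)).mul continuousOn_const)).sub
      (continuousOn_const.mul (continuousOn_finsetSum _ fun c _ => (hca h c).mul (hcg c k)))
  exact (contDiffOn_zero.2 hc).congr fun x hx => pd_eq_of_hasFDerivAt (hv x hx h) k

theorem contDiffOn_form (hg : IsMetric 1 g U) (hgbar : IsMetric 1 gbar U)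
    (hv : ∀ h, ContDiffOn ℝ 1 (geodesicVector g gbar ψ h) U) (i : Fin n) :
    ContDiffOn ℝ 1 (ψ i) U :=
  (ContDiffOn.sum fun h _ => (contDiffOn_geodesicCotensor hg hgbar i h).mul (hv h)).neg.congr
    fun _ hx => form_eq_geodesicVector hgbar i hx

theorem GeodesicallyRelated.isMetric_two (hgeo : GeodesicallyRelated g gbar ψ U) (hU : IsOpen U)
    (hg : IsMetric 2 g U) (hgbar : IsMetric 1 gbar U) (hψ : ∀ i, ContDiffOn ℝ 1 (ψ i) U) :
    IsMetric 2 gbar U where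
  symm := hgbar.symm
  inv := hgbar.inv
  contDiff i j := by
    have hΓ : ∀ h i j, ContDiffOn ℝ 1 (Christoffel gbar h i j) U := fun h i j =>
      (((hg.contDiffOn_christoffel (r := 1) hU h i j).add ((hψ i).mul contDiffOn_const)).add
        ((hψ j).mul contDiffOn_const)).congr fun x hx => hgeo h i j x hx
    refine contDiffOn_succ_of_pd (r := 1) hU
      ((hgbar.contDiff i j).differentiableOn one_ne_zero) fun k => ?_
    have h := ((ContDiffOn.sum fun c (_ : c ∈ Finset.univ) => (hΓ c k i).mul
      (hgbar.contDiff c j)).add (ContDiffOn.sum fun c (_ : c ∈ Finset.univ) =>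
        (hΓ c k j).mul (hgbar.contDiff i c))).congr fun x hx => hgbar.pd_eq hU k i j hx
    exact_mod_cast h

end Regularity

section Curvature

variable {n : ℕ} {g gbar a : Fin n → Fin n → (Fin n → ℝ) → ℝ} {ψ v : Fin n → (Fin n → ℝ) → ℝ}
  {U : Set (Fin n → ℝ)} {K C : ℝ}

theorem GeodesicallyRelated.pd_geodesicCotensor (hgeo : GeodesicallyRelated g gbar ψ U)
    (hU : IsOpen U) (hg : IsMetric 1 g U) (hgbar : IsMetric 1 gbar U) (k i j : Fin n)
    {x : Fin n → ℝ} (hx : x ∈ U) : pd k (geodesicCotensor g gbar i j) x =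
      ∑ c, Christoffel g c k i x * geodesicCotensor g gbar c j x
      + ∑ c, Christoffel g c k j x * geodesicCotensor g gbar i c x
      + ψ i x * geodesicCotensor g gbar k j x + ψ j x * geodesicCotensor g gbar i k x := by
  have dw : DifferentiableAt ℝ (geodesicWeight gbar g) x :=
    ((contDiffOn_geodesicWeight hgbar hg).differentiableOn one_ne_zero).differentiableAt
      (hU.mem_nhds hx)
  have e : ∀ i j, ∑ c, Christoffel gbar c k i x * gbar c j x =
      ∑ c, Christoffel g c k i x * gbar c j x + ψ k x * gbar i j x + ψ i x * gbar k j x := by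
    intro i j
    simp_rw [hgeo _ _ _ x hx, add_mul, Finset.sum_add_distrib]
    simp
  have e' : ∑ c, Christoffel gbar c k j x * gbar i c x =
      ∑ c, Christoffel g c k j x * gbar i c x + ψ k x * gbar i j x + ψ j x * gbar i k x := by
    simp_rw [hgbar.symm i _ x hx]
    exact e j i
  unfold geodesicCotensor
  rw [pd_mul dw (hgbar.differentiableAt one_ne_zero hU i j hx),
    hgeo.swap.pd_geodesicWeight hU hgbar hg k hx, hgbar.pd_eq hU k i j hx, e i j, e']
  simp only [mul_left_comm _ (geodesicWeight gbar g x), ← Finset.mul_sum]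
  ring

/-- The derivative of the form of a geodesic mapping in terms of the prolonged system. -/
theorem GeodesicallyRelated.pd_form (hgeo : GeodesicallyRelated g gbar ψ U)
    (hU : IsOpen U) (hg : IsMetric 1 g U) (hgbar : IsMetric 1 gbar U) {s : (Fin n → ℝ) → ℝ}
    {x : Fin n → ℝ} (hx : x ∈ U) (hv : ∀ h, HasFDerivAt (geodesicVector g gbar ψ h)
      (covec fun k => vDeriv g (geodesicTensor g gbar) (geodesicVector g gbar ψ) K s
        (fun _ _ _ => 0) h k x) x) (k i : Fin n) :
    pd k (ψ i) x = ∑ c, Christoffel g c k i x * ψ c x + ψ i x * ψ k x + K * g i k x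
      - (s x + ∑ h, ψ h x * geodesicVector g gbar ψ h x) * geodesicCotensor g gbar i k x := by
  have db : ∀ h, DifferentiableAt ℝ (geodesicCotensor g gbar i h) x := fun h =>
    ((contDiffOn_geodesicCotensor hg hgbar i h).differentiableOn one_ne_zero).differentiableAt
      (hU.mem_nhds hx)
  have dv := fun h => (hv h).differentiableAt
  have e0 : pd k (ψ i) x = -∑ h, (geodesicCotensor g gbar i h x * pd k (geodesicVector g gbar ψ h) x
      + geodesicVector g gbar ψ h x * pd k (geodesicCotensor g gbar i h) x) := by
    rw [pd_congr hU (fun y hy => form_eq_geodesicVector hgbar i hy) hx, pd_neg,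
      pd_sum fun h _ => (db h).fun_mul (dv h)]
    simp_rw [pd_mul (db _) (dv _)]
  have f := fun j => form_eq_geodesicVector (g := g) (ψ := ψ) hgbar j hx
  have S := fun i j => sum_geodesicCotensor_mul (g := g) hgbar i j hx
  rw [e0]
  simp_rw [pd_eq_of_hasFDerivAt (hv _) k, hgeo.pd_geodesicCotensor hU hg hgbar k i _ hx, vDeriv]
  set b := fun i j => geodesicCotensor g gbar i j x
  set u := fun h => geodesicVector g gbar ψ h x
  set α := fun h c => geodesicTensor g gbar h c x
  set Γ := fun h i j => Christoffel g h i j x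
  change ∀ j, ψ j x = -∑ h, b j h * u h at f
  change ∀ i j, ∑ c, b i c * α c j = if i = j then 1 else 0 at S
  change -∑ h, (b i h * (-(∑ c, Γ h k c * u c) + s x * (if h = k then 1 else 0)
      - K * (∑ c, α h c * g c k x) + ∑ c, ginv g h c x * 0)
      + u h * (∑ c, Γ c k i * b c h + ∑ c, Γ c k h * b i c + ψ i x * b k h + ψ h x * b i k))
    = ∑ c, Γ c k i * ψ c x + ψ i x * ψ k x + K * g i k x - (s x + ∑ h, ψ h x * u h) * b i k
  have t1 : ∑ h, b i h * ∑ c, Γ h k c * u c = ∑ h, u h * ∑ c, Γ c k h * b i c := by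
    simp_rw [Finset.mul_sum]
    rw [Finset.sum_comm]
    exact Finset.sum_congr rfl fun c _ => Finset.sum_congr rfl fun h _ => by ring
  have t2 : ∑ h, b i h * ∑ c, α h c * g c k x = g i k x := by
    simp_rw [Finset.mul_sum]
    rw [Finset.sum_comm]
    simp_rw [← mul_assoc, ← Finset.sum_mul, S]
    simp
  have t3 : ∑ h, u h * ∑ c, Γ c k i * b c h = -∑ c, Γ c k i * ψ c x := by
    simp_rw [f, mul_neg, Finset.sum_neg_distrib, neg_neg, Finset.mul_sum]
    rw [Finset.sum_comm]
    exact Finset.sum_congr rfl fun c _ => Finset.sum_congr rfl fun h _ => by ring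
  have t4 : ∑ h, u h * (ψ i x * b k h) = -(ψ i x * ψ k x) := by
    rw [f k, mul_neg, neg_neg, Finset.mul_sum]
    exact Finset.sum_congr rfl fun h _ => by ring
  have t5 : ∑ h, u h * (ψ h x * b i k) = (∑ h, ψ h x * u h) * b i k := by
    rw [Finset.sum_mul]
    exact Finset.sum_congr rfl fun h _ => by ring
  have t6 : ∑ h, b i h * (s x * (if h = k then 1 else 0)) = s x * b i k := by
    simp [mul_comm]
  have t7 : ∑ h, b i h * (K * (∑ c, α h c * g c k x)) = K * g i k x := by
    simp_rw [mul_left_comm _ K, ← Finset.mul_sum, t2]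
  simp only [mul_zero, Finset.sum_const_zero, add_zero, mul_add, mul_sub, mul_neg,
    Finset.sum_add_distrib, Finset.sum_sub_distrib, Finset.sum_neg_distrib, t1, t3, t4, t5, t6, t7]
  ring

theorem sum_projective_change_trace {Γ : Fin n → Fin n → Fin n → ℝ}
    (hΓ : ∀ h i j, Γ h i j = Γ h j i) (p : Fin n → ℝ) (i j : Fin n) :
    ∑ b, (∑ c, Γ c b c + (n + 1) * p b) *
        (Γ b i j + p i * (if b = j then 1 else 0) + p j * (if b = i then 1 else 0)) =
      ∑ c, ∑ b, Γ c c b * Γ b i j + p i * ∑ c, Γ c j c + p j * ∑ c, Γ c i c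
        + (n + 1) * ∑ c, Γ c i j * p c + 2 * (n + 1) * (p i * p j) := by
  have h1 : ∑ c, ∑ b, Γ c c b * Γ b i j = ∑ b, (∑ c, Γ c b c) * Γ b i j := by
    rw [Finset.sum_comm]
    simp_rw [Finset.sum_mul]
    exact Finset.sum_congr rfl fun b _ => Finset.sum_congr rfl fun c _ => by rw [hΓ c c b]
  have h2 : ∑ b, (n + 1) * p b * Γ b i j = (n + 1) * ∑ c, Γ c i j * p c := by
    rw [Finset.mul_sum]
    exact Finset.sum_congr rfl fun b _ => by ring
  rw [h1, ← h2]
  simp only [mul_add, add_mul, Finset.sum_add_distrib, mul_ite, mul_one, mul_zero,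
    Finset.sum_ite_eq', Finset.mem_univ, if_true]
  ring

theorem sum_projective_change_mul {Γ : Fin n → Fin n → Fin n → ℝ}
    (hΓ : ∀ h i j, Γ h i j = Γ h j i) (p : Fin n → ℝ) (i j : Fin n) :
    ∑ c, ∑ b, (Γ c j b + p j * (if c = b then 1 else 0) + p b * (if c = j then 1 else 0)) *
        (Γ b i c + p i * (if b = c then 1 else 0) + p c * (if b = i then 1 else 0)) =
      ∑ c, ∑ b, Γ c j b * Γ b i c + p i * ∑ c, Γ c j c + p j * ∑ c, Γ c i c
        + 2 * ∑ c, Γ c i j * p c + (n + 3) * (p i * p j) := by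
  simp only [mul_add, add_mul, Finset.sum_add_distrib, mul_ite, ite_mul, mul_one, mul_zero,
    zero_mul, Finset.sum_ite_eq', Finset.sum_ite_eq, Finset.mem_univ, if_true,
    Finset.sum_ite_irrel, Finset.sum_const_zero]
  simp only [hΓ _ j i, ← Finset.mul_sum, ← Finset.sum_mul, mul_comm (p _) (Γ _ _ _),
    Finset.sum_const, Finset.card_univ, Fintype.card_fin, nsmul_eq_mul]
  ring

/-- The transformation law of the Ricci tensor under a geodesic mapping with closed form. -/
theorem GeodesicallyRelated.ricci_eq (hgeo : GeodesicallyRelated g gbar ψ U) (hU : IsOpen U)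
    (hg : IsMetric 2 g U) (hψ : ∀ i, ContDiffOn ℝ 1 (ψ i) U) (i j : Fin n)
    {x : Fin n → ℝ} (hx : x ∈ U) (hcl : pd i (ψ j) x = pd j (ψ i) x) :
    Ricci gbar i j x = Ricci g i j x
      - (n - 1) * (pd j (ψ i) x - ∑ c, Christoffel g c i j x * ψ c x - ψ i x * ψ j x) := by
  have dΓ : ∀ h i j, DifferentiableAt ℝ (Christoffel g h i j) x := fun h i j =>
    ((hg.contDiffOn_christoffel (r := 1) hU h i j).differentiableOn one_ne_zero).differentiableAt
      (hU.mem_nhds hx)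
  have dψ : ∀ i, DifferentiableAt ℝ (ψ i) x := fun i =>
    ((hψ i).differentiableOn one_ne_zero).differentiableAt (hU.mem_nhds hx)
  have e1 : ∑ c, pd c (Christoffel gbar c i j) x =
      ∑ c, pd c (Christoffel g c i j) x + pd j (ψ i) x + pd i (ψ j) x := by
    have : ∀ c, pd c (Christoffel gbar c i j) x = pd c (Christoffel g c i j) x
        + pd c (ψ i) x * (if c = j then 1 else 0) + pd c (ψ j) x * (if c = i then 1 else 0) := by
      intro c
      rw [pd_congr hU (fun y hy => hgeo c i j y hy) hx,
        pd_add ((dΓ c i j).fun_add ((dψ i).mul_const _)) ((dψ j).mul_const _),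
        pd_add (dΓ c i j) ((dψ i).mul_const _)]
      simp_rw [mul_comm (ψ _ _), pd_const_mul (dψ _)]
      ring
    simp_rw [this, Finset.sum_add_distrib]
    simp
  have e2 : pd j (fun y => ∑ c, Christoffel gbar c i c y) x =
      pd j (fun y => ∑ c, Christoffel g c i c y) x + (n + 1) * pd j (ψ i) x := by
    rw [pd_congr hU (fun y hy => hgeo.sum_christoffel i hy) hx,
      pd_add (DifferentiableAt.fun_sum fun c _ => dΓ c i c) ((dψ i).const_mul _),
      pd_const_mul (dψ i)]
  have sy := fun h i j => hg.christoffel_symm hU h i j hx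
  have e3 : ∑ c, ∑ b, Christoffel gbar c c b x * Christoffel gbar b i j x =
      ∑ c, ∑ b, Christoffel g c c b x * Christoffel g b i j x
      + ψ i x * ∑ c, Christoffel g c j c x + ψ j x * ∑ c, Christoffel g c i c x
      + (n + 1) * ∑ c, Christoffel g c i j x * ψ c x + 2 * (n + 1) * (ψ i x * ψ j x) := by
    have hs : ∀ b, ∑ c, Christoffel gbar c c b x =
        ∑ c, Christoffel g c b c x + (n + 1) * ψ b x := fun b => by
      simp_rw [hgeo _ _ _ x hx, sy _ _ b, Finset.sum_add_distrib]
      simp; ring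
    rw [Finset.sum_comm]
    simp_rw [← Finset.sum_mul, hs, hgeo _ i j x hx]
    exact sum_projective_change_trace sy (fun i => ψ i x) i j
  have e4 : ∑ c, ∑ b, Christoffel gbar c j b x * Christoffel gbar b i c x =
      ∑ c, ∑ b, Christoffel g c j b x * Christoffel g b i c x
      + ψ i x * ∑ c, Christoffel g c j c x + ψ j x * ∑ c, Christoffel g c i c x
      + 2 * ∑ c, Christoffel g c i j x * ψ c x + (n + 3) * (ψ i x * ψ j x) := by
    simp_rw [hgeo _ _ _ x hx]
    exact sum_projective_change_mul sy (fun i => ψ i x) i j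
  rw [Ricci, Ricci, e1, e2, e3, e4, hcl]
  ring

theorem IsSinyukov.pd_trUp (hav : IsSinyukov g U a v) (hU : IsOpen U) (hg : IsMetric 1 g U)
    (k : Fin n) {x : Fin n → ℝ} (hx : x ∈ U) :
    pd k (trUp g a) x = 2 * ∑ h, v h x * g h k x := by
  have dg := fun i j => hg.differentiableAt one_ne_zero hU i j hx
  have da : ∀ i j, DifferentiableAt ℝ (a i j) x := fun i j =>
    ((hav.contDiffOn i j).differentiableOn one_ne_zero).differentiableAt (hU.mem_nhds hx)
  have e : pd k (trUp g a) x =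
      ∑ i, ∑ j, (g i j x * pd k (a i j) x + a i j x * pd k (g i j) x) := by
    unfold trUp
    rw [pd_sum fun i _ => DifferentiableAt.fun_sum fun j _ => (dg i j).fun_mul (da i j)]
    refine Finset.sum_congr rfl fun i _ => ?_
    rw [pd_sum fun j _ => (dg i j).fun_mul (da i j)]
    simp_rw [pd_mul (dg _ _) (da _ _)]
  rw [e]
  simp_rw [hav.pd_eq k _ _ x hx, hg.pd_eq hU k _ _ hx]
  simp only [mul_add, mul_sub, mul_neg, Finset.sum_add_distrib, Finset.sum_sub_distrib,
    Finset.sum_neg_distrib]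
  have t1 : ∑ i, ∑ j, g i j x * ∑ c, Christoffel g i k c x * a c j x =
      ∑ i, ∑ j, a i j x * ∑ c, Christoffel g c k i x * g c j x := by
    rw [Finset.sum_comm, Finset.sum_comm (γ := Fin n) (f := fun i j => a i j x * _)]
    refine Finset.sum_congr rfl fun j _ => ?_
    simp_rw [Finset.mul_sum]
    rw [Finset.sum_comm]
    exact Finset.sum_congr rfl fun i _ => Finset.sum_congr rfl fun c _ => by ring
  have t2 : ∑ i, ∑ j, g i j x * ∑ c, Christoffel g j k c x * a i c x =
      ∑ i, ∑ j, a i j x * ∑ c, Christoffel g c k j x * g i c x := by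
    refine Finset.sum_congr rfl fun i _ => ?_
    simp_rw [Finset.mul_sum]
    rw [Finset.sum_comm]
    exact Finset.sum_congr rfl fun j _ => Finset.sum_congr rfl fun c _ => by ring
  have t3 : ∑ i, ∑ j, g i j x * (v i x * (if j = k then 1 else 0)) = ∑ h, v h x * g h k x := by
    simp [mul_comm]
  have t4 : ∑ i, ∑ j, g i j x * (v j x * (if i = k then 1 else 0)) = ∑ h, v h x * g h k x := by
    rw [Finset.sum_comm]
    simp_rw [hg.symm _ k x hx]
    simp [mul_comm]
  rw [t1, t2, t3, t4]
  ring

/-- The function `σ + ψ_h v^h` is a multiple of the weight of the geodesic mapping. -/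
theorem GeodesicallyRelated.pd_curvature (hgeo : GeodesicallyRelated g gbar ψ U)
    (hU : IsOpen U) (hg : IsMetric 1 g U) (hgbar : IsMetric 1 gbar U)
    (hψ : ∀ i, ContDiffOn ℝ 1 (ψ i) U) {x : Fin n → ℝ} (hx : x ∈ U)
    (hv : ∀ h, HasFDerivAt (geodesicVector g gbar ψ h)
      (covec fun k => vDeriv g (geodesicTensor g gbar) (geodesicVector g gbar ψ) K
        (fun y => C - K * trUp g (geodesicTensor g gbar) y) (fun _ _ _ => 0) h k x) x) :
    DifferentiableAt ℝ (fun y => C - K * trUp g (geodesicTensor g gbar) y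
      + ∑ h, ψ h y * geodesicVector g gbar ψ h y) x ∧
    ∀ k, pd k (fun y => C - K * trUp g (geodesicTensor g gbar) y
      + ∑ h, ψ h y * geodesicVector g gbar ψ h y) x =
    2 * (C - K * trUp g (geodesicTensor g gbar) x
      + ∑ h, ψ h x * geodesicVector g gbar ψ h x) * ψ k x := by
  have hav := hgeo.isSinyukov hU hg hgbar fun i => (hψ i).continuousOn
  have dψ : ∀ i, DifferentiableAt ℝ (ψ i) x := fun i =>
    ((hψ i).differentiableOn one_ne_zero).differentiableAt (hU.mem_nhds hx)
  have dv := fun h => (hv h).differentiableAt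
  have dt : DifferentiableAt ℝ (trUp g (geodesicTensor g gbar)) x :=
    ((contDiffOn_trUp hg.contDiff hav.contDiffOn).differentiableOn one_ne_zero).differentiableAt
      (hU.mem_nhds hx)
  have dc : DifferentiableAt ℝ (fun y => C - K * trUp g (geodesicTensor g gbar) y) x :=
    (differentiableAt_const C).fun_sub (dt.const_mul K)
  have ds : DifferentiableAt ℝ (fun y => ∑ h, ψ h y * geodesicVector g gbar ψ h y) x :=
    DifferentiableAt.fun_sum fun h _ => (dψ h).fun_mul (dv h)
  refine ⟨dc.fun_add ds, fun k => ?_⟩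
  rw [pd_add dc ds, pd_sub (differentiableAt_const C) (dt.const_mul K), pd_const, pd_const_mul dt,
    hav.pd_trUp hU hg k hx, pd_sum fun h _ => (dψ h).fun_mul (dv h)]
  simp_rw [pd_mul (dψ _) (dv _), pd_eq_of_hasFDerivAt (hv _) k, hgeo.pd_form hU hg hgbar hx hv,
    vDeriv]
  have f := form_eq_geodesicVector (g := g) (ψ := ψ) hgbar k hx
  have sb := fun h => geodesicCotensor_symm (g := g) hgbar h k hx
  have hα := fun h l => hav.symm h l x hx
  have hu : ∀ h, geodesicVector g gbar ψ h x = -∑ c, geodesicTensor g gbar h c x * ψ c x :=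
    fun h => rfl
  generalize C - K * trUp g (geodesicTensor g gbar) x = σ
  have t1 : ∑ h, ψ h x * ∑ c, Christoffel g h k c x * geodesicVector g gbar ψ c x =
      ∑ h, geodesicVector g gbar ψ h x * ∑ c, Christoffel g c k h x * ψ c x := by
    simp_rw [Finset.mul_sum]
    rw [Finset.sum_comm]
    exact Finset.sum_congr rfl fun c _ => Finset.sum_congr rfl fun h _ => by ring
  have t2 : ∑ h, ψ h x * (K * ∑ c, geodesicTensor g gbar h c x * g c k x) =
      -(K * ∑ h, geodesicVector g gbar ψ h x * g h k x) := by
    simp_rw [hu, neg_mul, Finset.sum_neg_distrib, mul_neg, neg_neg, mul_left_comm _ K,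
      ← Finset.mul_sum, Finset.mul_sum, Finset.sum_mul]
    rw [Finset.sum_comm]
    refine Finset.sum_congr rfl fun c _ => ?_
    rw [Finset.mul_sum]
    refine Finset.sum_congr rfl fun h _ => ?_
    rw [hα h c]; ring
  have t3 : ∑ h, ψ h x * (σ * (if h = k then 1 else 0)) = σ * ψ k x := by
    simp [mul_comm]
  have t4 : ∑ h, geodesicVector g gbar ψ h x * (ψ h x * ψ k x) =
      (∑ h, ψ h x * geodesicVector g gbar ψ h x) * ψ k x := by
    rw [Finset.sum_mul]
    exact Finset.sum_congr rfl fun h _ => by ring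
  have t5 : ∑ h, geodesicVector g gbar ψ h x * (K * g h k x) =
      K * ∑ h, geodesicVector g gbar ψ h x * g h k x := by
    simp_rw [mul_left_comm _ K, ← Finset.mul_sum]
  have t6 : ∀ ρ : ℝ, ∑ h, geodesicVector g gbar ψ h x * (ρ * geodesicCotensor g gbar h k x) =
      -(ρ * ψ k x) := by
    intro ρ
    rw [f, mul_neg, neg_neg, Finset.mul_sum]
    refine Finset.sum_congr rfl fun h _ => ?_
    rw [sb h]; ring
  simp only [mul_zero, Finset.sum_const_zero, add_zero]
  simp only [mul_add, mul_sub, mul_neg, Finset.sum_add_distrib, Finset.sum_sub_distrib,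
    Finset.sum_neg_distrib, t1, t2, t3, t4, t5]
  simp only [← mul_add, t6]
  ring

end Curvature

end Analysis

/-- If an Einstein metric `g ∈ C^2` admits a nontrivial geodesic mapping onto a metric
`ḡ ∈ C^1` on an open connected `U ⊆ ℝⁿ` (`n ≥ 2`), then `ḡ ∈ C^2` and `ḡ` is Einstein. -/
theorem einstein_geodesic_C1
    {n : ℕ} (hn : 2 ≤ n) (U : Set (Fin n → ℝ)) (hU : IsOpen U) (hUc : IsConnected U)
    (g gbar : Fin n → Fin n → (Fin n → ℝ) → ℝ)
    (hg : IsMetric 2 g U) (hgbar : IsMetric 1 gbar U)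
    (hEin : ∃ c : ℝ, ∀ i j, ∀ x ∈ U, Ricci g i j x = c * g i j x)
    (ψ : Fin n → (Fin n → ℝ) → ℝ) (hψ : ∀ i, ContinuousOn (ψ i) U)
    (hgeo : GeodesicallyRelated g gbar ψ U)
    (hnontriv : ¬ ∀ i, ∀ x ∈ U, ψ i x = 0) :
    (∀ i j, ContDiffOn ℝ 2 (gbar i j) U) ∧
      ∃ cbar : ℝ, ∀ i j, ∀ x ∈ U, Ricci gbar i j x = cbar * gbar i j x := by
  obtain ⟨c, hc⟩ := hEin
  have hn1 : (n : ℝ) - 1 ≠ 0 := by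
    have : (2 : ℝ) ≤ n := by exact_mod_cast hn
    linarith
  set K : ℝ := c / (n - 1) with hK
  have hcK : ((n : ℝ) - 1) * K = c := by rw [hK]; field_simp
  have hE : ∀ i j, ∀ x ∈ U, Ricci g i j x = ((n - 1) * K) * g i j x := by rwa [hcK]
  have hg1 : IsMetric 1 g U := ⟨hg.symm, fun i j => (hg.contDiff i j).of_le (by norm_num), hg.inv⟩
  have hav := hgeo.isSinyukov hU hg1 hgbar hψ
  obtain ⟨p, hp, h₀, hv₀⟩ : ∃ p ∈ U, ∃ h, geodesicVector g gbar ψ h p ≠ 0 := by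
    by_contra! H
    refine hnontriv fun i x hx => ?_
    rw [form_eq_geodesicVector (g := g) (ψ := ψ) hgbar i hx]
    simp [H x hx]
  obtain ⟨C, hv⟩ := exists_prolongation hn hU hUc.isPreconnected hg hE hav hp hv₀
  have hψ1 := contDiffOn_form hg1 hgbar (hav.contDiffOn_vector hU hg hv)
  have hgbar2 := hgeo.isMetric_two hU hg hgbar hψ1
  refine ⟨hgbar2.contDiff, ?_⟩
  let ρ : (Fin n → ℝ) → ℝ := fun y => C - K * trUp g (geodesicTensor g gbar) y
      + ∑ h, ψ h y * geodesicVector g gbar ψ h y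
  have hpψ : ∀ x ∈ U, ∀ k i, pd k (ψ i) x = ∑ c, Christoffel g c k i x * ψ c x + ψ i x * ψ k x
      + K * g i k x - ρ x * geodesicCotensor g gbar i k x := fun x hx k i =>
    hgeo.pd_form hU hg1 hgbar hx (hv x hx) k i
  have hκ : ∀ x ∈ U, DifferentiableAt ℝ (fun y => ρ y * geodesicWeight gbar g y) x ∧
      fderiv ℝ (fun y => ρ y * geodesicWeight gbar g y) x = 0 := by
    intro x hx
    obtain ⟨dρ, pρ⟩ := hgeo.pd_curvature hU hg1 hgbar hψ1 hx (hv x hx)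
    have dw : DifferentiableAt ℝ (geodesicWeight gbar g) x :=
      ((contDiffOn_geodesicWeight hgbar hg1).differentiableOn one_ne_zero).differentiableAt
        (hU.mem_nhds hx)
    refine ⟨dρ.fun_mul dw, ?_⟩
    rw [fderiv_eq_covec]
    have : ∀ k, pd k (fun y => ρ y * geodesicWeight gbar g y) x = 0 := fun k => by
      rw [pd_mul dρ dw, pρ k, hgeo.swap.pd_geodesicWeight hU hgbar hg1 k hx]
      ring
    simp [this, covec]
  obtain ⟨κ, hκ⟩ := hU.exists_is_const_of_fderiv_eq_zero hUc.isPreconnected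
    (fun x hx => (hκ x hx).1.differentiableWithinAt) (fun x hx => (hκ x hx).2)
  refine ⟨(n - 1) * κ, fun i j x hx => ?_⟩
  have hΓ : ∑ c, Christoffel g c j i x * ψ c x = ∑ c, Christoffel g c i j x * ψ c x := by
    simp_rw [hg.christoffel_symm hU _ j i hx]
  rw [hgeo.ricci_eq hU hg hψ1 i j hx, hpψ x hx j i, hE i j x hx, hΓ, ← hκ x hx, geodesicCotensor]
  · ring
  · rw [hpψ x hx i j, hpψ x hx j i, hΓ, hg.symm j i x hx, geodesicCotensor_symm hgbar j i hx]
    ring
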